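/- Let β>0 and let h:ℝ→ℝ be a real analytic and even Schwartz function. Then there exists a constant α^h ≥ 0 such that for all real analytic, strongly convex and even functions Q:ℝ→ℝ with α_Q > α^h the following holds: the first correlation measure ρ_{N,Q,β}^{h,1}(t)dt of P_{N,Q,β}^h converges weakly, as N→∞, to a compactly supported probability measure μ_{Q,β}^h which has a non-zero continuous density on the interior of its support; that is, for every bounded continuous f:ℝ→ℝ, lim_{N→∞} ∫ f(t) ρ_{N,Q,β}^{h,1}(t) dt = ∫ f(t) μ_{Q,β}^h(t) dt. -/

import Mathlib

open MeasureTheory Real Filter Finset Topology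

noncomputable section

/-- Product over pairs `i < j` of `|x i - x j| ^ β` (the β-Vandermonde interaction). -/
def vdm (β : ℝ) {N : ℕ} (x : Fin N → ℝ) : ℝ :=
  ∏ p ∈ Finset.univ.filter (fun p : Fin N × Fin N => p.1 < p.2), |x p.1 - x p.2| ^ β

/-- Sum over pairs `i < j` of `g (x i - x j)`. -/
def pairSum {N : ℕ} (g : ℝ → ℝ) (x : Fin N → ℝ) : ℝ :=
  ∑ p ∈ Finset.univ.filter (fun p : Fin N × Fin N => p.1 < p.2), g (x p.1 - x p.2)

/-- Unnormalized density of `P_{N,Q,β}^h`. -/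
def weightH (β : ℝ) (Q g : ℝ → ℝ) (N : ℕ) (x : Fin N → ℝ) : ℝ :=
  vdm β x * Real.exp (-(N : ℝ) * ∑ j, Q (x j) - pairSum g x)

/-- Normalization constant `Z_{N,Q,β}^h`. -/
def ZH (β : ℝ) (Q g : ℝ → ℝ) (N : ℕ) : ℝ := ∫ x : Fin N → ℝ, weightH β Q g N x

/-- The density `P_{N,Q,β}^h`. -/
def PH (β : ℝ) (Q g : ℝ → ℝ) (N : ℕ) (x : Fin N → ℝ) : ℝ := weightH β Q g N x / ZH β Q g N

/-- Unnormalized density of the β-ensemble `P_{N,V,β}`. -/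
def weightV (β : ℝ) (V : ℝ → ℝ) (N : ℕ) (x : Fin N → ℝ) : ℝ :=
  vdm β x * Real.exp (-(N : ℝ) * ∑ j, V (x j))

/-- Normalization constant `Z_{N,V,β}`. -/
def ZV (β : ℝ) (V : ℝ → ℝ) (N : ℕ) : ℝ := ∫ x : Fin N → ℝ, weightV β V N x

/-- The β-ensemble density `P_{N,V,β}`. -/
def PV (β : ℝ) (V : ℝ → ℝ) (N : ℕ) (x : Fin N → ℝ) : ℝ := weightV β V N x / ZV β V N

/-- Expectation w.r.t. `P_{N,Q,β}^h`. -/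
def EH (β : ℝ) (Q g : ℝ → ℝ) (N : ℕ) (f : (Fin N → ℝ) → ℝ) : ℝ :=
  ∫ x : Fin N → ℝ, f x * PH β Q g N x

/-- Expectation w.r.t. `P_{N,V,β}`. -/
def EV (β : ℝ) (V : ℝ → ℝ) (N : ℕ) (f : (Fin N → ℝ) → ℝ) : ℝ :=
  ∫ x : Fin N → ℝ, f x * PV β V N x

/-- `k`-th correlation function of a density `P` on `ℝ^N`. -/
def correlationFn (N k : ℕ) (P : (Fin N → ℝ) → ℝ) (t : Fin k → ℝ) : ℝ :=
  ∫ y : Fin (N - k) → ℝ,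
    P (fun i => if hik : (i : ℕ) < k then t ⟨(i : ℕ), hik⟩
        else y ⟨(i : ℕ) - k, by have := i.isLt; omega⟩)

/-- `f_μ(s) = ∫ f(t-s) dμ(t)`. -/
def fMu (g : ℝ → ℝ) (μ : Measure ℝ) (s : ℝ) : ℝ := ∫ t, g (t - s) ∂μ

/-- `f_{μμ} = ∬ f(t-s) dμ(t) dμ(s)`. -/
def fMuMu (g : ℝ → ℝ) (μ : Measure ℝ) : ℝ := ∫ s, fMu g μ s ∂μ

/-- The Hoeffding-remainder `U(x)`. -/
def UU (g : ℝ → ℝ) (μ : Measure ℝ) (N : ℕ) (x : Fin N → ℝ) : ℝ :=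
  -(1/2) * ∑ i, ∑ j, (g (x i - x j) - fMu g μ (x i) - fMu g μ (x j) + fMuMu g μ)

/-- The weighted logarithmic energy functional `I_{V,β}`. -/
def logEnergy (β : ℝ) (V : ℝ → ℝ) (μ : Measure ℝ) : ℝ :=
  ∫ t, V t ∂μ + β / 2 * ∫ s, ∫ t, Real.log |s - t|⁻¹ ∂μ ∂μ

/-- `μ` is the equilibrium measure to the external field `V` and `β`. -/
def IsEquilibriumMeasure (β : ℝ) (V : ℝ → ℝ) (μ : Measure ℝ) : Prop :=
  IsProbabilityMeasure μ ∧
    ∀ ν : Measure ℝ, IsProbabilityMeasure ν → logEnergy β V μ ≤ logEnergy β V ν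

/-- `α_Q = inf_t Q''(t)`. -/
def alphaQ (Q : ℝ → ℝ) : ℝ := ⨅ t : ℝ, iteratedDeriv 2 Q t

/-- `g` is (the restriction of) a Schwartz function. -/
def IsSchwartz (g : ℝ → ℝ) : Prop := ∃ H : SchwartzMap ℝ ℝ, ∀ t, H t = g t

/-- `g` is an even function. -/
def IsEvenFun (g : ℝ → ℝ) : Prop := ∀ t, g (-t) = g t

/-- Partial derivative in coordinate `j`. -/
def partialDeriv {N : ℕ} (f : (Fin N → ℝ) → ℝ) (j : Fin N) (x : Fin N → ℝ) : ℝ :=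
  deriv (fun s => f (Function.update x j s)) (x j)

/-- Dirichlet form `D_ω(f) = (2N)⁻¹ ∑_j ∫ (∂_j f)² dω`. -/
def dirichletForm {N : ℕ} (ω : Measure (Fin N → ℝ)) (f : (Fin N → ℝ) → ℝ) : ℝ :=
  (1 / (2 * (N : ℝ))) * ∑ j : Fin N, ∫ x, (partialDeriv f j x) ^ 2 ∂ω

/-- Relative entropy `S_ω(q) = ∫ q log q dω`. -/
def entropy {N : ℕ} (ω : Measure (Fin N → ℝ)) (q : (Fin N → ℝ) → ℝ) : ℝ :=
  ∫ x, q x * Real.log (q x) ∂ω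

/-- The measure with density `P_{N,V,β}`. -/
def measV (β : ℝ) (V : ℝ → ℝ) (N : ℕ) : Measure (Fin N → ℝ) :=
  volume.withDensity (fun x => ENNReal.ofReal (PV β V N x))

/-- `Z_{N,V,β,U}`. -/
def ZVU (β : ℝ) (V g : ℝ → ℝ) (μ : Measure ℝ) (N : ℕ) : ℝ :=
  ∫ x : Fin N → ℝ, vdm β x * Real.exp (-(N : ℝ) * ∑ j, V (x j) + UU g μ N x)

/-- probability of a set under `P_{N,V,β}`. -/
def ProbV (β : ℝ) (V : ℝ → ℝ) (N : ℕ) (A : Set (Fin N → ℝ)) : ℝ := ∫ x in A, PV β V N x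

/-- probability of a set under `P_{N,Q,β}^h`. -/
def ProbH (β : ℝ) (Q g : ℝ → ℝ) (N : ℕ) (A : Set (Fin N → ℝ)) : ℝ := ∫ x in A, PH β Q g N x


/-- Data of a limiting measure satisfying the loop equation. -/
structure LD (μ : Measure ℝ) (W : ℝ → ℝ) (β R c : ℝ) : Prop where
  prob : IsProbabilityMeasure μ
  hR : 0 < R
  supp : ∀ᵐ y ∂μ, |y| ≤ R
  hβ : 0 < β
  hc : 0 < c
  smooth : ContDiff ℝ 3 W
  mono : ∀ x, c ≤ deriv W x
  loop : ∀ z : ℂ, 0 < z.im →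
    (∫ y, (z - (y : ℂ))⁻¹ ∂μ) ^ 2 = ((2 / β : ℝ) : ℂ) * ∫ y, (W y : ℂ) * (z - (y : ℂ))⁻¹ ∂μ

/-- the point `x + iη` -/
def zz (x η : ℝ) : ℂ := ⟨x, η⟩

/-- Stieltjes transform. -/
def GG (μ : Measure ℝ) (x η : ℝ) : ℂ := ∫ y, (zz x η - (y : ℂ))⁻¹ ∂μ

lemma zz_sub_norm_ge (x η y : ℝ) : |η| ≤ ‖zz x η - (y : ℂ)‖ := by
  have := Complex.abs_im_le_norm (zz x η - (y : ℂ))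
  simpa [zz] using this

lemma zz_sub_norm_ge' (x η y : ℝ) : |x - y| ≤ ‖zz x η - (y : ℂ)‖ := by
  have := Complex.abs_re_le_norm (zz x η - (y : ℂ))
  simpa [zz] using this

lemma zz_sub_ne (x : ℝ) {η : ℝ} (hη : 0 < η) (y : ℝ) : zz x η - (y : ℂ) ≠ 0 := by
  intro h
  have := zz_sub_norm_ge x η y
  rw [h, norm_zero, abs_of_pos hη] at this
  linarith

lemma zz_inv_im (x η y : ℝ) : ((zz x η - (y : ℂ))⁻¹).im = - (η / ((x - y) ^ 2 + η ^ 2)) := by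
  rw [Complex.inv_im]
  simp [zz, Complex.normSq_apply]
  ring

lemma zz_inv_norm_le (x : ℝ) {η : ℝ} (hη : 0 < η) (y : ℝ) : ‖(zz x η - (y : ℂ))⁻¹‖ ≤ η⁻¹ := by
  rw [norm_inv]
  have := zz_sub_norm_ge x η y
  rw [abs_of_pos hη] at this
  exact inv_anti₀ hη this

lemma zz_inv_meas (x η : ℝ) : Measurable fun y : ℝ => (zz x η - (y : ℂ))⁻¹ :=
  (measurable_const.sub Complex.measurable_ofReal).inv

lemma integrable_of_bdd {μ : Measure ℝ} [IsFiniteMeasure μ] {E : Type*} [NormedAddCommGroup E]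
    {f : ℝ → E} (hf : AEStronglyMeasurable f μ) (C : ℝ) (h : ∀ᵐ y ∂μ, ‖f y‖ ≤ C) :
    Integrable f μ :=
  Integrable.of_bound hf C h

lemma GG_integrable {μ : Measure ℝ} [IsFiniteMeasure μ] (x : ℝ) {η : ℝ} (hη : 0 < η) :
    Integrable (fun y : ℝ => (zz x η - (y : ℂ))⁻¹) μ :=
  integrable_of_bdd (zz_inv_meas x η).aestronglyMeasurable η⁻¹
    (Eventually.of_forall fun y => zz_inv_norm_le x hη y)

/-- Lipschitz bound on compacts. -/
lemma lip_on {W : ℝ → ℝ} (hW : ContDiff ℝ 3 W) (T : ℝ) :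
    ∃ L, 0 ≤ L ∧ ∀ x y, |x| ≤ T → |y| ≤ T → |W x - W y| ≤ L * |x - y| := by
  have hd : Continuous (deriv W) := hW.continuous_deriv (by norm_num)
  obtain ⟨L, hL⟩ := (isCompact_Icc (a := -T) (b := T)).exists_bound_of_continuousOn hd.continuousOn
  refine ⟨max L 0, le_max_right _ _, fun x y hx hy => ?_⟩
  have := (convex_Icc (-T) T).norm_image_sub_le_of_norm_deriv_le (f := W) (C := max L 0)
    (fun u _ => (hW.differentiable (by norm_num)) u)
    (fun u hu => (hL u hu).trans (le_max_left _ _)) (abs_le.mp hy) (abs_le.mp hx)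
  simpa [Real.norm_eq_abs] using this

lemma W_bdd {W : ℝ → ℝ} (hW : ContDiff ℝ 3 W) (T : ℝ) :
    ∃ L, 0 ≤ L ∧ ∀ x, |x| ≤ T → |W x| ≤ L := by
  obtain ⟨L, hL⟩ := (isCompact_Icc (a := -T) (b := T)).exists_bound_of_continuousOn
    hW.continuous.continuousOn
  exact ⟨max L 0, le_max_right _ _, fun x hx => (hL x (abs_le.mp hx)).trans (le_max_left _ _)⟩

/-- divided difference integral -/
def DD (μ : Measure ℝ) (W : ℝ → ℝ) (x η : ℝ) : ℂ :=
  ∫ y, ((W x - W y : ℝ) : ℂ) * (zz x η - (y : ℂ))⁻¹ ∂μ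

lemma DD_bound_pt {W : ℝ → ℝ} {L T : ℝ} (hL0 : 0 ≤ L)
    (hL : ∀ x y, |x| ≤ T → |y| ≤ T → |W x - W y| ≤ L * |x - y|) {x η y : ℝ} (hη : 0 < η)
    (hx : |x| ≤ T) (hy : |y| ≤ T) :
    ‖((W x - W y : ℝ) : ℂ) * (zz x η - (y : ℂ))⁻¹‖ ≤ L := by
  have h0 : 0 < ‖zz x η - (y : ℂ)‖ := norm_pos_iff.mpr (zz_sub_ne x hη y)
  rw [norm_mul, norm_inv, Complex.norm_real, Real.norm_eq_abs, ← div_eq_mul_inv, div_le_iff₀ h0]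
  exact (hL x y hx hy).trans (mul_le_mul_of_nonneg_left (zz_sub_norm_ge' x η y) hL0)

lemma W_int {μ : Measure ℝ} {W : ℝ → ℝ} {β R c : ℝ} (H : LD μ W β R c) (x : ℝ) {η : ℝ}
    (hη : 0 < η) : Integrable (fun y : ℝ => (W y : ℂ) * (zz x η - (y : ℂ))⁻¹) μ := by
  have := H.prob
  obtain ⟨B, hB0, hB⟩ := W_bdd H.smooth R
  refine integrable_of_bdd ?_ (B * η⁻¹) ?_
  · exact ((Complex.measurable_ofReal.comp H.smooth.continuous.measurable).mul
      (zz_inv_meas x η)).aestronglyMeasurable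
  · filter_upwards [H.supp] with y hy
    rw [norm_mul, Complex.norm_real]
    exact mul_le_mul (hB y hy) (zz_inv_norm_le x hη y) (norm_nonneg _) hB0

lemma quad {μ : Measure ℝ} {W : ℝ → ℝ} {β R c : ℝ} (H : LD μ W β R c) (x : ℝ) {η : ℝ}
    (hη : 0 < η) : (GG μ x η - ((W x / β : ℝ) : ℂ)) ^ 2 =
      (((W x) ^ 2 / β ^ 2 : ℝ) : ℂ) - ((2 / β : ℝ) : ℂ) * DD μ W x η := by
  have := H.prob
  have h1 : DD μ W x η = (W x : ℂ) * GG μ x η - ∫ y, (W y : ℂ) * (zz x η - (y : ℂ))⁻¹ ∂μ := by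
    unfold DD GG
    rw [← integral_const_mul, ← integral_sub ((GG_integrable x hη).const_mul _) (W_int H x hη)]
    congr 1
    ext y
    push_cast
    ring
  have h2 := H.loop (zz x η) hη
  rw [h1]
  have hb : (β : ℂ) ≠ 0 := by exact_mod_cast H.hβ.ne'
  unfold GG
  push_cast at h2 ⊢
  rw [mul_sub, ← h2]
  field_simp
  ring

lemma GG_bound {μ : Measure ℝ} {W : ℝ → ℝ} {β R c : ℝ} (H : LD μ W β R c) (T : ℝ) :
    ∃ C, ∀ x η, |x| ≤ T → 0 < η → ‖GG μ x η‖ ≤ C := by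
  have := H.prob
  set T' := max T R
  obtain ⟨L, hL0, hL⟩ := lip_on H.smooth T'
  obtain ⟨B, hB0, hB⟩ := W_bdd H.smooth T'
  have hβ := H.hβ
  refine ⟨√(B ^ 2 / β ^ 2 + 2 / β * L) + B / β, fun x η hx hη => ?_⟩
  have hx' : |x| ≤ T' := hx.trans (le_max_left _ _)
  have hD : ‖DD μ W x η‖ ≤ L := by
    have := norm_integral_le_of_norm_le_const (μ := μ) (C := L)
      (f := fun y => ((W x - W y : ℝ) : ℂ) * (zz x η - (y : ℂ))⁻¹) (by
        filter_upwards [H.supp] with y hy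
        exact DD_bound_pt hL0 hL hη hx' (hy.trans (le_max_right _ _)))
    simpa [DD] using this
  have hW : |W x| ≤ B := hB x hx'
  have h1 : ‖GG μ x η - ((W x / β : ℝ) : ℂ)‖ ≤ √(B ^ 2 / β ^ 2 + 2 / β * L) := by
    apply Real.le_sqrt_of_sq_le
    rw [← norm_pow, quad H x hη]
    refine (norm_sub_le _ _).trans ?_
    rw [norm_mul, Complex.norm_real, Complex.norm_real, Real.norm_eq_abs, Real.norm_eq_abs,
      abs_of_pos (by positivity : 0 < 2 / β), abs_of_nonneg (by positivity)]
    have : W x ^ 2 ≤ B ^ 2 := by rw [← sq_abs]; gcongr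
    gcongr
  have h2 : ‖((W x / β : ℝ) : ℂ)‖ ≤ B / β := by
    rw [Complex.norm_real, Real.norm_eq_abs, abs_div, abs_of_pos hβ]
    gcongr
  calc ‖GG μ x η‖ = ‖(GG μ x η - ((W x / β : ℝ) : ℂ)) + ((W x / β : ℝ) : ℂ)‖ := by simp
    _ ≤ _ := (norm_add_le _ _).trans (add_le_add h1 h2)

/-- minus imaginary part -/
def vv (μ : Measure ℝ) (x η : ℝ) : ℝ := ∫ y, η / ((x - y) ^ 2 + η ^ 2) ∂μ

lemma GG_im {μ : Measure ℝ} [IsFiniteMeasure μ] (x : ℝ) {η : ℝ} (hη : 0 < η) :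
    (GG μ x η).im = - vv μ x η := by
  have h1 : (GG μ x η).im = ∫ y, ((zz x η - (y : ℂ))⁻¹).im ∂μ :=
    (integral_im (𝕜 := ℂ) (GG_integrable x hη)).symm
  rw [h1, vv, ← integral_neg]
  congr 1
  ext y
  exact zz_inv_im x η y

lemma vv_nonneg {μ : Measure ℝ} (x : ℝ) {η : ℝ} (hη : 0 < η) : 0 ≤ vv μ x η :=
  integral_nonneg fun y => by positivity

lemma vv_integrable {μ : Measure ℝ} [IsFiniteMeasure μ] (x : ℝ) {η : ℝ} (hη : 0 < η) :
    Integrable (fun y => η / ((x - y) ^ 2 + η ^ 2)) μ := by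
  have := (GG_integrable (μ := μ) x hη).im.neg
  refine this.congr (Eventually.of_forall fun y => ?_)
  have := zz_inv_im x η y
  simp only [Pi.neg_apply]
  change - ((zz x η - (y : ℂ))⁻¹).im = _
  rw [this, neg_neg]

lemma vv_bound {μ : Measure ℝ} {W : ℝ → ℝ} {β R c : ℝ} (H : LD μ W β R c) (T : ℝ) :
    ∃ C, 0 ≤ C ∧ ∀ x η, |x| ≤ T → 0 < η → vv μ x η ≤ C := by
  have := H.prob
  obtain ⟨C, hC⟩ := GG_bound H T
  refine ⟨max C 0, le_max_right _ _, fun x η hx hη => ?_⟩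
  have h1 := Complex.abs_im_le_norm (GG μ x η)
  rw [GG_im x hη, abs_neg, abs_of_nonneg (vv_nonneg x hη)] at h1
  exact (h1.trans (hC x η hx hη)).trans (le_max_left _ _)

lemma no_atom {μ : Measure ℝ} {W : ℝ → ℝ} {β R c : ℝ} (H : LD μ W β R c) (x : ℝ) :
    ∀ᵐ y ∂μ, y ≠ x := by
  have := H.prob
  obtain ⟨C, hC0, hC⟩ := vv_bound H |x|
  have key : ∀ η > 0, μ.real {x} ≤ C * η := by
    intro η hη
    have h1 : ∫ y, Set.indicator {x} (fun _ => η⁻¹) y ∂μ ≤ vv μ x η := by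
      refine integral_mono ?_ (vv_integrable x hη) ?_
      · exact (integrable_const _).indicator (measurableSet_singleton x)
      · intro y
        by_cases hy : y = x
        · subst hy
          simp
          field_simp
          exact le_rfl
        · simp [hy]
          positivity
    rw [integral_indicator (measurableSet_singleton x)] at h1
    simp only [integral_const, smul_eq_mul, measureReal_restrict_apply_univ] at h1
    have h2 := h1.trans (hC x η le_rfl hη)
    rwa [← div_eq_mul_inv, div_le_iff₀ hη] at h2
  have h0 : μ.real {x} ≤ 0 := by
    by_contra hcon
    push Not at hcon
    have := key (μ.real {x} / (2 * (C + 1))) (by positivity)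
    have h3 : C * (μ.real {x} / (2 * (C + 1))) < μ.real {x} := by
      rw [mul_div_assoc', div_lt_iff₀ (by positivity)]
      nlinarith
    linarith
  have h1 : μ {x} = 0 := by
    have : μ.real {x} = 0 := le_antisymm h0 measureReal_nonneg
    exact (measureReal_eq_zero_iff).mp this
  rw [ae_iff]
  simpa using h1

/-- divided difference -/
def kk (W : ℝ → ℝ) (x y : ℝ) : ℝ := (W x - W y) / (x - y)

def PP (μ : Measure ℝ) (W : ℝ → ℝ) (x : ℝ) : ℝ := ∫ y, kk W x y ∂μ

def SS (μ : Measure ℝ) (W : ℝ → ℝ) (β x : ℝ) : ℝ := 2 / β * PP μ W x - (W x) ^ 2 / β ^ 2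

lemma kk_bound {W : ℝ → ℝ} {L T : ℝ} (hL0 : 0 ≤ L)
    (hL : ∀ x y, |x| ≤ T → |y| ≤ T → |W x - W y| ≤ L * |x - y|) {x y : ℝ}
    (hx : |x| ≤ T) (hy : |y| ≤ T) : |kk W x y| ≤ L := by
  unfold kk
  rw [abs_div]
  exact div_le_of_le_mul₀ (abs_nonneg _) hL0 (hL x y hx hy)

lemma kk_meas {W : ℝ → ℝ} (hW : Continuous W) (x : ℝ) : Measurable (kk W x) := by
  unfold kk
  exact (measurable_const.sub hW.measurable).div (measurable_const.sub measurable_id)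

lemma PP_cont {μ : Measure ℝ} {W : ℝ → ℝ} {β R c : ℝ} (H : LD μ W β R c) :
    Continuous (PP μ W) := by
  have := H.prob
  rw [continuous_iff_continuousAt]
  intro x
  set T := max (|x| + 1) R
  obtain ⟨L, hL0, hL⟩ := lip_on H.smooth T
  refine continuousAt_of_dominated (bound := fun _ => L) ?_ ?_ (integrable_const _) ?_
  · exact Eventually.of_forall fun x' => (kk_meas H.smooth.continuous x').aestronglyMeasurable
  · have : ∀ᶠ x' in 𝓝 x, |x'| < |x| + 1 :=
      (continuous_abs.tendsto x).eventually_lt_const (by linarith)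
    filter_upwards [this] with x' hx'
    filter_upwards [H.supp] with y hy
    exact kk_bound hL0 hL (hx'.le.trans (le_max_left _ _)) (hy.trans (le_max_right _ _))
  · filter_upwards [no_atom H x] with y hy
    unfold kk
    exact (H.smooth.continuous.continuousAt.sub continuousAt_const).div
      (continuousAt_id.sub continuousAt_const) (sub_ne_zero.mpr (Ne.symm hy))

lemma SS_cont {μ : Measure ℝ} {W : ℝ → ℝ} {β R c : ℝ} (H : LD μ W β R c) :
    Continuous (SS μ W β) := by
  unfold SS
  exact ((PP_cont H).const_mul _ |>.sub ((H.smooth.continuous.pow 2).div_const _))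

lemma zz_tendsto (x y : ℝ) :
    Tendsto (fun η : ℝ => zz x η - (y : ℂ)) (𝓝[>] 0) (𝓝 ((x - y : ℝ) : ℂ)) := by
  have : Continuous fun η : ℝ => zz x η - (y : ℂ) := by
    have h : (fun η : ℝ => zz x η - (y : ℂ)) = fun η : ℝ => (x : ℂ) + η * Complex.I - y := by
      ext η
      apply Complex.ext <;> simp [zz]
    rw [h]
    fun_prop
  have h2 := (this.tendsto 0).mono_left (nhdsWithin_le_nhds (s := Set.Ioi 0))
  convert h2 using 2
  apply Complex.ext <;> simp [zz]

lemma DD_tendsto {μ : Measure ℝ} {W : ℝ → ℝ} {β R c : ℝ} (H : LD μ W β R c) (x : ℝ) :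
    Tendsto (fun η => DD μ W x η) (𝓝[>] 0) (𝓝 ((PP μ W x : ℝ) : ℂ)) := by
  have := H.prob
  set T := max (|x| + 1) R
  obtain ⟨L, hL0, hL⟩ := lip_on H.smooth T
  have h1 : ((PP μ W x : ℝ) : ℂ) = ∫ y, ((kk W x y : ℝ) : ℂ) ∂μ := by
    rw [PP, integral_complex_ofReal]
  rw [h1]
  refine tendsto_integral_filter_of_dominated_convergence (fun _ => L) ?_ ?_ (integrable_const _) ?_
  · exact Eventually.of_forall fun η => ((Complex.measurable_ofReal.comp
      (measurable_const.sub H.smooth.continuous.measurable)).mul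
      (zz_inv_meas x η)).aestronglyMeasurable
  · filter_upwards [self_mem_nhdsWithin] with η hη
    filter_upwards [H.supp] with y hy
    exact DD_bound_pt hL0 hL hη (le_trans (by linarith) (le_max_left _ _)) (hy.trans (le_max_right _ _))
  · filter_upwards [no_atom H x] with y hy
    have h2 : ((x - y : ℝ) : ℂ) ≠ 0 := by
      exact_mod_cast (sub_ne_zero.mpr (Ne.symm hy))
    have := ((zz_tendsto x y).inv₀ h2).const_mul ((W x - W y : ℝ) : ℂ)
    convert this using 2
    unfold kk
    push_cast
    rw [div_eq_mul_inv]

lemma im_sq (w : ℂ) : w.im ^ 2 = (‖w ^ 2‖ - (w ^ 2).re) / 2 := by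
  rw [norm_pow, Complex.sq_norm, Complex.normSq_apply, sq w, Complex.mul_re]
  ring

lemma vv_sq_tendsto {μ : Measure ℝ} {W : ℝ → ℝ} {β R c : ℝ} (H : LD μ W β R c) (x : ℝ) :
    Tendsto (fun η => vv μ x η) (𝓝[>] 0) (𝓝 (√((|SS μ W β x| + SS μ W β x) / 2))) := by
  have := H.prob
  have h1 : Tendsto (fun η => (GG μ x η - ((W x / β : ℝ) : ℂ)) ^ 2) (𝓝[>] 0)
      (𝓝 ((-SS μ W β x : ℝ) : ℂ)) := by
    have h2 : Tendsto (fun η => (((W x) ^ 2 / β ^ 2 : ℝ) : ℂ) - ((2 / β : ℝ) : ℂ) * DD μ W x η)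
      (𝓝[>] 0) (𝓝 ((((W x) ^ 2 / β ^ 2 : ℝ) : ℂ) - ((2 / β : ℝ) : ℂ) * ((PP μ W x : ℝ) : ℂ))) :=
      tendsto_const_nhds.sub ((DD_tendsto H x).const_mul _)
    have h3 : ((-SS μ W β x : ℝ) : ℂ) =
        (((W x) ^ 2 / β ^ 2 : ℝ) : ℂ) - ((2 / β : ℝ) : ℂ) * ((PP μ W x : ℝ) : ℂ) := by
      unfold SS; push_cast; ring
    rw [h3]
    refine h2.congr' ?_
    filter_upwards [self_mem_nhdsWithin] with η hη
    exact (quad H x hη).symm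
  have h4 := ((h1.norm).sub (Complex.continuous_re.continuousAt.tendsto.comp h1)).div_const 2
  have h5 := h4.sqrt
  have e1 : (‖((-SS μ W β x : ℝ) : ℂ)‖ - (((-SS μ W β x : ℝ) : ℂ)).re) / 2 =
      (|SS μ W β x| + SS μ W β x) / 2 := by
    rw [Complex.norm_real, Complex.ofReal_re, Real.norm_eq_abs, abs_neg]; ring
  rw [e1] at h5
  refine h5.congr' ?_
  filter_upwards [self_mem_nhdsWithin] with η hη
  simp only [Function.comp]
  rw [← im_sq, Complex.sub_im, Complex.ofReal_im, sub_zero, GG_im x hη, neg_sq,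
    Real.sqrt_sq (vv_nonneg x hη)]

/-- the density -/
def gg (μ : Measure ℝ) (W : ℝ → ℝ) (β x : ℝ) : ℝ := √((|SS μ W β x| + SS μ W β x) / 2) / π

lemma gg_cont {μ : Measure ℝ} {W : ℝ → ℝ} {β R c : ℝ} (H : LD μ W β R c) :
    Continuous (gg μ W β) := by
  unfold gg
  have := SS_cont H
  fun_prop

lemma gg_nonneg (μ : Measure ℝ) (W : ℝ → ℝ) (β x : ℝ) : 0 ≤ gg μ W β x := by
  unfold gg; positivity

lemma gg_zero {μ : Measure ℝ} {W : ℝ → ℝ} {β R c : ℝ} (H : LD μ W β R c) {x : ℝ} (hx : R < |x|) :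
    gg μ W β x = 0 := by
  have := H.prob
  have h1 : Tendsto (fun η => vv μ x η) (𝓝[>] 0) (𝓝 0) := by
    have hb : Tendsto (fun η : ℝ => η / (|x| - R) ^ 2) (𝓝[>] 0) (𝓝 0) := by
      have : Continuous fun η : ℝ => η / (|x| - R) ^ 2 := by fun_prop
      have h := (this.tendsto 0).mono_left (nhdsWithin_le_nhds (s := Set.Ioi 0))
      simpa using h
    refine tendsto_of_tendsto_of_tendsto_of_le_of_le' tendsto_const_nhds hb ?_ ?_
    · filter_upwards [self_mem_nhdsWithin] with η hη using vv_nonneg x hη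
    · filter_upwards [self_mem_nhdsWithin] with η (hη : 0 < η)
      have : vv μ x η ≤ ∫ y, η / (|x| - R) ^ 2 ∂μ := by
        refine integral_mono_ae (vv_integrable x hη) (integrable_const _) ?_
        filter_upwards [H.supp] with y hy
        have h3 : |x| - R ≤ |x - y| := by
          have := abs_sub_abs_le_abs_sub x y
          linarith
        have h4 : (|x| - R) ^ 2 ≤ (x - y) ^ 2 := by
          rw [← sq_abs (x - y)]
          have : 0 ≤ |x| - R := by linarith
          gcongr
        have h5 : 0 < (|x| - R) ^ 2 := by
          have : 0 < |x| - R := by linarith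
          positivity
        apply div_le_div_of_nonneg_left hη.le h5
        nlinarith
      simpa using this
  have := tendsto_nhds_unique h1 (vv_sq_tendsto H x)
  unfold gg
  rw [← this, zero_div]

lemma poisson_change (F : ℝ → ℝ) (y : ℝ) {η : ℝ} (hη : 0 < η) :
    ∫ x, F x * (η / ((x - y) ^ 2 + η ^ 2)) = ∫ s, F (y + η * s) * (1 + s ^ 2)⁻¹ := by
  rw [← integral_add_left_eq_self (fun x => F x * (η / ((x - y) ^ 2 + η ^ 2))) y]
  have h := Measure.integral_comp_mul_left
    (fun x => F (y + x) * (η / ((y + x - y) ^ 2 + η ^ 2))) η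
  rw [abs_of_pos (inv_pos.mpr hη), smul_eq_mul] at h
  have h2 : ∫ x, F (y + x) * (η / ((y + x - y) ^ 2 + η ^ 2)) =
      η * ∫ x, F (y + η * x) * (η / ((y + η * x - y) ^ 2 + η ^ 2)) := by
    rw [h, ← mul_assoc, mul_inv_cancel₀ hη.ne', one_mul]
  rw [h2, ← integral_const_mul]
  congr 1
  ext s
  have : (y + η * s - y) ^ 2 + η ^ 2 = η ^ 2 * (1 + s ^ 2) := by ring
  rw [this]
  have : (1 + s ^ 2) ≠ 0 := by positivity
  field_simp

lemma integrable_poisson_pair {μ : Measure ℝ} [IsProbabilityMeasure μ] {F : ℝ → ℝ} {T B : ℝ}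
    (hF : Measurable F) (hB : ∀ x, |F x| ≤ B) (hT : ∀ x, T < |x| → F x = 0) {η : ℝ} (hη : 0 < η) :
    Integrable (fun p : ℝ × ℝ => F p.1 * (η / ((p.1 - p.2) ^ 2 + η ^ 2))) (volume.prod μ) := by
  have hB0 : 0 ≤ B := (abs_nonneg _).trans (hB 0)
  have hdom : Integrable (fun p : ℝ × ℝ => (Set.Icc (-T) T).indicator (fun _ => B * η⁻¹) p.1 * 1)
      (volume.prod μ) := by
    refine Integrable.mul_prod (f := (Set.Icc (-T) T).indicator (fun _ => B * η⁻¹))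
      (g := fun _ => (1:ℝ)) ?_ (integrable_const _)
    rw [integrable_indicator_iff measurableSet_Icc]
    exact integrableOn_const (by simp)
  refine hdom.mono' ?_ ?_
  · apply Measurable.aestronglyMeasurable
    exact (hF.comp measurable_fst).mul (measurable_const.div
      (((measurable_fst.sub measurable_snd).pow_const 2).add measurable_const))
  · refine Eventually.of_forall fun p => ?_
    by_cases hp : p.1 ∈ Set.Icc (-T) T
    · rw [Set.indicator_of_mem hp, mul_one, norm_mul]
      refine mul_le_mul (hB _) ?_ (norm_nonneg _) hB0
      rw [Real.norm_of_nonneg (by positivity), div_le_iff₀ (by positivity)]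
      have : η⁻¹ * ((p.1 - p.2) ^ 2 + η ^ 2) = η⁻¹ * (p.1 - p.2) ^ 2 + η := by field_simp
      rw [this]
      have : 0 ≤ η⁻¹ * (p.1 - p.2) ^ 2 := by positivity
      linarith
    · rw [hT p.1 (by
        by_contra hcon
        exact hp (abs_le.mp (not_lt.mp hcon)))]
      simp only [zero_mul, norm_zero, mul_one]
      exact Set.indicator_nonneg (fun _ _ => by positivity) _

lemma inversion {μ : Measure ℝ} {W : ℝ → ℝ} {β R c : ℝ} (H : LD μ W β R c)
    {f : ℝ → ℝ} (hf : Continuous f) {B : ℝ} (hB : ∀ x, |f x| ≤ B) :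
    ∫ y, f y ∂μ = ∫ x, f x * gg μ W β x := by
  have := H.prob
  have hB0 : 0 ≤ B := (abs_nonneg _).trans (hB 0)
  set T := R + 1 with hTdef
  set F : ℝ → ℝ := (Set.Icc (-T) T).indicator f with hFdef
  have hFm : Measurable F := hf.measurable.indicator measurableSet_Icc
  have hFB : ∀ x, |F x| ≤ B := by
    intro x
    by_cases hx : x ∈ Set.Icc (-T) T
    · rw [hFdef, Set.indicator_of_mem hx]; exact hB x
    · rw [hFdef, Set.indicator_of_notMem hx]; simpa using hB0
  have hFT : ∀ x, T < |x| → F x = 0 := by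
    intro x hx
    rw [hFdef, Set.indicator_of_notMem]
    intro h
    exact absurd (abs_le.mpr h) (not_le.mpr hx)
  have hFub : ∀ η > 0, ∫ x, F x * vv μ x η = ∫ y, (∫ s, F (y + η * s) * (1 + s ^ 2)⁻¹) ∂μ := by
    intro η hη
    have h1 : ∀ x, F x * vv μ x η = ∫ y, F x * (η / ((x - y) ^ 2 + η ^ 2)) ∂μ := by
      intro x; rw [vv, integral_const_mul]
    simp_rw [h1]
    rw [integral_integral_swap (integrable_poisson_pair hFm hFB hFT hη)]
    congr 1
    ext y
    exact poisson_change F y hη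
  have hL : Tendsto (fun η => ∫ x, F x * vv μ x η) (𝓝[>] 0)
      (𝓝 (∫ x, F x * (π * gg μ W β x))) := by
    obtain ⟨C, hC0, hC⟩ := vv_bound H T
    refine tendsto_integral_filter_of_dominated_convergence
      (fun x => (Set.Icc (-T) T).indicator (fun _ => B * C) x) ?_ ?_ ?_ ?_
    · filter_upwards [self_mem_nhdsWithin] with η (hη : 0 < η)
      have h1 := (integrable_poisson_pair (μ := μ) hFm hFB hFT hη).integral_prod_left
      refine h1.aestronglyMeasurable.congr (Eventually.of_forall fun x => ?_)
      simp only [vv]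
      rw [integral_const_mul]
    · filter_upwards [self_mem_nhdsWithin] with η (hη : 0 < η)
      refine Eventually.of_forall fun x => ?_
      by_cases hx : x ∈ Set.Icc (-T) T
      · rw [Set.indicator_of_mem hx, norm_mul, Real.norm_of_nonneg (vv_nonneg x hη)]
        exact mul_le_mul (hFB x) (hC x η (abs_le.mpr hx) hη) (vv_nonneg x hη) hB0
      · rw [Set.indicator_of_notMem hx, hFdef, Set.indicator_of_notMem hx]
        simp
    · rw [integrable_indicator_iff measurableSet_Icc]
      exact integrableOn_const (by simp)
    · refine Eventually.of_forall fun x => ?_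
      have := (vv_sq_tendsto H x).const_mul (F x)
      convert this using 3
      unfold gg
      field_simp
  have hpi : Integrable (fun s : ℝ => (1 + s ^ 2)⁻¹) := integrable_inv_one_add_sq
  have hRt : Tendsto (fun η : ℝ => ∫ y, (∫ s, F (y + η * s) * (1 + s ^ 2)⁻¹) ∂μ) (𝓝[>] 0)
      (𝓝 (∫ y, f y * π ∂μ)) := by
    refine tendsto_integral_filter_of_dominated_convergence (fun _ => B * π) ?_ ?_
      (integrable_const _) ?_
    · filter_upwards [self_mem_nhdsWithin] with η (hη : 0 < η)
      have h1 := (integrable_poisson_pair (μ := μ) hFm hFB hFT hη).integral_prod_right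
      refine h1.aestronglyMeasurable.congr (Eventually.of_forall fun y => ?_)
      exact poisson_change F y hη
    · refine Eventually.of_forall fun η => Eventually.of_forall fun y => ?_
      have h1 : ‖∫ s, F (y + η * s) * (1 + s ^ 2)⁻¹‖ ≤ ∫ s, B * (1 + s ^ 2)⁻¹ := by
        refine norm_integral_le_of_norm_le (hpi.const_mul B) (Eventually.of_forall fun s => ?_)
        rw [norm_mul, Real.norm_of_nonneg (by positivity : 0 ≤ (1 + s ^ 2)⁻¹)]
        exact mul_le_mul_of_nonneg_right (hFB _) (by positivity)
      rwa [integral_const_mul, integral_univ_inv_one_add_sq] at h1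
    · filter_upwards [H.supp] with y hy
      have : f y * π = ∫ s, f y * (1 + s ^ 2)⁻¹ := by
        rw [integral_const_mul, integral_univ_inv_one_add_sq]
      rw [this]
      refine tendsto_integral_filter_of_dominated_convergence (fun s => B * (1 + s ^ 2)⁻¹) ?_ ?_
        (hpi.const_mul B) ?_
      · refine Eventually.of_forall fun η => ?_
        apply Measurable.aestronglyMeasurable
        exact (hFm.comp (by fun_prop)).mul (by fun_prop)
      · refine Eventually.of_forall fun η => Eventually.of_forall fun s => ?_
        rw [norm_mul, Real.norm_of_nonneg (by positivity : 0 ≤ (1 + s ^ 2)⁻¹)]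
        exact mul_le_mul_of_nonneg_right (hFB _) (by positivity)
      · refine Eventually.of_forall fun s => ?_
        refine Tendsto.mul_const _ ?_
        have hc : Tendsto (fun η : ℝ => y + η * s) (𝓝[>] 0) (𝓝 y) := by
          have : Continuous fun η : ℝ => y + η * s := by fun_prop
          have h := (this.tendsto 0).mono_left (nhdsWithin_le_nhds (s := Set.Ioi 0))
          simpa using h
        have hFy : ∀ᶠ u in 𝓝 y, f u = F u := by
          have h2 : |y| < T := by linarith
          have := (continuous_abs.tendsto y).eventually_lt_const h2
          filter_upwards [this] with u hu
          rw [hFdef, Set.indicator_of_mem (show u ∈ Set.Icc (-T) T from abs_le.mp hu.le)]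
        exact ((hf.tendsto y).congr' hFy).comp hc
  have heq : ∫ x, F x * (π * gg μ W β x) = ∫ y, f y * π ∂μ := by
    refine tendsto_nhds_unique hL (hRt.congr' ?_)
    filter_upwards [self_mem_nhdsWithin] with η (hη : 0 < η)
    exact (hFub η hη).symm
  have h3 : ∫ x, F x * (π * gg μ W β x) = (∫ x, f x * gg μ W β x) * π := by
    rw [← integral_mul_const]
    congr 1
    ext x
    by_cases hx : x ∈ Set.Icc (-T) T
    · rw [hFdef, Set.indicator_of_mem hx]; ring
    · have : gg μ W β x = 0 := gg_zero H (by
        by_contra hcon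
        exact hx (abs_le.mp ((not_lt.mp hcon).trans (by linarith))))
      rw [this]; ring
  rw [h3, integral_mul_const] at heq
  exact (mul_right_cancel₀ Real.pi_ne_zero heq).symm

lemma mvt_diff {f f' : ℝ → ℝ} (hf : ∀ x, HasDerivAt f (f' x) x) {C r : ℝ} {n : ℕ}
    (hC : 0 ≤ C) (hb : ∀ σ, |σ| ≤ r → |f' σ| ≤ C * |σ| ^ n) {a b : ℝ} (ha : |a| ≤ r) (hb' : |b| ≤ r) :
    |f a - f b| ≤ C * r ^ n * |a - b| := by
  have h := (convex_Icc (-r) r).norm_image_sub_le_of_norm_hasDerivWithin_le (f := f) (f' := f')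
    (C := C * r ^ n) (fun u _ => (hf u).hasDerivWithinAt)
    (fun u hu => by
      have hu' : |u| ≤ r := abs_le.mpr hu
      exact (hb u hu').trans (by gcongr)) (abs_le.mp hb') (abs_le.mp ha)
  simpa [Real.norm_eq_abs] using h

lemma mvt_pow {f f' : ℝ → ℝ} (hf : ∀ x, HasDerivAt f (f' x) x) (h0 : f 0 = 0) {C T : ℝ} {n : ℕ}
    (hC : 0 ≤ C) (hb : ∀ σ, |σ| ≤ T → |f' σ| ≤ C * |σ| ^ n) {τ : ℝ} (ht : |τ| ≤ T) :
    |f τ| ≤ C * |τ| ^ (n + 1) := by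
  have := mvt_diff (r := |τ|) hf hC (fun σ hσ => hb σ (hσ.trans ht)) le_rfl
    (by simp : |(0:ℝ)| ≤ |τ|)
  rw [h0, sub_zero, sub_zero] at this
  rw [pow_succ, ← mul_assoc]
  exact this

/-- second order Taylor remainder -/
def ee (W : ℝ → ℝ) (x0 τ : ℝ) : ℝ :=
  W (x0 + τ) - (W x0 + deriv W x0 * τ + deriv (deriv W) x0 / 2 * τ ^ 2)

lemma ee_bounds {W : ℝ → ℝ} (hW : ContDiff ℝ 3 W) (x0 T : ℝ) :
    ∃ C, 0 ≤ C ∧ (∀ τ, |τ| ≤ T → |ee W x0 τ| ≤ C * |τ| ^ 3) ∧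
      (∀ r a b, r ≤ T → |a| ≤ r → |b| ≤ r → |ee W x0 a - ee W x0 b| ≤ C * r ^ 2 * |a - b|) := by
  have h3 : ContDiff ℝ (2 + 1) W := hW
  have hW1 := (contDiff_succ_iff_deriv.mp h3).2.2
  have d0 := (contDiff_succ_iff_deriv.mp h3).1
  have h2 : ContDiff ℝ (1 + 1) (deriv W) := by
    have : (1 + 1 : WithTop ℕ∞) = 2 := by norm_num
    rw [this]; exact hW1
  have hW2 := (contDiff_succ_iff_deriv.mp h2).2.2
  have d1 := (contDiff_succ_iff_deriv.mp h2).1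
  have d2 : Differentiable ℝ (deriv (deriv W)) := hW2.differentiable (by norm_num)
  have c3 : Continuous (deriv (deriv (deriv W))) := hW2.continuous_deriv (by norm_num)
  obtain ⟨C0, hC0⟩ := (isCompact_Icc (a := -T) (b := T)).exists_bound_of_continuousOn
    (c3.comp (continuous_const.add continuous_id : Continuous fun τ : ℝ => x0 + τ)).continuousOn
  set C := max C0 0
  have hC : 0 ≤ C := le_max_right _ _
  have e0 : ∀ τ, HasDerivAt (ee W x0)
      (deriv W (x0 + τ) - (deriv W x0 + deriv (deriv W) x0 * τ)) τ := by
    intro τ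
    unfold ee
    have h1 := (d0 (x0 + τ)).hasDerivAt.comp_const_add x0 τ
    have h2 : HasDerivAt (fun τ : ℝ => W x0 + deriv W x0 * τ + deriv (deriv W) x0 / 2 * τ ^ 2)
        (deriv W x0 + deriv (deriv W) x0 * τ) τ := by
      have := (((hasDerivAt_id τ).const_mul (deriv W x0)).const_add (W x0)).add
        (((hasDerivAt_id τ).pow 2).const_mul (deriv (deriv W) x0 / 2))
      refine HasDerivAt.congr_deriv this ?_
      simp only [id]
      norm_num
      ring
    exact h1.sub h2
  have e1 : ∀ τ, HasDerivAt (fun τ => deriv W (x0 + τ) - (deriv W x0 + deriv (deriv W) x0 * τ))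
      (deriv (deriv W) (x0 + τ) - deriv (deriv W) x0) τ := by
    intro τ
    have h1 := (d1 (x0 + τ)).hasDerivAt.comp_const_add x0 τ
    have h2 := ((hasDerivAt_id τ).const_mul (deriv (deriv W) x0)).const_add (deriv W x0)
    simp only [mul_one] at h2
    exact h1.sub h2
  have e2 : ∀ τ, HasDerivAt (fun τ => deriv (deriv W) (x0 + τ) - deriv (deriv W) x0)
      (deriv (deriv (deriv W)) (x0 + τ)) τ := by
    intro τ
    exact ((d2 (x0 + τ)).hasDerivAt.comp_const_add x0 τ).sub_const _
  have b3 : ∀ σ, |σ| ≤ T → |deriv (deriv (deriv W)) (x0 + σ)| ≤ C * |σ| ^ 0 := by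
    intro σ hσ
    rw [pow_zero, mul_one]
    exact (hC0 σ (abs_le.mp hσ)).trans (le_max_left _ _)
  have b2 : ∀ σ, |σ| ≤ T → _ := fun σ hσ => mvt_pow e2 (by simp) hC b3 hσ
  have b1 : ∀ σ, |σ| ≤ T → _ := fun σ hσ => mvt_pow e1 (by simp) hC b2 hσ
  have b0 : ∀ σ, |σ| ≤ T → _ := fun σ hσ => mvt_pow e0 (by simp [ee]) hC b1 hσ
  exact ⟨C, hC, b0, fun r a b hr ha hb => mvt_diff e0 hC (fun σ hσ => b1 σ (hσ.trans hr)) ha hb⟩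

lemma ee_cont {W : ℝ → ℝ} (hW : ContDiff ℝ 3 W) (x0 : ℝ) : Continuous (ee W x0) := by
  unfold ee
  have := hW.continuous
  fun_prop

/-- third divided difference -/
def qq (W : ℝ → ℝ) (x0 y : ℝ) : ℝ := ee W x0 (y - x0) / (y - x0) ^ 3

lemma qq_meas {W : ℝ → ℝ} (hW : ContDiff ℝ 3 W) (x0 : ℝ) : Measurable (qq W x0) := by
  unfold qq
  exact ((ee_cont hW x0).measurable.comp (measurable_id.sub_const x0)).div
    ((measurable_id.sub_const x0).pow_const 3)

lemma qq_bound {W : ℝ → ℝ} {x0 T C : ℝ} (hC : 0 ≤ C)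
    (h : ∀ τ, |τ| ≤ T → |ee W x0 τ| ≤ C * |τ| ^ 3) {y : ℝ} (hy : |y - x0| ≤ T) :
    |qq W x0 y| ≤ C := by
  unfold qq
  rw [abs_div, abs_pow]
  exact div_le_of_le_mul₀ (by positivity) hC (h _ hy)

lemma local_min_coeffs {S : ℝ → ℝ} (hS : ContinuousAt S 0) (hS0 : S 0 = 0)
    (hpos : ∀ᶠ t in 𝓝 (0:ℝ), 0 ≤ S t) {a0 a1 a2 : ℝ}
    (h : Tendsto (fun t => (S t - (a0 + a1 * t + a2 * t ^ 2)) / t ^ 2) (𝓝[≠] 0) (𝓝 0)) :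
    a0 = 0 ∧ a1 = 0 ∧ 0 ≤ a2 := by
  set o : ℝ → ℝ := fun t => (S t - (a0 + a1 * t + a2 * t ^ 2)) / t ^ 2 with ho
  have hid : Tendsto (fun t : ℝ => t) (𝓝[≠] 0) (𝓝 0) := nhdsWithin_le_nhds
  have hSe : ∀ t ≠ 0, S t = a0 + a1 * t + a2 * t ^ 2 + t ^ 2 * o t := by
    intro t ht
    simp only [ho]
    field_simp
    ring
  have h0 : a0 = 0 := by
    have h1 : Tendsto S (𝓝[≠] 0) (𝓝 0) := by
      have := hS.tendsto.mono_left (nhdsWithin_le_nhds (s := {0}ᶜ))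
      rwa [hS0] at this
    have h2 : Tendsto (fun t => a0 + a1 * t + a2 * t ^ 2 + t ^ 2 * o t) (𝓝[≠] 0)
        (𝓝 (a0 + a1 * 0 + a2 * 0 ^ 2 + 0 ^ 2 * 0)) :=
      ((tendsto_const_nhds.add (hid.const_mul a1)).add ((hid.pow 2).const_mul a2)).add
        ((hid.pow 2).mul h)
    have h3 : Tendsto S (𝓝[≠] 0) (𝓝 (a0 + a1 * 0 + a2 * 0 ^ 2 + 0 ^ 2 * 0)) := by
      refine h2.congr' ?_
      filter_upwards [self_mem_nhdsWithin] with t ht using (hSe t ht).symm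
    have := tendsto_nhds_unique h1 h3
    simpa using this.symm
  subst h0
  have h2 : Tendsto (fun t => a1 + a2 * t + t * o t) (𝓝[≠] 0) (𝓝 (a1 + a2 * 0 + 0 * 0)) :=
    (tendsto_const_nhds.add (hid.const_mul a2)).add (hid.mul h)
  simp only [mul_zero, add_zero] at h2
  have hgt : 𝓝[>] (0:ℝ) ≤ 𝓝[≠] 0 := nhdsWithin_mono _ fun x (hx : 0 < x) => hx.ne'
  have hlt : 𝓝[<] (0:ℝ) ≤ 𝓝[≠] 0 := nhdsWithin_mono _ fun x (hx : x < 0) => hx.ne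
  have h1 : a1 = 0 := by
    apply le_antisymm
    · refine le_of_tendsto (h2.mono_left hlt) ?_
      filter_upwards [self_mem_nhdsWithin, nhdsWithin_le_nhds hpos] with t (ht : t < 0) hp
      rw [hSe t ht.ne] at hp
      by_contra hcon
      push Not at hcon
      nlinarith [mul_neg_of_neg_of_pos ht hcon]
    · refine ge_of_tendsto (h2.mono_left hgt) ?_
      filter_upwards [self_mem_nhdsWithin, nhdsWithin_le_nhds hpos] with t (ht : 0 < t) hp
      rw [hSe t ht.ne'] at hp
      by_contra hcon
      push Not at hcon
      nlinarith [mul_neg_of_pos_of_neg ht hcon]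
  subst h1
  refine ⟨rfl, rfl, ?_⟩
  have h3 : Tendsto (fun t => a2 + o t) (𝓝[>] 0) (𝓝 (a2 + 0)) :=
    tendsto_const_nhds.add (h.mono_left hgt)
  rw [add_zero] at h3
  refine ge_of_tendsto h3 ?_
  filter_upwards [self_mem_nhdsWithin, nhdsWithin_le_nhds hpos] with t (ht : 0 < t) hp
  rw [hSe t ht.ne'] at hp
  by_contra hcon
  push Not at hcon
  nlinarith [mul_neg_of_pos_of_neg (pow_pos ht 2) hcon]

/-- remainder integrand -/
def rr (W : ℝ → ℝ) (x0 t y : ℝ) : ℝ :=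
  (ee W x0 t - t ^ 3 * qq W x0 y) / (t - (y - x0))

lemma rr_bound {W : ℝ → ℝ} {x0 T C : ℝ} (hC : 0 ≤ C)
    (h : ∀ τ, |τ| ≤ T → |ee W x0 τ| ≤ C * |τ| ^ 3)
    (h' : ∀ r a b, r ≤ T → |a| ≤ r → |b| ≤ r → |ee W x0 a - ee W x0 b| ≤ C * r ^ 2 * |a - b|)
    {t y : ℝ} (ht : 2 * |t| ≤ T) (hy : |y - x0| ≤ T) (hne : y ≠ x0) (htne : t ≠ y - x0) :
    |rr W x0 t y| ≤ 11 * C * t ^ 2 := by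
  set d := y - x0 with hd
  have hd0 : d ≠ 0 := sub_ne_zero.mpr hne
  have htd : t - d ≠ 0 := sub_ne_zero.mpr htne
  have hq : |qq W x0 y| ≤ C := qq_bound hC h hy
  have ht' : |t| ≤ T := by linarith [abs_nonneg t]
  have ht2 : t ^ 2 = |t| ^ 2 := (sq_abs t).symm
  by_cases hc : 2 * |t| ≤ |d|
  · have h1 : |t| ≤ |t - d| := by
      have := abs_sub_abs_le_abs_sub d t
      rw [abs_sub_comm d t] at this
      linarith
    unfold rr
    rw [← hd, abs_div, div_le_iff₀ (abs_pos.mpr htd)]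
    calc |ee W x0 t - t ^ 3 * qq W x0 y| ≤ |ee W x0 t| + |t ^ 3 * qq W x0 y| := abs_sub _ _
      _ ≤ C * |t| ^ 3 + |t| ^ 3 * C := by
        rw [abs_mul, abs_pow]
        gcongr
        exact h t ht'
      _ = 2 * C * t ^ 2 * |t| := by rw [ht2]; ring
      _ ≤ 11 * C * t ^ 2 * |t - d| := by gcongr; norm_num
  · push Not at hc
    have he : ee W x0 d = d ^ 3 * qq W x0 y := by
      unfold qq; rw [← hd]; field_simp
    have h1 : rr W x0 t y = (ee W x0 t - ee W x0 d) / (t - d) - (t ^ 2 + t * d + d ^ 2) * qq W x0 y := by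
      unfold rr
      rw [he, ← hd]
      field_simp
      ring
    rw [h1]
    have h2 : |(ee W x0 t - ee W x0 d) / (t - d)| ≤ 4 * C * t ^ 2 := by
      rw [abs_div, div_le_iff₀ (abs_pos.mpr htd)]
      have := h' (2 * |t|) t d ht (by linarith [abs_nonneg t]) hc.le
      calc _ ≤ _ := this
        _ = _ := by rw [ht2]; ring
    have h3 : |t ^ 2 + t * d + d ^ 2| ≤ 7 * t ^ 2 := by
      have a1 : |t * d| ≤ 2 * |t| ^ 2 := by
        rw [abs_mul]; nlinarith [abs_nonneg t, abs_nonneg d]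
      have a2 : d ^ 2 ≤ 4 * |t| ^ 2 := by
        rw [← sq_abs d]; nlinarith [abs_nonneg t, abs_nonneg d]
      rw [abs_le] at *
      constructor <;> nlinarith [sq_nonneg t, sq_nonneg d]
    calc _ ≤ 4 * C * t ^ 2 + 7 * t ^ 2 * C := by
          refine (abs_sub _ _).trans (add_le_add h2 ?_)
          rw [abs_mul]
          gcongr
      _ = _ := by ring

/-- constants -/
def A0 (μ : Measure ℝ) (W : ℝ → ℝ) (x0 : ℝ) : ℝ :=
  ∫ y, (deriv W x0 + deriv (deriv W) x0 / 2 * (y - x0) + (y - x0) ^ 2 * qq W x0 y) ∂μ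
def A1 (μ : Measure ℝ) (W : ℝ → ℝ) (x0 : ℝ) : ℝ :=
  ∫ y, (deriv (deriv W) x0 / 2 + (y - x0) * qq W x0 y) ∂μ
def A2 (μ : Measure ℝ) (W : ℝ → ℝ) (x0 : ℝ) : ℝ := ∫ y, qq W x0 y ∂μ

lemma int_pow_qq {μ : Measure ℝ} {W : ℝ → ℝ} {β R c : ℝ} (H : LD μ W β R c) (x0 : ℝ) (n : ℕ) :
    Integrable (fun y => (y - x0) ^ n * qq W x0 y) μ := by
  have := H.prob
  obtain ⟨C, hC, h1, -⟩ := ee_bounds H.smooth x0 (R + |x0|)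
  have hb : ∀ y, |y| ≤ R → |y - x0| ≤ R + |x0| := fun y hy =>
    (abs_sub _ _).trans (by linarith)
  refine integrable_of_bdd ?_ ((R + |x0|) ^ n * C) ?_
  · exact (((measurable_id.sub_const x0).pow_const n).mul (qq_meas H.smooth x0)).aestronglyMeasurable
  · filter_upwards [H.supp] with y hy
    rw [norm_mul, norm_pow, Real.norm_eq_abs, Real.norm_eq_abs]
    have := qq_bound hC h1 (hb y hy)
    have := hb y hy
    have hR := H.hR
    have h5 : 0 ≤ (R + |x0|) ^ n := by positivity
    gcongr

lemma int_lin {μ : Measure ℝ} {W : ℝ → ℝ} {β R c : ℝ} (H : LD μ W β R c) (x0 : ℝ) :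
    Integrable (fun y => y - x0) μ := by
  have := H.prob
  refine integrable_of_bdd (measurable_id.sub_const x0).aestronglyMeasurable (R + |x0|) ?_
  filter_upwards [H.supp] with y hy
  exact (abs_sub _ _).trans (by linarith)

lemma A_ints {μ : Measure ℝ} {W : ℝ → ℝ} {β R c : ℝ} (H : LD μ W β R c) (x0 : ℝ) :
    Integrable (fun y => deriv W x0 + deriv (deriv W) x0 / 2 * (y - x0) + (y - x0) ^ 2 * qq W x0 y) μ ∧
    Integrable (fun y => deriv (deriv W) x0 / 2 + (y - x0) * qq W x0 y) μ ∧
    Integrable (fun y => qq W x0 y) μ := by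
  have := H.prob
  refine ⟨?_, ?_, ?_⟩
  · exact ((integrable_const _).add ((int_lin H x0).const_mul _)).add (int_pow_qq H x0 2)
  · have := int_pow_qq H x0 1
    simp only [pow_one] at this
    exact (integrable_const _).add this
  · simpa using int_pow_qq H x0 0

lemma PP_expand {μ : Measure ℝ} {W : ℝ → ℝ} {β R c : ℝ} (H : LD μ W β R c) (x0 : ℝ) :
    Tendsto (fun t => (PP μ W (x0 + t) - (A0 μ W x0 + A1 μ W x0 * t + A2 μ W x0 * t ^ 2)) / t ^ 2)
      (𝓝[≠] 0) (𝓝 0) := by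
  have := H.prob
  set T := R + |x0| + 1
  obtain ⟨C, hC, h1, h2⟩ := ee_bounds H.smooth x0 T
  have hT : 0 < T := by have := H.hR; positivity
  have hb : ∀ y, |y| ≤ R → |y - x0| ≤ T := fun y hy => (abs_sub _ _).trans (by linarith)
  obtain ⟨i0, i1, i2⟩ := A_ints H x0
  have key : ∀ᶠ t in 𝓝[≠] (0:ℝ),
      ∫ y, rr W x0 t y / t ^ 2 ∂μ =
        (PP μ W (x0 + t) - (A0 μ W x0 + A1 μ W x0 * t + A2 μ W x0 * t ^ 2)) / t ^ 2 := by
    filter_upwards [self_mem_nhdsWithin] with t (ht : t ≠ 0)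
    rw [integral_div]
    congr 1
    have hk : Integrable (kk W (x0 + t)) μ := by
      obtain ⟨L, hL0, hL⟩ := lip_on H.smooth (max |x0 + t| R)
      refine integrable_of_bdd (kk_meas H.smooth.continuous _).aestronglyMeasurable L ?_
      filter_upwards [H.supp] with y hy
      exact kk_bound hL0 hL (le_max_left _ _) (hy.trans (le_max_right _ _))
    unfold PP A0 A1 A2
    have j01 : Integrable (fun y => (deriv W x0 + deriv (deriv W) x0 / 2 * (y - x0)
        + (y - x0) ^ 2 * qq W x0 y) + (deriv (deriv W) x0 / 2 + (y - x0) * qq W x0 y) * t) μ :=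
      i0.add (i1.mul_const t)
    have j02 : Integrable (fun y => ((deriv W x0 + deriv (deriv W) x0 / 2 * (y - x0)
        + (y - x0) ^ 2 * qq W x0 y) + (deriv (deriv W) x0 / 2 + (y - x0) * qq W x0 y) * t)
        + qq W x0 y * t ^ 2) μ :=
      j01.add (i2.mul_const (t ^ 2))
    rw [← integral_mul_const, ← integral_mul_const, ← integral_add i0 (i1.mul_const t),
      ← integral_add j01 (i2.mul_const _), ← integral_sub hk j02]
    apply integral_congr_ae
    filter_upwards [no_atom H x0, no_atom H (x0 + t)] with y hy1 hy2
    have hd0 : y - x0 ≠ 0 := sub_ne_zero.mpr hy1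
    have htd : t - (y - x0) ≠ 0 := by
      intro h; apply hy2; linarith
    have hW1 : W (x0 + t) = W x0 + deriv W x0 * t + deriv (deriv W) x0 / 2 * t ^ 2 + ee W x0 t := by
      unfold ee; ring
    have hW2 : W y = W x0 + deriv W x0 * (y - x0) + deriv (deriv W) x0 / 2 * (y - x0) ^ 2
        + (y - x0) ^ 3 * qq W x0 y := by
      unfold qq
      rw [mul_div_cancel₀ _ (pow_ne_zero 3 hd0)]
      unfold ee; rw [add_sub_cancel]; ring
    have hx : x0 + t - y = t - (y - x0) := by ring
    simp only [rr, kk]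
    rw [hx, hW1, hW2]
    field_simp
    ring
  refine Tendsto.congr' key ?_
  have h0 : (0:ℝ) = ∫ y, (0:ℝ) ∂μ := by simp
  rw [h0]
  rw [← h0]
  refine (tendsto_integral_filter_of_dominated_convergence (f := fun _ => (0:ℝ)) (fun _ => 11 * C) ?_ ?_
    (integrable_const _) ?_).trans (by simp)
  · refine Eventually.of_forall fun t => ?_
    unfold rr
    exact (((measurable_const.sub ((qq_meas H.smooth x0).const_mul _)).div
      (measurable_const.sub (measurable_id.sub_const x0))).div_const _).aestronglyMeasurable
  · have hsm : ∀ᶠ t in 𝓝[≠] (0:ℝ), |t| < T / 2 := by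
      apply nhdsWithin_le_nhds
      exact (continuous_abs.tendsto 0).eventually_lt_const (by simpa using hT)
    filter_upwards [hsm, self_mem_nhdsWithin] with t ht (ht0 : t ≠ 0)
    filter_upwards [H.supp, no_atom H x0, no_atom H (x0 + t)] with y hy hy1 hy2
    have := rr_bound hC h1 h2 (t := t) (by linarith) (hb y hy) hy1 (by intro h; apply hy2; linarith)
    have ht2 : 0 < t ^ 2 := by positivity
    rw [norm_div, Real.norm_eq_abs, Real.norm_of_nonneg ht2.le, div_le_iff₀ ht2]
    exact this
  · filter_upwards [no_atom H x0] with y hy1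
    have hd0 : y - x0 ≠ 0 := sub_ne_zero.mpr hy1
    have hid : Tendsto (fun t : ℝ => t) (𝓝[≠] 0) (𝓝 0) := nhdsWithin_le_nhds
    have he : Tendsto (fun t => ee W x0 t / t ^ 2) (𝓝[≠] 0) (𝓝 0) := by
      have hz : Tendsto (fun t : ℝ => C * |t|) (𝓝[≠] 0) (𝓝 0) := by
        have := (hid.abs).const_mul C
        simpa using this
      refine squeeze_zero_norm' ?_ hz
      have hsm : ∀ᶠ t in 𝓝[≠] (0:ℝ), |t| < T := by
        apply nhdsWithin_le_nhds
        exact (continuous_abs.tendsto 0).eventually_lt_const (by simpa using hT)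
      filter_upwards [hsm, self_mem_nhdsWithin] with t ht (ht0 : t ≠ 0)
      have ht2 : 0 < t ^ 2 := by positivity
      rw [norm_div, Real.norm_eq_abs, Real.norm_of_nonneg ht2.le, div_le_iff₀ ht2, ← sq_abs t]
      have := h1 t ht.le
      calc _ ≤ _ := this
        _ = _ := by ring
    have hlim : Tendsto (fun t => (ee W x0 t / t ^ 2 - t * qq W x0 y) / (t - (y - x0))) (𝓝[≠] 0)
        (𝓝 ((0 - 0 * qq W x0 y) / (0 - (y - x0)))) :=
      (he.sub (hid.mul_const _)).div (hid.sub_const _) (by simpa [sub_eq_zero] using fun h => hd0 (by linarith))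
    simp only [zero_mul, sub_zero, zero_div] at hlim
    refine hlim.congr' ?_
    filter_upwards [self_mem_nhdsWithin] with t (ht0 : t ≠ 0)
    unfold rr
    field_simp

lemma ee_small {μ : Measure ℝ} {W : ℝ → ℝ} {β R c : ℝ} (H : LD μ W β R c) (x0 : ℝ) :
    Tendsto (fun t => ee W x0 t / t ^ 2) (𝓝[≠] 0) (𝓝 0) := by
  obtain ⟨C, hC, h1, -⟩ := ee_bounds H.smooth x0 1
  have hid : Tendsto (fun t : ℝ => t) (𝓝[≠] 0) (𝓝 0) := nhdsWithin_le_nhds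
  have hz : Tendsto (fun t : ℝ => C * |t|) (𝓝[≠] 0) (𝓝 0) := by
    have := (hid.abs).const_mul C
    simpa using this
  refine squeeze_zero_norm' ?_ hz
  have hsm : ∀ᶠ t in 𝓝[≠] (0:ℝ), |t| < 1 := by
    apply nhdsWithin_le_nhds
    exact (continuous_abs.tendsto 0).eventually_lt_const (by simp)
  filter_upwards [hsm, self_mem_nhdsWithin] with t ht (ht0 : t ≠ 0)
  have ht2 : 0 < t ^ 2 := by positivity
  rw [norm_div, Real.norm_eq_abs, Real.norm_of_nonneg ht2.le, div_le_iff₀ ht2, ← sq_abs t]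
  have := h1 t ht.le
  calc _ ≤ _ := this
    _ = _ := by ring

def a0 (μ : Measure ℝ) (W : ℝ → ℝ) (β x0 : ℝ) : ℝ := 2 / β * A0 μ W x0 - W x0 ^ 2 / β ^ 2
def a1 (μ : Measure ℝ) (W : ℝ → ℝ) (β x0 : ℝ) : ℝ :=
  2 / β * A1 μ W x0 - 2 * W x0 * deriv W x0 / β ^ 2
def a2 (μ : Measure ℝ) (W : ℝ → ℝ) (β x0 : ℝ) : ℝ :=
  2 / β * A2 μ W x0 - (deriv W x0 ^ 2 + W x0 * deriv (deriv W) x0) / β ^ 2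

lemma SS_expand {μ : Measure ℝ} {W : ℝ → ℝ} {β R c : ℝ} (H : LD μ W β R c) (x0 : ℝ) :
    Tendsto (fun t => (SS μ W β (x0 + t) - (a0 μ W β x0 + a1 μ W β x0 * t + a2 μ W β x0 * t ^ 2)) / t ^ 2)
      (𝓝[≠] 0) (𝓝 0) := by
  have hβ := H.hβ
  have hid : Tendsto (fun t : ℝ => t) (𝓝[≠] 0) (𝓝 0) := nhdsWithin_le_nhds
  have he := ee_small H x0
  have hP := PP_expand H x0
  set W0 := W x0
  set W1 := deriv W x0
  set W2 := deriv (deriv W) x0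
  have hpp : Tendsto (fun t : ℝ => W0 + W1 * t + W2 / 2 * t ^ 2) (𝓝[≠] 0)
      (𝓝 (W0 + W1 * 0 + W2 / 2 * 0 ^ 2)) :=
    (tendsto_const_nhds.add (hid.const_mul _)).add ((hid.pow 2).const_mul _)
  have hlim : Tendsto (fun t => 2 / β * ((PP μ W (x0 + t) - (A0 μ W x0 + A1 μ W x0 * t + A2 μ W x0 * t ^ 2)) / t ^ 2)
     - (W1 * W2 * t + W2 ^ 2 / 4 * t ^ 2 + 2 * (W0 + W1 * t + W2 / 2 * t ^ 2) * (ee W x0 t / t ^ 2)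
      + t ^ 2 * (ee W x0 t / t ^ 2) ^ 2) / β ^ 2) (𝓝[≠] 0)
     (𝓝 (2 / β * 0 - (W1 * W2 * 0 + W2 ^ 2 / 4 * 0 ^ 2 + 2 * (W0 + W1 * 0 + W2 / 2 * 0 ^ 2) * 0 + 0 ^ 2 * 0 ^ 2) / β ^ 2)) :=
    (hP.const_mul _).sub (((((hid.const_mul _).add ((hid.pow 2).const_mul _)).add
      ((hpp.const_mul 2).mul he)).add ((hid.pow 2).mul (he.pow 2))).div_const _)
  have h0 : (2 / β * 0 - (W1 * W2 * 0 + W2 ^ 2 / 4 * 0 ^ 2 + 2 * (W0 + W1 * 0 + W2 / 2 * 0 ^ 2) * 0 + 0 ^ 2 * 0 ^ 2) / β ^ 2) = 0 := by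
    simp
  rw [h0] at hlim
  refine hlim.congr' ?_
  filter_upwards [self_mem_nhdsWithin] with t (ht : t ≠ 0)
  have hW1 : W (x0 + t) = W0 + W1 * t + W2 / 2 * t ^ 2 + ee W x0 t := by
    simp only [ee, W0, W1, W2]; ring
  simp only [SS, a0, a1, a2]
  rw [hW1]
  field_simp
  ring

lemma small_tail {μ : Measure ℝ} {W : ℝ → ℝ} {β R c : ℝ} (H : LD μ W β R c) (x0 : ℝ) :
    Tendsto (fun η : ℝ => ∫ y, (η : ℂ) * ((qq W x0 y : ℂ) * (zz x0 η - (y : ℂ))⁻¹) ∂μ) (𝓝[>] 0) (𝓝 0) := by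
  have := H.prob
  obtain ⟨C, hC, h1, -⟩ := ee_bounds H.smooth x0 (R + |x0|)
  have hb : ∀ y, |y| ≤ R → |y - x0| ≤ R + |x0| := fun y hy =>
    (abs_sub _ _).trans (by linarith)
  have key := tendsto_integral_filter_of_dominated_convergence (μ := μ) (l := 𝓝[>] (0:ℝ))
    (F := fun η y => (η : ℂ) * ((qq W x0 y : ℂ) * (zz x0 η - (y : ℂ))⁻¹))
    (f := fun _ => (0:ℂ)) (fun _ => C) ?_ ?_ (integrable_const _) ?_
  · simpa using key
  · refine Eventually.of_forall fun η => ?_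
    exact (((Complex.measurable_ofReal.comp (qq_meas H.smooth x0)).mul
      (zz_inv_meas x0 η)).const_mul _).aestronglyMeasurable
  · filter_upwards [self_mem_nhdsWithin] with η (hη : 0 < η)
    filter_upwards [H.supp] with y hy
    have h2 := qq_bound hC h1 (hb y hy)
    have h3 := zz_inv_norm_le x0 hη y
    rw [norm_mul, norm_mul, Complex.norm_real, Complex.norm_real, Real.norm_of_nonneg hη.le,
      Real.norm_eq_abs]
    calc η * (|qq W x0 y| * ‖(zz x0 η - (y : ℂ))⁻¹‖) ≤ η * (C * η⁻¹) := by gcongr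
      _ = C := by field_simp
  · filter_upwards [no_atom H x0] with y hy
    have h2 : ((x0 - y : ℝ) : ℂ) ≠ 0 := by
      rw [Complex.ofReal_ne_zero]; exact sub_ne_zero.mpr hy.symm
    have h3 := (zz_tendsto x0 y).inv₀ h2
    have h4 : Tendsto (fun η : ℝ => (η : ℂ)) (𝓝[>] 0) (𝓝 ((0:ℝ):ℂ)) :=
      (Complex.continuous_ofReal.tendsto 0).mono_left nhdsWithin_le_nhds
    have := h4.mul (h3.const_mul (qq W x0 y : ℂ))
    simpa using this

lemma quad2 {μ : Measure ℝ} {W : ℝ → ℝ} {β R c : ℝ} (H : LD μ W β R c) (x0 : ℝ) {η : ℝ}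
    (hη : 0 < η) (p t : ℂ) (ht : t = η * Complex.I)
    (hp : p = W x0 + ((deriv W x0 : ℝ) : ℂ) * t + ((deriv (deriv W) x0 : ℝ) : ℂ) / 2 * t ^ 2) :
    (GG μ x0 η - p / β) ^ 2 = p ^ 2 / β ^ 2 - 2 / β * ((A0 μ W x0 : ℂ) + A1 μ W x0 * t + A2 μ W x0 * t ^ 2)
      + 2 / β * t ^ 3 * ∫ y, (qq W x0 y : ℂ) * (zz x0 η - (y : ℂ))⁻¹ ∂μ := by
  have := H.prob
  have hβ : (β : ℂ) ≠ 0 := Complex.ofReal_ne_zero.mpr H.hβ.ne'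
  obtain ⟨i0, i1, i2⟩ := A_ints H x0
  have k0 := i0.ofReal (𝕜 := ℂ)
  have k1 := (i1.ofReal (𝕜 := ℂ)).mul_const t
  have k2 := (i2.ofReal (𝕜 := ℂ)).mul_const (t ^ 2)
  have hq : Integrable (fun y => (qq W x0 y : ℂ) * (zz x0 η - (y : ℂ))⁻¹) μ := by
    have := (GG_integrable (μ := μ) x0 hη)
    obtain ⟨C, hC, h1, -⟩ := ee_bounds H.smooth x0 (R + |x0|)
    have hb : ∀ y, |y| ≤ R → |y - x0| ≤ R + |x0| := fun y hy =>
      (abs_sub _ _).trans (by linarith)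
    refine this.bdd_mul (c := C)
      (Complex.measurable_ofReal.comp (qq_meas H.smooth x0)).aestronglyMeasurable ?_
    filter_upwards [H.supp] with y hy
    rw [Complex.norm_real]
    exact qq_bound hC h1 (hb y hy)
  have hW : ∫ y, (W y : ℂ) * (zz x0 η - (y : ℂ))⁻¹ ∂μ = p * GG μ x0 η -
      ((A0 μ W x0 : ℂ) + A1 μ W x0 * t + A2 μ W x0 * t ^ 2)
      + t ^ 3 * ∫ y, (qq W x0 y : ℂ) * (zz x0 η - (y : ℂ))⁻¹ ∂μ := by
    have e0 : (A0 μ W x0 : ℂ) = _ := (integral_ofReal (𝕜 := ℂ) (μ := μ)).symm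
    have e1 : (A1 μ W x0 : ℂ) = _ := (integral_ofReal (𝕜 := ℂ) (μ := μ)).symm
    have e2 : (A2 μ W x0 : ℂ) = _ := (integral_ofReal (𝕜 := ℂ) (μ := μ)).symm
    have k01 := k0.add k1
    have k012 := k01.add k2
    have k4 := (GG_integrable (μ := μ) x0 hη).const_mul p
    have k5 := k4.sub k012
    beta_reduce at k01 k012 k4 k5
    simp only [Pi.add_def, Pi.sub_def] at k01 k012 k5
    rw [e0, e1, e2, GG, ← integral_const_mul, ← integral_const_mul, ← integral_mul_const,
      ← integral_mul_const, ← integral_add k0 k1, ← integral_add k01 k2,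
      ← integral_sub k4 k012,
      ← integral_add k5 (hq.const_mul _)]
    apply integral_congr_ae
    filter_upwards [no_atom H x0] with y hy1
    have hd0 : y - x0 ≠ 0 := sub_ne_zero.mpr hy1
    have hW2 : W y = W x0 + deriv W x0 * (y - x0) + deriv (deriv W) x0 / 2 * (y - x0) ^ 2
        + (y - x0) ^ 3 * qq W x0 y := by
      unfold qq
      rw [mul_div_cancel₀ _ (pow_ne_zero 3 hd0)]
      unfold ee; rw [add_sub_cancel]; ring
    have hz : zz x0 η = x0 + t := by rw [ht]; apply Complex.ext <;> simp [zz]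
    have hne := zz_sub_ne x0 hη y
    rw [hz] at hne
    rw [hW2, hz, hp]
    simp only [RCLike.ofReal_add, RCLike.ofReal_mul, RCLike.ofReal_div, RCLike.ofReal_pow, RCLike.ofReal_sub, Complex.coe_algebraMap, RCLike.ofReal_ofNat, Complex.ofReal_add, Complex.ofReal_mul, Complex.ofReal_sub, Complex.ofReal_pow, Complex.ofReal_div, Complex.ofReal_ofNat]
    field_simp
    push_cast
    ring
  have hl := H.loop (zz x0 η) (by simpa [zz] using hη)
  rw [hW] at hl
  have hl' : GG μ x0 η ^ 2 = _ := hl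
  have : (GG μ x0 η - p / β) ^ 2 = GG μ x0 η ^ 2 - 2 * GG μ x0 η * p / β + p ^ 2 / β ^ 2 := by
    field_simp
    ring
  rw [this, hl']
  push_cast
  field_simp
  ring

lemma quad2_tendsto {μ : Measure ℝ} {W : ℝ → ℝ} {β R c : ℝ} (H : LD μ W β R c) (x0 : ℝ)
    (h0 : a0 μ W β x0 = 0) (h1 : a1 μ W β x0 = 0) :
    Tendsto (fun η : ℝ => ((GG μ x0 η - (W x0 + ((deriv W x0 : ℝ) : ℂ) * (η * Complex.I)
      + ((deriv (deriv W) x0 : ℝ) : ℂ) / 2 * (η * Complex.I) ^ 2) / β) / η) ^ 2) (𝓝[>] 0)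
      (𝓝 ((a2 μ W β x0 : ℝ) : ℂ)) := by
  have hβ : (β : ℂ) ≠ 0 := Complex.ofReal_ne_zero.mpr H.hβ.ne'
  have h4 : Tendsto (fun η : ℝ => (η : ℂ)) (𝓝[>] 0) (𝓝 0) := by
    have := (Complex.continuous_ofReal.tendsto 0).mono_left (nhdsWithin_le_nhds (s := Set.Ioi 0))
    simpa using this
  have ht := small_tail H x0
  set W0 := W x0
  set W1 := deriv W x0
  set W2 := deriv (deriv W) x0
  have hlim : Tendsto (fun η : ℝ => (a2 μ W β x0 : ℂ) +
      (- (W1 * W2 * Complex.I / β ^ 2 * η) + W2 ^ 2 / 4 / β ^ 2 * (η : ℂ) ^ 2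
      - 2 / β * Complex.I * ∫ y, (η : ℂ) * ((qq W x0 y : ℂ) * (zz x0 η - (y : ℂ))⁻¹) ∂μ)) (𝓝[>] 0)
      (𝓝 ((a2 μ W β x0 : ℂ) + (- (W1 * W2 * Complex.I / β ^ 2 * 0) + W2 ^ 2 / 4 / β ^ 2 * (0 : ℂ) ^ 2
      - 2 / β * Complex.I * 0))) :=
    tendsto_const_nhds.add ((((h4.const_mul _).neg).add ((h4.pow 2).const_mul _)).sub (ht.const_mul _))
  have e0 : ((a2 μ W β x0 : ℂ) + (- (W1 * W2 * Complex.I / β ^ 2 * 0) + W2 ^ 2 / 4 / β ^ 2 * (0 : ℂ) ^ 2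
      - 2 / β * Complex.I * 0)) = a2 μ W β x0 := by simp
  rw [e0] at hlim
  refine hlim.congr' ?_
  filter_upwards [self_mem_nhdsWithin] with η (hη : 0 < η)
  have hη' : (η : ℂ) ≠ 0 := Complex.ofReal_ne_zero.mpr hη.ne'
  rw [div_pow, quad2 H x0 hη _ _ rfl rfl, integral_const_mul]
  have c0 : (A0 μ W x0 : ℂ) = W0 ^ 2 / (2 * β) := by
    have : A0 μ W x0 = W0 ^ 2 / (2 * β) := by
      have hb := H.hβ
      unfold a0 at h0
      field_simp at h0 ⊢
      linarith
    rw [this]; push_cast; rfl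
  have c1 : (A1 μ W x0 : ℂ) = W0 * W1 / β := by
    have : A1 μ W x0 = W0 * W1 / β := by
      have hb := H.hβ
      unfold a1 at h1
      field_simp at h1 ⊢
      linarith
    rw [this]; push_cast; rfl
  simp only [a2]
  rw [c0, c1]
  set J := ∫ y, (qq W x0 y : ℂ) * (zz x0 η - (y : ℂ))⁻¹ ∂μ
  have I2 : Complex.I ^ 2 = -1 := Complex.I_sq
  have I3 : Complex.I ^ 3 = -Complex.I := by rw [pow_succ, I2]; ring
  have I4 : Complex.I ^ 4 = 1 := Complex.I_pow_four
  push_cast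
  field_simp
  ring_nf
  simp only [I2, I3, I4, W0, W1, W2]
  ring_nf

lemma gg_pos {μ : Measure ℝ} {W : ℝ → ℝ} {β R c : ℝ} (H : LD μ W β R c) {x0 : ℝ}
    (hx : x0 ∈ interior (tsupport (gg μ W β))) : gg μ W β x0 ≠ 0 := by
  have := H.prob
  intro hg
  have hβ := H.hβ
  have hSS := SS_cont H
  have hsub : tsupport (gg μ W β) ⊆ {x | 0 ≤ SS μ W β x} := by
    apply closure_minimal
    · intro x hx
      by_contra hcon
      simp only [Set.mem_ofPred_eq, not_le] at hcon
      apply hx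
      unfold gg
      rw [abs_of_neg hcon]
      simp
    · exact isClosed_le continuous_const hSS
  have hpos : ∀ᶠ x in 𝓝 x0, 0 ≤ SS μ W β x := by
    filter_upwards [isOpen_interior.mem_nhds hx] with x hx using hsub (interior_subset hx)
  have hS0 : SS μ W β x0 = 0 := by
    have h1 : 0 ≤ SS μ W β x0 := hpos.self_of_nhds
    unfold gg at hg
    rw [abs_of_nonneg h1] at hg
    have h2 : √((SS μ W β x0 + SS μ W β x0) / 2) = 0 := by
      rcases div_eq_zero_iff.mp hg with h | h
      · exact h
      · exact absurd h pi_ne_zero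
    rw [Real.sqrt_eq_zero (by linarith)] at h2
    linarith
  have hc0 : Continuous fun t : ℝ => SS μ W β (x0 + t) :=
    hSS.comp (continuous_const.add continuous_id)
  obtain ⟨h0, h1, h2⟩ := local_min_coeffs (S := fun t => SS μ W β (x0 + t))
    hc0.continuousAt (by simpa using hS0)
    (by
      have : Tendsto (fun t : ℝ => x0 + t) (𝓝 0) (𝓝 x0) := by
        have h := (by fun_prop : Continuous fun t : ℝ => x0 + t).tendsto 0
        rwa [add_zero] at h
      exact this.eventually hpos) (SS_expand H x0)
  have hlim := quad2_tendsto H x0 h0 h1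
  have him : Tendsto (fun η : ℝ => (((GG μ x0 η - (W x0 + ((deriv W x0 : ℝ) : ℂ) * (η * Complex.I)
      + ((deriv (deriv W) x0 : ℝ) : ℂ) / 2 * (η * Complex.I) ^ 2) / β) / η).im) ^ 2) (𝓝[>] 0) (𝓝 0) := by
    have h3 := ((hlim.norm).sub ((Complex.continuous_re.tendsto _).comp hlim)).div_const 2
    have h4 : (‖((a2 μ W β x0 : ℝ) : ℂ)‖ - (((a2 μ W β x0 : ℝ) : ℂ)).re) / 2 = 0 := by
      rw [Complex.norm_real, Complex.ofReal_re, Real.norm_of_nonneg h2]; simp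
    rw [h4] at h3
    refine h3.congr fun η => ?_
    rw [im_sq]
    rfl
  have hbound : ∀ᶠ η in 𝓝[>] (0:ℝ), (c / β) ^ 2 ≤ (((GG μ x0 η - (W x0 + ((deriv W x0 : ℝ) : ℂ) * (η * Complex.I)
      + ((deriv (deriv W) x0 : ℝ) : ℂ) / 2 * (η * Complex.I) ^ 2) / β) / η).im) ^ 2 := by
    filter_upwards [self_mem_nhdsWithin] with η (hη : 0 < η)
    have e : ((GG μ x0 η - (W x0 + ((deriv W x0 : ℝ) : ℂ) * (η * Complex.I)
      + ((deriv (deriv W) x0 : ℝ) : ℂ) / 2 * (η * Complex.I) ^ 2) / β) / η).im =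
        - (vv μ x0 η / η + deriv W x0 / β) := by
      have : (GG μ x0 η - (W x0 + ((deriv W x0 : ℝ) : ℂ) * (η * Complex.I)
      + ((deriv (deriv W) x0 : ℝ) : ℂ) / 2 * (η * Complex.I) ^ 2) / β).im = - vv μ x0 η - deriv W x0 * η / β := by
        rw [Complex.sub_im, GG_im x0 hη, Complex.div_ofReal_im]
        congr 2
        have : (W x0 + ((deriv W x0 : ℝ) : ℂ) * (η * Complex.I)
          + ((deriv (deriv W) x0 : ℝ) : ℂ) / 2 * (η * Complex.I) ^ 2) =
          ((W x0 - deriv (deriv W) x0 / 2 * η ^ 2 : ℝ) : ℂ) + ((deriv W x0 * η : ℝ) : ℂ) * Complex.I := by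
          rw [mul_pow, Complex.I_sq]; push_cast; ring
        rw [this]
        simp [-Complex.ofReal_sub, -Complex.ofReal_mul]
      rw [Complex.div_ofReal_im, this]
      field_simp
      ring
    rw [e, neg_sq]
    have m := H.mono x0
    have hc := H.hc
    have v := vv_nonneg (μ := μ) x0 hη
    have : c / β ≤ vv μ x0 η / η + deriv W x0 / β := by
      have : 0 ≤ vv μ x0 η / η := by positivity
      have : c / β ≤ deriv W x0 / β := by gcongr
      linarith
    gcongr
  have := ge_of_tendsto him hbound
  have : 0 < (c / β) ^ 2 := by have := H.hc; positivity
  linarith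

/-- collected hypotheses -/
structure Dat (β : ℝ) (Q h : ℝ → ℝ) (α M B : ℝ) : Prop where
  hβ : 0 < β
  Qs : ContDiff ℝ 5 Q
  hs : ContDiff ℝ 5 h
  Qev : ∀ t, Q (-t) = Q t
  hev : ∀ t, h (-t) = h t
  Q2 : ∀ t, α ≤ deriv (deriv Q) t
  h2 : ∀ t, |deriv (deriv h) t| ≤ M
  hB : ∀ n ≤ 5, ∀ t, |iteratedDeriv n h t| ≤ B
  hM : 0 ≤ M
  hMα : M < α

lemma quad_convex {f : ℝ → ℝ} (hf : ContDiff ℝ 2 f) {a : ℝ} (h : ∀ t, a ≤ deriv (deriv f) t) :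
    ConvexOn ℝ Set.univ (fun x => f x - a / 2 * x ^ 2) := by
  have h2 : ContDiff ℝ (1 + 1) f := by
    have : (1 + 1 : WithTop ℕ∞) = 2 := by norm_num
    rw [this]; exact hf
  have d0 := (contDiff_succ_iff_deriv.mp h2).1
  have d1 : Differentiable ℝ (deriv f) :=
    (contDiff_succ_iff_deriv.mp h2).2.2.differentiable (by norm_num)
  have e1 : ∀ x, HasDerivAt (fun x => f x - a / 2 * x ^ 2) (deriv f x - a * x) x := by
    intro x
    have := (d0 x).hasDerivAt.sub (((hasDerivAt_id x).pow 2).const_mul (a / 2))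
    refine HasDerivAt.congr_deriv this ?_
    simp only [id]
    norm_num
    ring
  have e1' : deriv (fun x => f x - a / 2 * x ^ 2) = fun x => deriv f x - a * x :=
    funext fun x => (e1 x).deriv
  have e2 : ∀ x, HasDerivAt (fun x => deriv f x - a * x) (deriv (deriv f) x - a) x := by
    intro x
    have := (d1 x).hasDerivAt.sub ((hasDerivAt_id x).const_mul a)
    refine HasDerivAt.congr_deriv this ?_
    ring
  refine convexOn_of_deriv2_nonneg' convex_univ ?_ ?_ ?_
  · exact fun x _ => (e1 x).differentiableAt.differentiableWithinAt
  · rw [e1']; exact fun x _ => (e2 x).differentiableAt.differentiableWithinAt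
  · intro x _
    simp only [Function.iterate_succ, Function.iterate_zero, Function.comp, id]
    rw [e1', (e2 x).deriv]
    linarith [h x]

lemma mid_convex {f : ℝ → ℝ} (hf : ContDiff ℝ 2 f) {a : ℝ} (h : ∀ t, a ≤ deriv (deriv f) t) (x y : ℝ) :
    f ((x + y) / 2) ≤ (f x + f y) / 2 - a / 8 * (x - y) ^ 2 := by
  have := (quad_convex hf h).2 (Set.mem_univ x) (Set.mem_univ y) (by norm_num : (0:ℝ) ≤ 1 / 2)
    (by norm_num : (0:ℝ) ≤ 1 / 2) (by norm_num)
  simp only [smul_eq_mul] at this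
  have e : 1 / 2 * x + 1 / 2 * y = (x + y) / 2 := by ring
  rw [e] at this
  nlinarith

lemma grad_mono {f : ℝ → ℝ} (hf : ContDiff ℝ 2 f) {a : ℝ} (h : ∀ t, a ≤ deriv (deriv f) t) (x y : ℝ) :
    a * (x - y) ^ 2 ≤ (deriv f x - deriv f y) * (x - y) := by
  have h2 : ContDiff ℝ (1 + 1) f := by
    have : (1 + 1 : WithTop ℕ∞) = 2 := by norm_num
    rw [this]; exact hf
  have d1 : Differentiable ℝ (deriv f) :=
    (contDiff_succ_iff_deriv.mp h2).2.2.differentiable (by norm_num)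
  have e2 : ∀ x, HasDerivAt (fun x => deriv f x - a * x) (deriv (deriv f) x - a) x := by
    intro x
    have := (d1 x).hasDerivAt.sub ((hasDerivAt_id x).const_mul a)
    refine HasDerivAt.congr_deriv this ?_
    ring
  have hm : Monotone (fun x => deriv f x - a * x) :=
    monotone_of_deriv_nonneg (fun x => (e2 x).differentiableAt) fun x => by
      rw [(e2 x).deriv]; linarith [h x]
  rcases le_total x y with hxy | hxy
  · have := hm hxy
    simp only at this
    nlinarith
  · have := hm hxy
    simp only at this
    nlinarith

lemma deriv_odd {f : ℝ → ℝ} (hf : ∀ t, f (-t) = f t) (t : ℝ) : deriv f (-t) = - deriv f t := by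
  have h1 : (fun x => f (-x)) = f := funext hf
  have := deriv_comp_neg f t
  rw [h1] at this
  linarith

lemma Dat.Q_lower {β : ℝ} {Q h : ℝ → ℝ} {α M B : ℝ} (D : Dat β Q h α M B) (t : ℝ) :
    Q 0 + α / 2 * t ^ 2 ≤ Q t := by
  have := mid_convex (D.Qs.of_le (by norm_num)) D.Q2 t (-t)
  rw [D.Qev] at this
  simp only [add_neg_cancel, zero_div] at this
  nlinarith

lemma Dat.hb {β : ℝ} {Q h : ℝ → ℝ} {α M B : ℝ} (D : Dat β Q h α M B) (t : ℝ) : |h t| ≤ B := by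
  simpa using D.hB 0 (by norm_num) t

lemma Dat.hb1 {β : ℝ} {Q h : ℝ → ℝ} {α M B : ℝ} (D : Dat β Q h α M B) (t : ℝ) : |deriv h t| ≤ B := by
  simpa using D.hB 1 (by norm_num) t

lemma Dat.hα {β : ℝ} {Q h : ℝ → ℝ} {α M B : ℝ} (D : Dat β Q h α M B) : 0 < α :=
  D.hM.trans_lt D.hMα

lemma sum_pairs {N : ℕ} (g : ℝ → ℝ) (hg : ∀ t, g (-t) = g t) (x : Fin N → ℝ) :
    ∑ i, ∑ j, g (x i - x j) = 2 * pairSum g x + N * g 0 := by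
  have h1 : ∑ i, ∑ j, g (x i - x j) = ∑ p : Fin N × Fin N, g (x p.1 - x p.2) := by
    rw [← Finset.univ_product_univ, Finset.sum_product]
  have h2 : ∑ p ∈ univ.filter (fun p : Fin N × Fin N => p.2 < p.1), g (x p.1 - x p.2) = pairSum g x := by
    unfold pairSum
    refine Finset.sum_bij' (fun p _ => p.swap) (fun p _ => p.swap) ?_ ?_ ?_ ?_ ?_
    · intro p hp; simpa using hp
    · intro p hp; simpa using hp
    · intro p _; simp
    · intro p _; simp
    · intro p _
      simp only [Prod.fst_swap, Prod.snd_swap]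
      rw [← hg]; congr 1; ring
  have h3 : ∑ p ∈ univ.filter (fun p : Fin N × Fin N => p.1 = p.2), g (x p.1 - x p.2) = N * g 0 := by
    have : ∑ p ∈ univ.filter (fun p : Fin N × Fin N => p.1 = p.2), g (x p.1 - x p.2)
        = ∑ p ∈ univ.filter (fun p : Fin N × Fin N => p.1 = p.2), g 0 := by
      apply Finset.sum_congr rfl
      intro p hp
      rw [(Finset.mem_filter.mp hp).2, sub_self]
    rw [this, Finset.sum_const, nsmul_eq_mul]
    congr 2
    have : (univ.filter (fun p : Fin N × Fin N => p.1 = p.2)) = (univ : Finset (Fin N)).diag := by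
      ext p; simp [Finset.mem_diag]
    rw [this, Finset.diag_card]; simp
  rw [h1, ← Finset.sum_filter_add_sum_filter_not univ (fun p : Fin N × Fin N => p.1 < p.2)]
  have h4 : ∑ p ∈ univ.filter (fun p : Fin N × Fin N => ¬ p.1 < p.2), g (x p.1 - x p.2)
      = ∑ p ∈ univ.filter (fun p : Fin N × Fin N => p.2 < p.1), g (x p.1 - x p.2) +
        ∑ p ∈ univ.filter (fun p : Fin N × Fin N => p.1 = p.2), g (x p.1 - x p.2) := by
    rw [← Finset.sum_union]
    · apply Finset.sum_congr _ (fun _ _ => rfl)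
      ext p
      simp only [Finset.mem_filter, Finset.mem_univ, true_and, Finset.mem_union, not_lt]
      rw [le_iff_lt_or_eq, eq_comm (a := p.2)]
    · rw [Finset.disjoint_filter]
      intro p _ h h'
      rw [h'] at h; exact lt_irrefl _ h
  rw [h4, h2, h3]
  unfold pairSum
  ring

/-- log of the weight for injective configurations -/
lemma vdm_eq_exp {N : ℕ} (β : ℝ) {x : Fin N → ℝ} (hx : Function.Injective x) :
    vdm β x = Real.exp (β * pairSum Real.log x) := by
  unfold vdm pairSum
  rw [Finset.mul_sum, Real.exp_sum]
  apply Finset.prod_congr rfl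
  intro p hp
  have hne : x p.1 - x p.2 ≠ 0 := by
    rw [sub_ne_zero]
    intro h
    have := hx h
    have hp' := (Finset.mem_filter.mp hp).2
    rw [this] at hp'; exact lt_irrefl _ hp'
  rw [Real.rpow_def_of_pos (abs_pos.mpr hne), Real.log_abs, mul_comm]

/-- the log weight -/
def lw (β : ℝ) (Q h : ℝ → ℝ) (N : ℕ) (x : Fin N → ℝ) : ℝ :=
  β * pairSum Real.log x + (-(N : ℝ) * ∑ j, Q (x j) - pairSum h x)

lemma weight_eq_exp {β : ℝ} {Q h : ℝ → ℝ} {N : ℕ} {x : Fin N → ℝ} (hx : Function.Injective x) :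
    weightH β Q h N x = Real.exp (lw β Q h N x) := by
  unfold weightH lw
  rw [vdm_eq_exp β hx, Real.exp_add]

lemma vdm_zero {N : ℕ} {β : ℝ} (hβ : 0 < β) {x : Fin N → ℝ} (hx : ¬ Function.Injective x) :
    vdm β x = 0 := by
  rw [Function.not_injective_iff] at hx
  obtain ⟨i, j, hij, hne⟩ := hx
  unfold vdm
  rcases lt_or_gt_of_ne hne with h | h
  · apply Finset.prod_eq_zero (i := (i, j))
    · simpa using h
    · simp [hij, Real.zero_rpow hβ.ne']
  · apply Finset.prod_eq_zero (i := (j, i))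
    · simpa using h
    · simp [hij, Real.zero_rpow hβ.ne']

lemma weight_nonneg (β : ℝ) (Q h : ℝ → ℝ) (N : ℕ) (x : Fin N → ℝ) : 0 ≤ weightH β Q h N x := by
  unfold weightH vdm
  positivity

lemma weight_cont {β : ℝ} {Q h : ℝ → ℝ} (hβ : 0 < β) (hQ : Continuous Q) (hh : Continuous h) (N : ℕ) :
    Continuous (weightH β Q h N) := by
  unfold weightH vdm pairSum
  refine Continuous.mul ?_ ?_
  · refine continuous_finsetProd _ fun p _ => ?_
    exact Continuous.rpow_const (by fun_prop) fun x => Or.inr hβ.le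
  · fun_prop

lemma lw_eq {β : ℝ} {Q h : ℝ → ℝ} (hev : ∀ t, h (-t) = h t) {N : ℕ} (x : Fin N → ℝ) :
    lw β Q h N x = -(N : ℝ) * ∑ j, Q (x j) + (1 / 2) * ∑ i, ∑ j, (β * Real.log (x i - x j) - h (x i - x j))
      + N * h 0 / 2 := by
  have h1 := sum_pairs (fun t => β * Real.log t - h t) (by intro t; simp [hev]) x
  rw [h1]
  unfold lw pairSum
  rw [Finset.sum_sub_distrib, ← Finset.mul_sum]
  simp
  ring

lemma weight_perm {β : ℝ} {Q h : ℝ → ℝ} (hβ : 0 < β) (hev : ∀ t, h (-t) = h t) {N : ℕ}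
    (σ : Equiv.Perm (Fin N)) (x : Fin N → ℝ) : weightH β Q h N (x ∘ σ) = weightH β Q h N x := by
  by_cases hx : Function.Injective x
  · rw [weight_eq_exp hx, weight_eq_exp (hx.comp σ.injective), lw_eq hev, lw_eq hev]
    congr 2
    simp only [Function.comp]
    congr 1
    · congr 1
      exact Equiv.sum_comp σ (fun j => Q (x j))
    · congr 1
      rw [← Equiv.sum_comp σ (fun i => ∑ j, (β * Real.log (x i - x j) - h (x i - x j)))]
      apply Finset.sum_congr rfl
      intro i _
      exact Equiv.sum_comp σ (fun j => β * Real.log (x (σ i) - x j) - h (x (σ i) - x j))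
  · have hx' : ¬ Function.Injective (x ∘ σ) := by
      rwa [σ.injective_comp]
    unfold weightH
    rw [vdm_zero hβ hx, vdm_zero hβ hx', zero_mul, zero_mul]

lemma vdm_crude {N : ℕ} {β : ℝ} (hβ : 0 < β) (x : Fin N → ℝ) :
    vdm β x ≤ Real.exp (∑ i, 2 * N * β * |x i|) := by
  have hterm : ∀ p : Fin N × Fin N, |x p.1 - x p.2| ^ β ≤ Real.exp (β * |x p.1| + β * |x p.2|) := by
    intro p
    have h1 : |x p.1 - x p.2| ≤ Real.exp (|x p.1| + |x p.2|) := by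
      refine (abs_sub _ _).trans ?_
      have := Real.add_one_le_exp (|x p.1| + |x p.2|)
      linarith
    calc |x p.1 - x p.2| ^ β ≤ (Real.exp (|x p.1| + |x p.2|)) ^ β :=
          Real.rpow_le_rpow (abs_nonneg _) h1 hβ.le
      _ = _ := by rw [← Real.exp_mul]; congr 1; ring
  unfold vdm
  calc _ ≤ ∏ p ∈ univ.filter (fun p : Fin N × Fin N => p.1 < p.2), Real.exp (β * |x p.1| + β * |x p.2|) :=
        Finset.prod_le_prod (fun p _ => by positivity) fun p _ => hterm p
    _ = Real.exp (∑ p ∈ univ.filter (fun p : Fin N × Fin N => p.1 < p.2), (β * |x p.1| + β * |x p.2|)) :=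
        (Real.exp_sum _ _).symm
    _ ≤ Real.exp (∑ p : Fin N × Fin N, (β * |x p.1| + β * |x p.2|)) := by
        apply Real.exp_le_exp.mpr
        apply Finset.sum_le_sum_of_subset_of_nonneg (Finset.filter_subset _ _)
        intros; positivity
    _ = _ := by
        congr 1
        rw [← Finset.univ_product_univ, Finset.sum_product]
        simp only [Finset.sum_add_distrib, Finset.sum_const, Finset.card_univ, Fintype.card_fin, nsmul_eq_mul]
        simp only [← Finset.mul_sum]
        ring

lemma pairSum_bound {N : ℕ} {h : ℝ → ℝ} {B : ℝ} (hb : ∀ t, |h t| ≤ B) (x : Fin N → ℝ) :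
    |pairSum h x| ≤ N ^ 2 * B := by
  have hB : 0 ≤ B := (abs_nonneg _).trans (hb 0)
  unfold pairSum
  calc _ ≤ ∑ p ∈ univ.filter (fun p : Fin N × Fin N => p.1 < p.2), |h (x p.1 - x p.2)| :=
        Finset.abs_sum_le_sum_abs _ _
    _ ≤ ∑ p : Fin N × Fin N, |h (x p.1 - x p.2)| :=
        Finset.sum_le_sum_of_subset_of_nonneg (Finset.filter_subset _ _) (by intros; positivity)
    _ ≤ ∑ p : Fin N × Fin N, B := Finset.sum_le_sum fun p _ => hb _
    _ = _ := by simp; left; ring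

lemma Dat.weight_crude {β : ℝ} {Q h : ℝ → ℝ} {α M B : ℝ} (D : Dat β Q h α M B) (N : ℕ) :
    ∃ C, 0 < C ∧ ∀ x : Fin N → ℝ, weightH β Q h N x ≤ C * Real.exp (-(N * α / 4) * ∑ i, x i ^ 2) := by
  have hα := D.hα
  have hβ := D.hβ
  refine ⟨Real.exp (N ^ 2 * B + N * (N * (4 * β ^ 2 / α - Q 0))), Real.exp_pos _, fun x => ?_⟩
  unfold weightH
  calc _ ≤ Real.exp (∑ i, 2 * N * β * |x i|) * Real.exp (-(N : ℝ) * ∑ j, Q (x j) - pairSum h x) := by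
        gcongr; exact vdm_crude D.hβ x
    _ ≤ _ := by
        rw [← Real.exp_add, ← Real.exp_add]
        apply Real.exp_le_exp.mpr
        have h1 := (abs_le.mp (pairSum_bound D.hb x)).1
        have h2 : ∑ i, (2 * N * β * |x i| - N * Q (x i)) ≤ ∑ i, (N * (4 * β ^ 2 / α - Q 0) - N * α / 4 * x i ^ 2) := by
          apply Finset.sum_le_sum
          intro i _
          have hq := D.Q_lower (x i)
          have hy : 2 * β * |x i| ≤ α / 4 * x i ^ 2 + 4 * β ^ 2 / α := by
            have : α / 4 * x i ^ 2 + 4 * β ^ 2 / α - 2 * β * |x i| = (α * |x i| - 4 * β) ^ 2 / (4 * α) := by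
              rw [← sq_abs (x i)]
              field_simp
              ring
            have h0 : 0 ≤ (α * |x i| - 4 * β) ^ 2 / (4 * α) := by positivity
            linarith
          have hN : (0:ℝ) ≤ N := Nat.cast_nonneg N
          have : 2 * β * |x i| - Q (x i) ≤ 4 * β ^ 2 / α - Q 0 - α / 4 * x i ^ 2 := by linarith
          have := mul_le_mul_of_nonneg_left this hN
          linarith
        rw [Finset.sum_sub_distrib, Finset.sum_sub_distrib, ← Finset.mul_sum, ← Finset.mul_sum,
          ← Finset.mul_sum, Finset.sum_const, Finset.card_univ, Fintype.card_fin, nsmul_eq_mul] at h2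
        rw [← Finset.mul_sum]
        try rw [← Finset.mul_sum] at h2
        linarith

lemma integrable_gauss {N : ℕ} {b : ℝ} (hb : 0 < b) :
    Integrable (fun x : Fin N → ℝ => Real.exp (-b * ∑ i, x i ^ 2)) := by
  have : (fun x : Fin N → ℝ => Real.exp (-b * ∑ i, x i ^ 2)) = fun x => ∏ i, Real.exp (-b * x i ^ 2) := by
    ext x
    rw [Finset.mul_sum, Real.exp_sum]
  rw [this]
  exact Integrable.fintype_prod (f := fun _ : Fin N => fun t : ℝ => Real.exp (-b * t ^ 2))
    fun _ => integrable_exp_neg_mul_sq hb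

lemma Dat.weight_int {β : ℝ} {Q h : ℝ → ℝ} {α M B : ℝ} (D : Dat β Q h α M B) {N : ℕ} (hN : 0 < N) :
    Integrable (weightH β Q h N) := by
  obtain ⟨C, hC, hw⟩ := D.weight_crude N
  have hα := D.hα
  have : (0:ℝ) < N := Nat.cast_pos.mpr hN
  refine ((integrable_gauss (N := N) (b := N * α / 4) (by positivity)).const_mul C).mono'
    (weight_cont D.hβ D.Qs.continuous D.hs.continuous N).aestronglyMeasurable ?_
  refine Eventually.of_forall fun x => ?_
  rw [Real.norm_of_nonneg (weight_nonneg _ _ _ _ _)]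
  exact hw x

lemma Dat.weight_sq_int {β : ℝ} {Q h : ℝ → ℝ} {α M B : ℝ} (D : Dat β Q h α M B) {N : ℕ} (hN : 0 < N)
    (z : Fin N → ℝ) :
    Integrable (fun x => weightH β Q h N x * ∑ i, (x i - z i) ^ 2) := by
  obtain ⟨C, hC, hw⟩ := D.weight_crude N
  have hα := D.hα
  have : (0:ℝ) < N := Nat.cast_pos.mpr hN
  set b := N * α / 4 with hb
  have hb0 : 0 < b := by positivity
  have hcont := weight_cont D.hβ D.Qs.continuous D.hs.continuous N
  refine (((integrable_gauss (N := N) (b := b / 2) (by positivity)).const_mul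
    (C * (4 / b + 2 * ∑ i, z i ^ 2)))).mono' (hcont.mul (by fun_prop)).aestronglyMeasurable ?_
  refine Eventually.of_forall fun x => ?_
  rw [Real.norm_of_nonneg (mul_nonneg (weight_nonneg _ _ _ _ _) (by positivity))]
  set S := ∑ i, x i ^ 2
  have hS : 0 ≤ S := by positivity
  set Z := ∑ i, z i ^ 2
  have hZ : 0 ≤ Z := by positivity
  have h1 : ∑ i, (x i - z i) ^ 2 ≤ 2 * S + 2 * Z := by
    simp only [S, Z, Finset.mul_sum, ← Finset.sum_add_distrib]
    apply Finset.sum_le_sum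
    intro i _
    nlinarith [sq_nonneg (x i + z i)]
  have h2 : Real.exp (-b * S) * (2 * S + 2 * Z) ≤ (4 / b + 2 * Z) * Real.exp (-(b / 2) * S) := by
    have e1 : Real.exp (-b * S) = Real.exp (-(b / 2) * S) * Real.exp (-(b / 2) * S) := by
      rw [← Real.exp_add]; congr 1; ring
    have e2 : Real.exp (-(b / 2) * S) ≤ 1 := Real.exp_le_one_iff.mpr (by nlinarith)
    have e3 : Real.exp (-(b / 2) * S) * S ≤ 2 / b := by
      have h3 := Real.add_one_le_exp (b / 2 * S)
      have h4 : Real.exp (-(b / 2) * S) * Real.exp (b / 2 * S) = 1 := by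
        rw [← Real.exp_add]; simp
      have h5 := Real.exp_pos (-(b / 2) * S)
      have h6 : b / 2 * (Real.exp (-(b / 2) * S) * S) ≤ 1 := by nlinarith
      rw [le_div_iff₀ hb0]; linarith
    have h5 := Real.exp_pos (-(b / 2) * S)
    rw [e1]
    have e4 : Real.exp (-(b / 2) * S) * (2 * S + 2 * Z) ≤ 4 / b + 2 * Z := by
      have : 4 / b = 2 * (2 / b) := by ring
      nlinarith
    nlinarith
  calc _ ≤ (C * Real.exp (-b * S)) * (2 * S + 2 * Z) :=
        mul_le_mul (hw x) h1 (by positivity) (by positivity)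
    _ = C * (Real.exp (-b * S) * (2 * S + 2 * Z)) := by ring
    _ ≤ C * ((4 / b + 2 * Z) * Real.exp (-(b / 2) * S)) := by gcongr
    _ = _ := by ring

lemma weight_pos {β : ℝ} {Q h : ℝ → ℝ} {N : ℕ} {x : Fin N → ℝ} (hx : Function.Injective x) :
    0 < weightH β Q h N x := by
  rw [weight_eq_exp hx]; exact Real.exp_pos _

lemma inj_ex (N : ℕ) : Function.Injective (fun i : Fin N => (i : ℝ)) := fun i j h => by
  have : ((i : ℕ) : ℝ) = ((j : ℕ) : ℝ) := h
  exact Fin.ext (by exact_mod_cast this)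

lemma Dat.exists_max {β : ℝ} {Q h : ℝ → ℝ} {α M B : ℝ} (D : Dat β Q h α M B) {N : ℕ} (hN : 0 < N) :
    ∃ z : Fin N → ℝ, StrictMono z ∧ ∀ x, weightH β Q h N x ≤ weightH β Q h N z := by
  obtain ⟨C, hC, hw⟩ := D.weight_crude N
  have hα := D.hα
  have hN' : (0:ℝ) < N := Nat.cast_pos.mpr hN
  set b := N * α / 4 with hb
  have hb0 : 0 < b := by positivity
  have hcont := weight_cont D.hβ D.Qs.continuous D.hs.continuous N
  have hp := weight_pos (β := β) (Q := Q) (h := h) (inj_ex N)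
  have hev : ∀ᶠ x in cocompact (Fin N → ℝ), weightH β Q h N x ≤ weightH β Q h N (fun i : Fin N => (i : ℝ)) := by
    have h1 : Tendsto (fun x : Fin N → ℝ => C * Real.exp (-b * ‖x‖ ^ 2)) (cocompact _) (𝓝 (C * 0)) := by
      refine Tendsto.const_mul C ?_
      refine Real.tendsto_exp_atBot.comp ?_
      refine Tendsto.const_mul_atTop_of_neg (by linarith) ?_
      exact (tendsto_pow_atTop (by norm_num)).comp (tendsto_norm_cocompact_atTop)
    rw [mul_zero] at h1
    filter_upwards [h1.eventually_lt_const hp] with x hx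
    refine (hw x).trans (le_trans ?_ hx.le)
    gcongr C * Real.exp ?_
    have h2 : ‖x‖ ^ 2 ≤ ∑ i, x i ^ 2 := by
      have : Nonempty (Fin N) := ⟨⟨0, hN⟩⟩
      obtain ⟨i, hi⟩ := Finite.exists_max (fun i => ‖x i‖)
      have : ‖x‖ ≤ ‖x i‖ := (pi_norm_le_iff_of_nonneg (norm_nonneg _)).mpr hi
      calc ‖x‖ ^ 2 ≤ ‖x i‖ ^ 2 := by gcongr
        _ = x i ^ 2 := by rw [Real.norm_eq_abs, sq_abs]
        _ ≤ _ := Finset.single_le_sum (f := fun i => x i ^ 2) (fun j _ => sq_nonneg _) (Finset.mem_univ i)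
    nlinarith
  obtain ⟨y, hy⟩ := hcont.exists_forall_ge' _ hev
  have hyinj : Function.Injective y := by
    by_contra hcon
    have h0 : weightH β Q h N y = 0 := by unfold weightH; rw [vdm_zero D.hβ hcon, zero_mul]
    have := hy (fun i : Fin N => (i : ℝ))
    linarith
  refine ⟨y ∘ Tuple.sort y, ?_, fun x => ?_⟩
  · exact (Tuple.monotone_sort y).strictMono_of_injective (hyinj.comp (Tuple.sort y).injective)
  · rw [weight_perm D.hβ D.hev]; exact hy x

/-- weak Euler-Lagrange -/
lemma Dat.EL {β : ℝ} {Q h : ℝ → ℝ} {α M B : ℝ} (D : Dat β Q h α M B) {N : ℕ}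
    {z : Fin N → ℝ} (hz : Function.Injective z) (hmax : ∀ x, weightH β Q h N x ≤ weightH β Q h N z)
    (i : Fin N) : N * deriv Q (z i) + ∑ j, (deriv h (z i - z j) - β * (z i - z j)⁻¹) = 0 := by
  set v : Fin N → ℝ := Pi.single i 1 with hv
  set F : Fin N → Fin N → ℝ := fun k l => β * (z k - z l)⁻¹ - deriv h (z k - z l) with hF
  have hanti : ∀ k l, F l k = - F k l := by
    intro k l
    simp only [hF]
    rw [← neg_sub (z k) (z l), deriv_odd D.hev, inv_neg]
    ring
  have hcurve : Continuous fun t : ℝ => (fun k => z k + t * v k : Fin N → ℝ) := by fun_prop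
  have hder : HasDerivAt (fun t : ℝ => lw β Q h N (fun k => z k + t * v k))
      (-(N : ℝ) * ∑ k, deriv Q (z k) * v k + (1 / 2) * ∑ k, ∑ l, F k l * (v k - v l)) 0 := by
    have e : (fun t : ℝ => lw β Q h N (fun k => z k + t * v k)) = fun t =>
        -(N : ℝ) * ∑ j, Q (z j + t * v j) + (1 / 2) * ∑ k, ∑ l, (β * Real.log ((z k + t * v k) - (z l + t * v l))
          - h ((z k + t * v k) - (z l + t * v l))) + N * h 0 / 2 := by
      ext t
      rw [lw_eq D.hev]
    rw [e]
    have hlin : ∀ a b : ℝ, HasDerivAt (fun t : ℝ => a + t * b) b 0 := by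
      intro a b
      simpa using ((hasDerivAt_id (0:ℝ)).mul_const b).const_add a
    refine HasDerivAt.add_const _ ?_
    refine HasDerivAt.add ?_ ?_
    · refine HasDerivAt.const_mul _ ?_
      refine HasDerivAt.fun_sum fun k _ => ?_
      have hq : HasDerivAt Q (deriv Q (z k)) (z k + 0 * v k) := by
        rw [zero_mul, add_zero]
        exact (D.Qs.differentiable (by norm_num) _).hasDerivAt
      exact hq.comp 0 (hlin (z k) (v k))
    · refine HasDerivAt.const_mul _ ?_
      refine HasDerivAt.fun_sum fun k _ => HasDerivAt.fun_sum fun l _ => ?_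
      have hd := (hlin (z k) (v k)).sub (hlin (z l) (v l))
      have hh : HasDerivAt h (deriv h (z k - z l)) ((z k + 0 * v k) - (z l + 0 * v l)) := by
        simp only [zero_mul, add_zero]
        exact (D.hs.differentiable (by norm_num) _).hasDerivAt
      have h2 := hh.comp (0:ℝ) hd
      by_cases hkl : k = l
      · subst hkl
        simpa [hF] using hasDerivAt_const (0:ℝ) (-h 0)
      · have hne : (z k + 0 * v k) - (z l + 0 * v l) ≠ 0 := by
          simp only [zero_mul, add_zero]
          exact sub_ne_zero.mpr fun h => hkl (hz h)
        have h3 := (hd.log hne).const_mul β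
        refine (h3.sub h2).congr_deriv ?_
        simp only [hF, zero_mul, add_zero, Pi.sub_apply]
        ring
  have hloc : IsLocalMax (fun t : ℝ => lw β Q h N (fun k => z k + t * v k)) 0 := by
    have hzpos := weight_pos (β := β) (Q := Q) (h := h) hz
    have hwc : Continuous fun t : ℝ => weightH β Q h N (fun k => z k + t * v k) :=
      (weight_cont D.hβ D.Qs.continuous D.hs.continuous N).comp hcurve
    have h0 : (fun k => z k + 0 * v k) = z := by ext k; simp
    have : ∀ᶠ t in 𝓝 (0:ℝ), 0 < weightH β Q h N (fun k => z k + t * v k) := by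
      have := hwc.tendsto 0
      rw [h0] at this
      exact this.eventually_const_lt hzpos
    filter_upwards [this] with t ht
    have hinj : Function.Injective (fun k => z k + t * v k) := by
      by_contra hcon
      have h0 : weightH β Q h N (fun k => z k + t * v k) = 0 := by
        unfold weightH; rw [vdm_zero D.hβ hcon, zero_mul]
      linarith
    have := hmax (fun k => z k + t * v k)
    rw [weight_eq_exp hinj, weight_eq_exp hz, Real.exp_le_exp] at this
    simp only [h0]
    exact this
  have h0 := hloc.hasDerivAt_eq_zero hder
  have h1 : ∑ k, ∑ l, F k l * (v k - v l) = 2 * ∑ k, ∑ l, F k l * v k := by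
    have a : ∑ k, ∑ l, F k l * v l = - ∑ k, ∑ l, F k l * v k := by
      rw [Finset.sum_comm, ← Finset.sum_neg_distrib]
      apply Finset.sum_congr rfl; intro k _
      rw [← Finset.sum_neg_distrib]
      apply Finset.sum_congr rfl; intro l _
      rw [hanti k l]; ring
    simp only [mul_sub, Finset.sum_sub_distrib]
    rw [a]; ring
  have h2 : ∑ k, ∑ l, F k l * v k = ∑ l, F i l := by
    rw [Finset.sum_eq_single i]
    · simp [hv]
    · intro k _ hk
      simp [hv, Pi.single_eq_of_ne hk]
    · simp
  have h3 : ∑ k, deriv Q (z k) * v k = deriv Q (z i) := by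
    rw [Finset.sum_eq_single i]
    · simp [hv]
    · intro k _ hk
      simp [hv, Pi.single_eq_of_ne hk]
    · simp
  rw [h1, h2, h3] at h0
  have h4 : ∑ j, (deriv h (z i - z j) - β * (z i - z j)⁻¹) = - ∑ l, F i l := by
    rw [← Finset.sum_neg_distrib]
    apply Finset.sum_congr rfl; intro l _
    simp only [hF]; ring
  rw [h4]
  linarith

lemma xlogx_ge {x : ℝ} (hx : 0 ≤ x) : x - 1 ≤ x * Real.log x := by
  rcases hx.eq_or_lt with h | h
  · subst h; simp
  · have := Real.one_sub_inv_le_log_of_pos h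
    have := mul_le_mul_of_nonneg_left this hx
    have e : x * (1 - x⁻¹) = x - 1 := by field_simp
    linarith

lemma int_log_ge (a : ℝ) : -2 ≤ ∫ s in (0:ℝ)..1, Real.log (s - a) := by
  rw [intervalIntegral.integral_comp_sub_right (fun s => Real.log s) a, integral_log]
  rcases le_total a 0 with h | h
  · -- b = -a ≥ 0
    have h1 : (0 - a) * Real.log (0 - a) ≤ (1 - a) * Real.log (1 - a) := by
      have l1 : 0 ≤ Real.log (1 - a) := Real.log_nonneg (by linarith)
      rcases h.eq_or_lt with h' | h'
      · subst h'; simp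
      · have l2 : Real.log (0 - a) ≤ Real.log (1 - a) := Real.log_le_log (by linarith) (by linarith)
        nlinarith
    linarith
  · rcases le_total a 1 with h' | h'
    · have l1 := xlogx_ge h
      have l2 := xlogx_ge (sub_nonneg.mpr h')
      have e : Real.log (0 - a) = Real.log a := by rw [zero_sub, Real.log_neg_eq_log]
      rw [e]
      linarith
    · have e : Real.log (0 - a) = Real.log a := by rw [zero_sub, Real.log_neg_eq_log]
      have e' : Real.log (1 - a) = Real.log (a - 1) := by rw [← neg_sub, Real.log_neg_eq_log]
      rw [e, e']
      have h1 : (a - 1) * Real.log (a - 1) ≤ a * Real.log a := by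
        have l1 : 0 ≤ Real.log a := Real.log_nonneg h'
        rcases h'.eq_or_lt with h2 | h2
        · subst h2; simp
        · have l2 : Real.log (a - 1) ≤ Real.log a := Real.log_le_log (by linarith) (by linarith)
          nlinarith
      linarith

lemma int_log_ok (a : ℝ) : IntervalIntegrable (fun s => Real.log (s - a)) volume 0 1 := by
  have := (intervalIntegral.intervalIntegrable_log' (a := 0 - a) (b := 1 - a)).comp_sub_right a
  simpa using this

/-- moving one coordinate -/
lemma lw_update {β : ℝ} {Q h : ℝ → ℝ} (hev : ∀ t, h (-t) = h t) {N : ℕ} (x : Fin N → ℝ) (i : Fin N) (s : ℝ) :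
    lw β Q h N (Function.update x i s) = -(N : ℝ) * Q s + ∑ j ∈ univ.erase i, (β * Real.log (s - x j) - h (s - x j))
      + (-(N : ℝ) * ∑ j ∈ univ.erase i, Q (x j) + (1 / 2) * ∑ k ∈ univ.erase i, ∑ l ∈ univ.erase i,
        (β * Real.log (x k - x l) - h (x k - x l)) - h 0 / 2 + N * h 0 / 2) := by
  rw [lw_eq hev]
  set G : ℝ → ℝ := fun t => β * Real.log t - h t with hG
  have hGe : ∀ t, G (-t) = G t := by intro t; simp [hG, hev]
  have hG0 : G 0 = - h 0 := by simp [hG]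
  set y := Function.update x i s with hy
  have hyi : y i = s := by simp [hy]
  have hyj : ∀ j ∈ univ.erase i, y j = x j := by
    intro j hj
    simp [hy, Function.update_of_ne (Finset.ne_of_mem_erase hj)]
  have e1 : ∑ j, Q (y j) = Q s + ∑ j ∈ univ.erase i, Q (x j) := by
    rw [← Finset.add_sum_erase univ _ (Finset.mem_univ i), hyi]
    congr 1
    exact Finset.sum_congr rfl fun j hj => by rw [hyj j hj]
  have e2 : ∀ k, ∑ l, G (y k - y l) = G (y k - s) + ∑ l ∈ univ.erase i, G (y k - x l) := by
    intro k
    rw [← Finset.add_sum_erase univ _ (Finset.mem_univ i), hyi]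
    congr 1
    exact Finset.sum_congr rfl fun j hj => by rw [hyj j hj]
  have e3 : ∑ k, ∑ l, G (y k - y l) = G 0 + 2 * ∑ l ∈ univ.erase i, G (s - x l)
      + ∑ k ∈ univ.erase i, ∑ l ∈ univ.erase i, G (x k - x l) := by
    simp only [e2]
    rw [← Finset.add_sum_erase univ _ (Finset.mem_univ i), hyi, sub_self]
    have : ∑ k ∈ univ.erase i, (G (y k - s) + ∑ l ∈ univ.erase i, G (y k - x l))
        = ∑ k ∈ univ.erase i, (G (s - x k) + ∑ l ∈ univ.erase i, G (x k - x l)) := by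
      refine Finset.sum_congr rfl fun j hj => ?_
      rw [hyj j hj, ← hGe, neg_sub]
    rw [this, Finset.sum_add_distrib]
    ring
  change -(N : ℝ) * ∑ j, Q (y j) + 1 / 2 * ∑ k, ∑ l, G (y k - y l) + _ = -(N : ℝ) * Q s + ∑ j ∈ univ.erase i, G (s - x j)
    + (-(N : ℝ) * ∑ j ∈ univ.erase i, Q (x j) + (1 / 2) * ∑ k ∈ univ.erase i, ∑ l ∈ univ.erase i, G (x k - x l) - _ + _)
  rw [e1, e3, hG0]
  ring

lemma Dat.sup_bound {β : ℝ} {Q h : ℝ → ℝ} {α M B : ℝ} (D : Dat β Q h α M B) :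
    ∃ R : ℝ, 0 < R ∧ ∀ N : ℕ, ∀ z : Fin N → ℝ, Function.Injective z →
      (∀ x, weightH β Q h N x ≤ weightH β Q h N z) → ∀ i, |z i| ≤ R := by
  have hα := D.hα
  have hβ := D.hβ
  have hB : 0 ≤ B := (abs_nonneg _).trans (D.hb 0)
  obtain ⟨q, hq⟩ := (isCompact_Icc (a := (0:ℝ)) (b := 1)).exists_bound_of_continuousOn
    D.Qs.continuous.continuousOn
  set C := |q| + |Q 0| + 2 * B + 2 * β with hC
  have hC0 : 0 ≤ C := by positivity
  refine ⟨1 + 2 * (C + 2 * β) / α, by positivity, ?_⟩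
  intro N z hz hmax i0
  have : Nonempty (Fin N) := ⟨i0⟩
  obtain ⟨i, hi⟩ := Finite.exists_max (fun i => |z i|)
  refine (hi i0).trans ?_
  set m := |z i| with hm
  by_contra hcon
  push Not at hcon
  have hm1 : 1 ≤ m := by
    have : 0 ≤ 2 * (C + 2 * β) / α := by positivity
    linarith
  have hN : (0:ℝ) < N := by
    have := i0.pos
    exact_mod_cast this
  -- comparison for a.e. s
  set A : ℝ := -(N : ℝ) * Q (z i) + ∑ j ∈ univ.erase i, (β * Real.log (z i - z j) - h (z i - z j)) with hA
  have hcmp : ∀ s, (∀ j, s ≠ z j) → -(N : ℝ) * Q s + ∑ j ∈ univ.erase i, (β * Real.log (s - z j) - h (s - z j)) ≤ A := by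
    intro s hs
    have hinj : Function.Injective (Function.update z i s) := by
      intro k l hkl
      by_cases hk : k = i <;> by_cases hl : l = i
      · rw [hk, hl]
      · subst hk
        rw [Function.update_self, Function.update_of_ne hl] at hkl
        exact absurd hkl (hs l)
      · subst hl
        rw [Function.update_self, Function.update_of_ne hk] at hkl
        exact absurd hkl.symm (hs k)
      · rw [Function.update_of_ne hk, Function.update_of_ne hl] at hkl
        exact hz hkl
    have h1 := hmax (Function.update z i s)
    rw [weight_eq_exp hinj, weight_eq_exp hz, Real.exp_le_exp] at h1
    have h2 := lw_update (β := β) (Q := Q) D.hev z i (z i)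
    rw [Function.update_eq_self] at h2
    rw [lw_update D.hev, h2] at h1
    linarith
  have hcmp2 : ∀ s ∈ Set.Icc (0:ℝ) 1, (∀ j, s ≠ z j) →
      -(N : ℝ) * |q| - N * B + ∑ j ∈ univ.erase i, β * Real.log (s - z j) ≤ A := by
    intro s hs hne
    refine le_trans ?_ (hcmp s hne)
    have h1 : Q s ≤ |q| := (le_abs_self _).trans ((hq s hs).trans (le_abs_self q))
    have h2 : ∑ j ∈ univ.erase i, h (s - z j) ≤ N * B := by
      calc _ ≤ ∑ j ∈ univ.erase i, B := Finset.sum_le_sum fun j _ => (le_abs_self _).trans (D.hb _)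
        _ ≤ ∑ j : Fin N, B := Finset.sum_le_sum_of_subset_of_nonneg (Finset.erase_subset _ _) (by intros; exact hB)
        _ = _ := by simp
    rw [Finset.sum_sub_distrib]
    nlinarith
  have hae : ∀ᵐ s ∂(volume.restrict (Set.Icc (0:ℝ) 1)),
      -(N : ℝ) * |q| - N * B + ∑ j ∈ univ.erase i, β * Real.log (s - z j) ≤ A := by
    have hfin : (Set.range z).Finite := Set.finite_range z
    have h0 : ∀ᵐ s : ℝ ∂volume, s ∉ Set.range z := by
      exact compl_mem_ae_iff.mpr (hfin.measure_zero _)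
    filter_upwards [ae_restrict_mem measurableSet_Icc, ae_restrict_of_ae h0] with s hs hs'
    exact hcmp2 s hs fun j hj => hs' ⟨j, hj.symm⟩
  have hIntE : ∀ j ∈ univ.erase i, IntervalIntegrable (fun s => β * Real.log (s - z j)) volume 0 1 :=
    fun j _ => (int_log_ok (z j)).const_mul β
  have hIntS : IntervalIntegrable (fun s => ∑ j ∈ univ.erase i, β * Real.log (s - z j)) volume 0 1 := by
    have := IntervalIntegrable.sum (univ.erase i) hIntE
    have e : (fun s => ∑ j ∈ univ.erase i, β * Real.log (s - z j)) =
        ∑ j ∈ univ.erase i, fun s => β * Real.log (s - z j) := by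
      ext s; simp
    rw [e]; exact this
  have hI := intervalIntegral.integral_mono_ae_restrict (μ := volume) (a := 0) (b := 1)
    (f := fun s => -(N : ℝ) * |q| - N * B + ∑ j ∈ univ.erase i, β * Real.log (s - z j))
    (g := fun _ => A) zero_le_one (intervalIntegrable_const.add hIntS) intervalIntegrable_const hae
  rw [intervalIntegral.integral_add intervalIntegrable_const hIntS,
    intervalIntegral.integral_finsetSum hIntE] at hI
  simp only [intervalIntegral.integral_const, sub_zero, one_smul, intervalIntegral.integral_const_mul] at hI
  have hlow : - (2 * β * N) ≤ ∑ j ∈ univ.erase i, β * ∫ s in (0:ℝ)..1, Real.log (s - z j) := by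
    calc - (2 * β * N) = ∑ j : Fin N, (- (2 * β)) := by simp; ring
      _ ≤ ∑ j ∈ univ.erase i, (- (2 * β)) := by
          rw [← Finset.add_sum_erase univ _ (Finset.mem_univ i)]; linarith
      _ ≤ _ := by
          refine Finset.sum_le_sum fun j _ => ?_
          have := int_log_ge (z j)
          nlinarith
  have hup : A ≤ -(N : ℝ) * (Q 0 + α / 2 * m ^ 2) + N * (2 * β * m) + N * B := by
    rw [hA, Finset.sum_sub_distrib]
    have h1 := D.Q_lower (z i)
    rw [← sq_abs (z i), ← hm] at h1
    have h2 : - ∑ j ∈ univ.erase i, h (z i - z j) ≤ N * B := by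
      rw [← Finset.sum_neg_distrib]
      calc _ ≤ ∑ j ∈ univ.erase i, B := Finset.sum_le_sum fun j _ => (neg_le_abs _).trans (D.hb _)
        _ ≤ ∑ j : Fin N, B := Finset.sum_le_sum_of_subset_of_nonneg (Finset.erase_subset _ _) (by intros; exact hB)
        _ = _ := by simp
    have h3 : ∑ j ∈ univ.erase i, β * Real.log (z i - z j) ≤ N * (2 * β * m) := by
      calc _ ≤ ∑ j ∈ univ.erase i, 2 * β * m := by
            refine Finset.sum_le_sum fun j hj => ?_
            have hne : z i - z j ≠ 0 := sub_ne_zero.mpr fun h => (Finset.ne_of_mem_erase hj) (hz h).symm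
            have a1 : |z i - z j| ≤ 2 * m := (abs_sub _ _).trans (by linarith [hi j])
            have a2 := Real.log_le_sub_one_of_pos (abs_pos.mpr hne)
            rw [Real.log_abs] at a2
            nlinarith
        _ ≤ ∑ j : Fin N, 2 * β * m := Finset.sum_le_sum_of_subset_of_nonneg (Finset.erase_subset _ _)
            (by intros; positivity)
        _ = _ := by simp
    nlinarith
  have hfin : α / 2 * m ^ 2 ≤ C + 2 * β * m := by
    have h1 : (N : ℝ) * (α / 2 * m ^ 2) ≤ N * (C + 2 * β * m) := by
      have : - Q 0 ≤ |Q 0| := neg_le_abs _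
      have := mul_le_mul_of_nonneg_left this hN.le
      rw [hC]
      linarith
    exact le_of_mul_le_mul_left h1 hN
  have h2 : C + 2 * β * m ≤ (C + 2 * β) * m := by nlinarith
  have h3 : α / 2 * m ≤ C + 2 * β := by
    have : (α / 2 * m) * m ≤ (C + 2 * β) * m := by nlinarith
    exact le_of_mul_le_mul_right this (by linarith)
  have h4 : m ≤ 2 * (C + 2 * β) / α := by
    rw [le_div_iff₀ hα]; linarith
  linarith

lemma vdm_mid {N : ℕ} {β : ℝ} (hβ : 0 < β) {x y : Fin N → ℝ}
    (hs : ∀ i j, 0 ≤ (x i - x j) * (y i - y j)) :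
    vdm β x * vdm β y ≤ vdm β (fun i => (x i + y i) / 2) ^ 2 := by
  unfold vdm
  rw [← Finset.prod_mul_distrib, ← Finset.prod_pow]
  refine Finset.prod_le_prod (fun p _ => by positivity) fun p _ => ?_
  set a := x p.1 - x p.2
  set b := y p.1 - y p.2
  have hab : 0 ≤ a * b := hs p.1 p.2
  have e : (x p.1 + y p.1) / 2 - (x p.2 + y p.2) / 2 = (a + b) / 2 := by simp only [a, b]; ring
  rw [e, ← Real.mul_rpow (abs_nonneg _) (abs_nonneg _), ← abs_mul, ← Real.rpow_natCast (_ ^ β),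
    ← Real.rpow_mul (abs_nonneg _), mul_comm β, Real.rpow_mul (abs_nonneg _), Real.rpow_natCast, sq_abs,
    abs_of_nonneg hab]
  refine Real.rpow_le_rpow hab ?_ hβ.le
  nlinarith [sq_nonneg (a - b)]

lemma pair_sq {N : ℕ} (v : Fin N → ℝ) : pairSum (fun t => t ^ 2) v ≤ N * ∑ i, v i ^ 2 := by
  have h := sum_pairs (fun t => t ^ 2) (by intro t; ring) v
  have h1 : ∑ i, ∑ j, (v i - v j) ^ 2 = 2 * (N * ∑ i, v i ^ 2) - 2 * (∑ i, v i) ^ 2 := by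
    have : ∀ i j, (v i - v j) ^ 2 = v i ^ 2 + v j ^ 2 - 2 * (v i * v j) := by intros; ring
    simp only [this, Finset.sum_sub_distrib, Finset.sum_add_distrib, Finset.sum_const, Finset.card_univ,
      Fintype.card_fin, nsmul_eq_mul, ← Finset.mul_sum, ← Finset.sum_mul]
    ring
  rw [h1] at h
  have := sq_nonneg (∑ i, v i)
  simp only [ne_eq, OfNat.ofNat_ne_zero, not_false_eq_true, zero_pow, mul_zero, add_zero] at h
  linarith

lemma Dat.weight_mid {β : ℝ} {Q h : ℝ → ℝ} {α M B : ℝ} (D : Dat β Q h α M B) {N : ℕ} {x y : Fin N → ℝ}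
    (hs : ∀ i j, 0 ≤ (x i - x j) * (y i - y j)) :
    weightH β Q h N x * weightH β Q h N y * Real.exp (N * (α - M) / 4 * ∑ i, (x i - y i) ^ 2)
      ≤ weightH β Q h N (fun i => (x i + y i) / 2) ^ 2 := by
  unfold weightH
  have hv := vdm_mid D.hβ hs
  set m : Fin N → ℝ := fun i => (x i + y i) / 2 with hm
  have hN : (0:ℝ) ≤ N := Nat.cast_nonneg N
  have hQ : ∑ j, Q (m j) ≤ (∑ j, Q (x j) + ∑ j, Q (y j)) / 2 - α / 8 * ∑ i, (x i - y i) ^ 2 := by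
    rw [← Finset.sum_add_distrib, Finset.sum_div, Finset.mul_sum, ← Finset.sum_sub_distrib]
    exact Finset.sum_le_sum fun i _ => mid_convex (D.Qs.of_le (by norm_num)) D.Q2 (x i) (y i)
  have hH : pairSum h m ≤ (pairSum h x + pairSum h y) / 2 + M / 8 * pairSum (fun t => t ^ 2) (fun i => x i - y i) := by
    unfold pairSum
    rw [← Finset.sum_add_distrib, Finset.sum_div, Finset.mul_sum, ← Finset.sum_add_distrib]
    refine Finset.sum_le_sum fun p _ => ?_
    have := mid_convex (D.hs.of_le (by norm_num)) (fun t => (abs_le.mp (D.h2 t)).1)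
      (x p.1 - x p.2) (y p.1 - y p.2)
    have e : m p.1 - m p.2 = (x p.1 - x p.2 + (y p.1 - y p.2)) / 2 := by simp only [hm]; ring
    rw [e]
    refine this.trans (le_of_eq ?_)
    ring
  have hp := pair_sq (fun i => x i - y i)
  have hp' := mul_le_mul_of_nonneg_left hp D.hM
  have hQ' := mul_le_mul_of_nonneg_left hQ hN
  calc _ = (vdm β x * vdm β y) * Real.exp ((-(N : ℝ) * ∑ j, Q (x j) - pairSum h x) +
        (-(N : ℝ) * ∑ j, Q (y j) - pairSum h y) + N * (α - M) / 4 * ∑ i, (x i - y i) ^ 2) := by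
        rw [Real.exp_add, Real.exp_add]; ring
    _ ≤ vdm β m ^ 2 * Real.exp (2 * (-(N : ℝ) * ∑ j, Q (m j) - pairSum h m)) := by
        gcongr
        linarith
    _ = _ := by
        rw [mul_pow, ← Real.exp_nat_mul]; norm_num

lemma Dat.weight_mid' {β : ℝ} {Q h : ℝ → ℝ} {α M B : ℝ} (D : Dat β Q h α M B) {N : ℕ} {x z : Fin N → ℝ}
    (hz : Function.Injective z) (hmax : ∀ x, weightH β Q h N x ≤ weightH β Q h N z)
    (hs : ∀ i j, 0 ≤ (x i - x j) * (z i - z j)) :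
    weightH β Q h N x * Real.exp (N * (α - M) / 4 * ∑ i, (x i - z i) ^ 2)
      ≤ weightH β Q h N (fun i => (x i + z i) / 2) := by
  have h1 := D.weight_mid hs
  have h2 := hmax (fun i => (x i + z i) / 2)
  have h3 := weight_pos (β := β) (Q := Q) (h := h) hz
  have h4 := weight_nonneg β Q h N (fun i => (x i + z i) / 2)
  have h5 : weightH β Q h N z * (weightH β Q h N x * Real.exp (N * (α - M) / 4 * ∑ i, (x i - z i) ^ 2))
      ≤ weightH β Q h N z * weightH β Q h N (fun i => (x i + z i) / 2) := by nlinarith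
  exact le_of_mul_le_mul_left h5 h3

lemma integral_mid {N : ℕ} (g : (Fin N → ℝ) → ℝ) (z : Fin N → ℝ) :
    ∫ x : Fin N → ℝ, g (fun i => (x i + z i) / 2) = 2 ^ N * ∫ x, g x := by
  have h1 := MeasureTheory.Measure.integral_comp_smul (volume : Measure (Fin N → ℝ)) g (1 / 2 : ℝ)
  have h2 := integral_add_right_eq_self (μ := (volume : Measure (Fin N → ℝ))) (fun x => g ((1 / 2 : ℝ) • x)) z
  have e : (fun x : Fin N → ℝ => g (fun i => (x i + z i) / 2)) = fun x => g ((1 / 2 : ℝ) • (x + z)) := by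
    ext x
    congr 1
    ext i
    simp
    ring
  rw [e, h2, h1]
  simp

lemma integrable_mid {N : ℕ} {g : (Fin N → ℝ) → ℝ} (hg : Integrable g) (z : Fin N → ℝ) :
    Integrable (fun x : Fin N → ℝ => g (fun i => (x i + z i) / 2)) := by
  have e : (fun x : Fin N → ℝ => g (fun i => (x i + z i) / 2)) = fun x => g ((1 / 2 : ℝ) • (x + z)) := by
    ext x
    congr 1
    ext i
    simp
    ring
  rw [e]
  have h1 := hg.comp_smul (R := (1 / 2 : ℝ)) (by norm_num)
  exact h1.comp_add_right z

lemma Dat.chamber {β : ℝ} {Q h : ℝ → ℝ} {α M B : ℝ} (D : Dat β Q h α M B) {N : ℕ} (hN : 0 < N)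
    {z : Fin N → ℝ}
    (hz : Function.Injective z) (hmax : ∀ x, weightH β Q h N x ≤ weightH β Q h N z)
    {K : Set (Fin N → ℝ)} (hK : MeasurableSet K) (hs : ∀ x ∈ K, ∀ i j, 0 ≤ (x i - x j) * (z i - z j))
    (hmid : ∀ x ∈ K, (fun i => (x i + z i) / 2) ∈ K) :
    ∫ x in K, weightH β Q h N x * ∑ i, (x i - z i) ^ 2 ≤ 4 * Real.log 2 / (α - M) * ∫ x in K, weightH β Q h N x := by
  have hc : 0 < α - M := sub_pos.mpr D.hMα
  have hN' : (0:ℝ) < N := Nat.cast_pos.mpr hN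
  set w := weightH β Q h N with hw
  have hwi : Integrable w := D.weight_int hN
  have hwsi : Integrable (fun x => w x * ∑ i, (x i - z i) ^ 2) := D.weight_sq_int hN z
  set κ := N * (α - M) / 4 with hκ
  have h1 : ∫ x in K, (2:ℝ) ^ N * ((1 - N * Real.log 2) * w x + κ * (w x * ∑ i, (x i - z i) ^ 2)) ≤
      ∫ x : Fin N → ℝ, K.indicator w (fun i => (x i + z i) / 2) := by
    rw [← integral_indicator hK]
    refine integral_mono ?_ ?_ ?_
    · exact (((hwi.const_mul _).add (hwsi.const_mul _)).const_mul _).indicator hK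
    · exact integrable_mid (hwi.indicator hK) z
    · intro x
      by_cases hx : x ∈ K
      · rw [Set.indicator_of_mem hx]
        simp only []
        rw [Set.indicator_of_mem (hmid x hx)]
        refine le_trans ?_ (D.weight_mid' hz hmax (hs x hx))
        set r := ∑ i, (x i - z i) ^ 2
        have h2 := Real.add_one_le_exp (κ * r - N * Real.log 2)
        have h3 : Real.exp (κ * r) = 2 ^ N * Real.exp (κ * r - N * Real.log 2) := by
          have : (2:ℝ) ^ N = Real.exp (N * Real.log 2) := by
            rw [Real.exp_nat_mul, Real.exp_log (by norm_num)]
          rw [this, ← Real.exp_add]; congr 1; ring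
        rw [h3]
        have h4 := weight_nonneg β Q h N x
        have h5 : w x * (κ * r - N * Real.log 2 + 1) ≤ w x * Real.exp (κ * r - N * Real.log 2) :=
          mul_le_mul_of_nonneg_left h2 h4
        have h6 : (0:ℝ) < 2 ^ N := by positivity
        have := mul_le_mul_of_nonneg_left h5 h6.le
        calc _ = _ := by ring
          _ ≤ _ := this
          _ = _ := by ring
      · rw [Set.indicator_of_notMem hx]
        exact Set.indicator_nonneg (fun y _ => weight_nonneg _ _ _ _ _) _
  rw [integral_mid, integral_indicator hK, integral_const_mul,
    integral_add (hwi.const_mul _).integrableOn (hwsi.const_mul _).integrableOn,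
    integral_const_mul, integral_const_mul] at h1
  have h2 := le_of_mul_le_mul_left h1 (by positivity)
  set I := ∫ x in K, w x
  set J := ∫ x in K, w x * ∑ i, (x i - z i) ^ 2
  have h3 : κ * J ≤ N * Real.log 2 * I := by linarith
  have h4 : κ * (4 * Real.log 2 / (α - M) * I) = N * Real.log 2 * I := by
    rw [hκ]; field_simp
  rw [← h4] at h3
  exact le_of_mul_le_mul_left h3 (by positivity)

lemma test_bound (f : BoundedContinuousFunction ℝ ℝ) (R : ℝ) {ε : ℝ} (hε : 0 < ε) :
    ∃ C, 0 ≤ C ∧ ∀ x y, |y| ≤ R → |f x - f y| ≤ ε + C * (x - y) ^ 2 := by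
  have hu := (isCompact_Icc (a := -R - 1) (b := R + 1)).uniformContinuousOn_of_continuous
    f.continuous.continuousOn
  rw [Metric.uniformContinuousOn_iff] at hu
  obtain ⟨δ, hδ, hu⟩ := hu ε hε
  set d := min δ 1
  have hd : 0 < d := lt_min hδ one_pos
  refine ⟨2 * ‖f‖ / d ^ 2, by positivity, fun x y hy => ?_⟩
  by_cases hxy : |x - y| < d
  · have h1 : |x - y| < 1 := hxy.trans_le (min_le_right _ _)
    rw [abs_lt] at h1
    rw [abs_le] at hy
    have := hu x ⟨by linarith, by linarith⟩ y ⟨by linarith, by linarith⟩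
      (by rw [Real.dist_eq]; exact hxy.trans_le (min_le_left _ _))
    rw [Real.dist_eq] at this
    have : 0 ≤ 2 * ‖f‖ / d ^ 2 * (x - y) ^ 2 := by positivity
    linarith
  · push Not at hxy
    have h1 : |f x - f y| ≤ 2 * ‖f‖ := by
      have := f.norm_coe_le_norm x
      have := f.norm_coe_le_norm y
      rw [Real.norm_eq_abs] at *
      exact (abs_sub _ _).trans (by linarith)
    have h2 : d ^ 2 ≤ (x - y) ^ 2 := by rw [← sq_abs (x - y)]; gcongr
    have h3 : 2 * ‖f‖ ≤ 2 * ‖f‖ / d ^ 2 * (x - y) ^ 2 := by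
      rw [div_mul_eq_mul_div, le_div_iff₀ (by positivity)]
      gcongr
    linarith

/-- Weyl chamber -/
def WC {N : ℕ} (σ : Equiv.Perm (Fin N)) : Set (Fin N → ℝ) := {x | StrictMono (x ∘ σ)}

lemma WC_meas {N : ℕ} (σ : Equiv.Perm (Fin N)) : MeasurableSet (WC σ) := by
  have : WC σ = ⋂ (i : Fin N) (j : Fin N) (_ : i < j), {x : Fin N → ℝ | x (σ i) < x (σ j)} := by
    ext x
    simp only [WC, StrictMono, Set.mem_ofPred_eq, Set.mem_iInter, Function.comp]
  rw [this]
  refine MeasurableSet.iInter fun i => MeasurableSet.iInter fun j => MeasurableSet.iInter fun _ => ?_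
  exact measurableSet_lt (measurable_pi_apply _) (measurable_pi_apply _)

lemma WC_disj {N : ℕ} : Pairwise (Function.onFun Disjoint (WC (N := N))) := by
  intro σ τ hne
  rw [Function.onFun, Set.disjoint_left]
  intro x h1 h2
  apply hne
  have h3 : StrictMono ((τ.symm ∘ σ : Fin N → Fin N)) := by
    intro a b hab
    have h4 := h1 hab
    have h5 : (x ∘ τ) (τ.symm (σ a)) < (x ∘ τ) (τ.symm (σ b)) := by simpa using h4
    exact h2.lt_iff_lt.mp h5
  have h6 : (τ.symm ∘ σ : Fin N → Fin N) = id := by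
    have hsurj : Function.Surjective (τ.symm ∘ σ : Fin N → Fin N) := τ.symm.surjective.comp σ.surjective
    exact (h3.range_inj strictMono_id).mp (by rw [hsurj.range_eq, Set.range_id])
  ext a
  have := congrFun h6 a
  simp only [Function.comp, id] at this
  rw [Equiv.symm_apply_eq] at this
  rw [this]

lemma ae_inj (N : ℕ) : ∀ᵐ x : Fin N → ℝ, Function.Injective x := by
  have h1 : ∀ i j : Fin N, i ≠ j → ∀ᵐ x : Fin N → ℝ, x i ≠ x j := by
    intro i j hij
    set L : (Fin N → ℝ) →ₗ[ℝ] ℝ := LinearMap.proj (R := ℝ) (φ := fun _ : Fin N => ℝ) i -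
      LinearMap.proj (R := ℝ) (φ := fun _ : Fin N => ℝ) j with hL
    have h2 := Measure.addHaar_submodule (volume : Measure (Fin N → ℝ)) (LinearMap.ker L) (by
      intro h
      have : (Pi.single i 1 : Fin N → ℝ) ∈ LinearMap.ker L := by rw [h]; trivial
      rw [LinearMap.mem_ker] at this
      simp [hL, Pi.single_eq_of_ne hij.symm] at this)
    rw [ae_iff]
    refine measure_mono_null ?_ h2
    intro x hx
    simp only [ne_eq, not_not, Set.mem_ofPred_eq] at hx
    simp [hL, hx]
  have h2 : ∀ᵐ x : Fin N → ℝ, ∀ i j : Fin N, i ≠ j → x i ≠ x j := by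
    rw [ae_all_iff]; intro i
    rw [ae_all_iff]; intro j
    by_cases h : i = j
    · exact Eventually.of_forall fun x hh => absurd h hh
    · filter_upwards [h1 i j h] with x hx _ using hx
  filter_upwards [h2] with x hx i j hij
  by_contra hne
  exact hx i j hne hij

lemma WC_cover (N : ℕ) : (⋃ σ : Equiv.Perm (Fin N), WC σ) =ᵐ[volume] (Set.univ : Set (Fin N → ℝ)) := by
  rw [eventuallyEq_univ]
  change ∀ᵐ x : Fin N → ℝ, x ∈ ⋃ σ : Equiv.Perm (Fin N), WC σ
  filter_upwards [ae_inj N] with x hx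
  rw [Set.mem_iUnion]
  exact ⟨Tuple.sort x, (Tuple.monotone_sort x).strictMono_of_injective (hx.comp (Tuple.sort x).injective)⟩

lemma integral_chambers {N : ℕ} {g : (Fin N → ℝ) → ℝ} (hg : Integrable g)
    (h : ∀ σ : Equiv.Perm (Fin N), ∫ x in WC σ, g x ≤ 0) : ∫ x, g x ≤ 0 := by
  rw [← setIntegral_univ, ← setIntegral_congr_set (WC_cover N),
    integral_iUnion_fintype WC_meas WC_disj (fun σ => hg.integrableOn)]
  exact Finset.sum_nonpos fun σ _ => h σ

lemma Dat.conc {β : ℝ} {Q h : ℝ → ℝ} {α M B : ℝ} (D : Dat β Q h α M B) {N : ℕ} (hN : 0 < N)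
    {z : Fin N → ℝ}
    (hz : StrictMono z) (hmax : ∀ x, weightH β Q h N x ≤ weightH β Q h N z) {R : ℝ} (hR : ∀ i, |z i| ≤ R)
    (f : BoundedContinuousFunction ℝ ℝ) {ε C : ℝ} (hC : 0 ≤ C)
    (hf : ∀ x y, |y| ≤ R → |f x - f y| ≤ ε + C * (x - y) ^ 2) :
    |∫ x, (∑ i, f (x i) - ∑ i, f (z i)) * weightH β Q h N x| ≤
      (N * ε + C * (4 * Real.log 2 / (α - M))) * ∫ x, weightH β Q h N x := by
  set w := weightH β Q h N with hw
  have hwc : Continuous w := weight_cont D.hβ D.Qs.continuous D.hs.continuous N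
  have hwi : Integrable w := D.weight_int hN
  set F : (Fin N → ℝ) → ℝ := fun x => ∑ i, f (x i) - ∑ i, f (z i) with hF
  have hFc : Continuous F := by
    simp only [hF]
    fun_prop
  have hFb : ∀ x, ‖F x‖ ≤ N * ‖f‖ + N * ‖f‖ := by
    intro x
    have : ∀ y : Fin N → ℝ, ‖∑ i, f (y i)‖ ≤ N * ‖f‖ := by
      intro y
      calc _ ≤ ∑ i, ‖f (y i)‖ := norm_sum_le _ _
        _ ≤ ∑ i : Fin N, ‖f‖ := Finset.sum_le_sum fun i _ => f.norm_coe_le_norm _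
        _ = _ := by simp
    exact (norm_sub_le _ _).trans (add_le_add (this _) (this _))
  have hFw : Integrable (fun x => F x * w x) :=
    hwi.bdd_mul hFc.aestronglyMeasurable (Eventually.of_forall hFb)
  set δ := N * ε + C * (4 * Real.log 2 / (α - M)) with hδ
  have hgi : Integrable (fun x => |F x * w x| - δ * w x) := hFw.abs.sub (hwi.const_mul _)
  have key : ∫ x, (|F x * w x| - δ * w x) ≤ 0 := by
    refine integral_chambers hgi fun σ => ?_
    set zs : Fin N → ℝ := z ∘ σ.symm with hzs
    have hzi : Function.Injective zs := hz.injective.comp σ.symm.injective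
    have hzmax : ∀ x, w x ≤ w zs := by
      intro x
      rw [hzs, hw, weight_perm D.hβ D.hev]
      exact hmax x
    have hzR : ∀ i, |zs i| ≤ R := fun i => hR _
    have hzsum : ∑ i, f (zs i) = ∑ i, f (z i) := Equiv.sum_comp σ.symm (fun i => f (z i))
    have hzK : zs ∈ WC σ := by
      have : zs ∘ σ = z := by ext i; simp [hzs]
      simp only [WC, Set.mem_ofPred_eq, this]; exact hz
    have hch := D.chamber hN hzi hzmax (WC_meas σ) (by
      intro x hx i j
      rw [← σ.apply_symm_apply i, ← σ.apply_symm_apply j]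
      rcases le_total (σ.symm i) (σ.symm j) with hij | hij
      · exact mul_nonneg_of_nonpos_of_nonpos (sub_nonpos.mpr (hx.monotone hij)) (sub_nonpos.mpr (hzK.monotone hij))
      · exact mul_nonneg (sub_nonneg.mpr (hx.monotone hij)) (sub_nonneg.mpr (hzK.monotone hij))) (by
      intro x hx a b hab
      have h1 := hx hab
      have h2 := hzK hab
      simp only [Function.comp] at h1 h2 ⊢
      linarith)
    have hsq := D.weight_sq_int hN zs
    have hb : ∀ x, |F x * w x| - δ * w x ≤ C * (w x * ∑ i, (x i - zs i) ^ 2) -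
        C * (4 * Real.log 2 / (α - M)) * w x := by
      intro x
      have h0 := weight_nonneg β Q h N x
      have h1 : |F x| ≤ N * ε + C * ∑ i, (x i - zs i) ^ 2 := by
        simp only [hF]
        rw [← hzsum, ← Finset.sum_sub_distrib]
        calc _ ≤ ∑ i, |f (x i) - f (zs i)| := Finset.abs_sum_le_sum_abs _ _
          _ ≤ ∑ i, (ε + C * (x i - zs i) ^ 2) := Finset.sum_le_sum fun i _ => hf _ _ (hzR i)
          _ = _ := by rw [Finset.sum_add_distrib, ← Finset.mul_sum]; simp
      rw [abs_mul, abs_of_nonneg h0]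
      have h2 := mul_le_mul_of_nonneg_right h1 h0
      rw [hδ]
      linarith
    calc ∫ x in WC σ, (|F x * w x| - δ * w x) ≤ ∫ x in WC σ, (C * (w x * ∑ i, (x i - zs i) ^ 2) -
        C * (4 * Real.log 2 / (α - M)) * w x) :=
          integral_mono hgi.integrableOn ((hsq.const_mul _).sub (hwi.const_mul _)).integrableOn hb
      _ = C * (∫ x in WC σ, w x * ∑ i, (x i - zs i) ^ 2) - C * (4 * Real.log 2 / (α - M)) * ∫ x in WC σ, w x := by
          rw [integral_sub (hsq.const_mul _).integrableOn (hwi.const_mul _).integrableOn,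
            integral_const_mul, integral_const_mul]
      _ ≤ 0 := by
          have := mul_le_mul_of_nonneg_left hch hC
          linarith
  rw [integral_sub hFw.abs (hwi.const_mul _), integral_const_mul] at key
  exact abs_integral_le_integral_abs.trans (by linarith)

lemma Dat.Z_pos {β : ℝ} {Q h : ℝ → ℝ} {α M B : ℝ} (D : Dat β Q h α M B) {N : ℕ} (hN : 0 < N) :
    0 < ∫ x, weightH β Q h N x := by
  have hwc : Continuous (weightH β Q h N) := weight_cont D.hβ D.Qs.continuous D.hs.continuous N
  obtain ⟨z, hz, -⟩ := D.exists_max hN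
  rw [integral_pos_iff_support_of_nonneg (fun x => weight_nonneg β Q h N x) (D.weight_int hN)]
  exact hwc.isOpen_support.measure_pos _ ⟨z, (weight_pos hz.injective).ne'⟩

lemma corr_one {n : ℕ} (P : (Fin (n+1) → ℝ) → ℝ) (f : ℝ → ℝ) (hi : Integrable (fun x => f (x 0) * P x)) :
    ∫ t : ℝ, f t * correlationFn (n+1) 1 P (fun _ => t) = ∫ x : Fin (n+1) → ℝ, f (x 0) * P x := by
  have mp := (volume_preserving_piFinSuccAbove (fun _ : Fin (n+1) => ℝ) 0).symm
  have h1 := mp.integral_comp' (g := fun x => f (x 0) * P x)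
  have h2 := (mp.integrable_comp_emb (MeasurableEquiv.measurableEmbedding _)).mpr hi
  rw [← h1]
  rw [Measure.volume_eq_prod] at h2 ⊢
  have h3 := integral_prod _ h2
  simp only [Function.comp] at h3
  rw [h3]
  refine integral_congr_ae (Eventually.of_forall fun t => ?_)
  simp only [correlationFn]
  rw [← integral_const_mul]
  refine integral_congr_ae (Eventually.of_forall fun y => ?_)
  have e : (fun i : Fin (n+1) => if hik : (i : ℕ) < 1 then t
        else y ⟨(i : ℕ) - 1, by have := i.isLt; omega⟩) = 
        (MeasurableEquiv.piFinSuccAbove (fun _ : Fin (n+1) => ℝ) 0).symm (t, y) := by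
    ext i
    refine Fin.cases ?_ (fun j => ?_) i
    · simp [MeasurableEquiv.piFinSuccAbove]
    · simp [MeasurableEquiv.piFinSuccAbove]
  have e0 : (MeasurableEquiv.piFinSuccAbove (fun _ : Fin (n+1) => ℝ) 0).symm (t, y) 0 = t := by
    rw [← e]; simp
  simp only []
  rw [e0]
  congr 2

lemma sym_one {n : ℕ} (P : (Fin (n+1) → ℝ) → ℝ) (hP : ∀ (σ : Equiv.Perm (Fin (n+1))) x, P (x ∘ σ) = P x)
    (f : ℝ → ℝ) (i : Fin (n+1)) :
    ∫ x : Fin (n+1) → ℝ, f (x i) * P x = ∫ x : Fin (n+1) → ℝ, f (x 0) * P x := by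
  have mp := volume_measurePreserving_piCongrLeft (fun _ : Fin (n+1) => ℝ) (Equiv.swap 0 i)
  have h1 := mp.integral_comp' (g := fun x => f (x i) * P x)
  rw [← h1]
  refine integral_congr_ae (Eventually.of_forall fun x => ?_)
  have e : (MeasurableEquiv.piCongrLeft (fun _ : Fin (n+1) => ℝ) (Equiv.swap 0 i)) x = x ∘ (Equiv.swap 0 i) := by
    ext j
    rw [MeasurableEquiv.coe_piCongrLeft, Equiv.piCongrLeft_apply, eqRec_eq_cast, cast_eq, Equiv.symm_swap]
    rfl
  beta_reduce
  rw [e, hP]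
  simp

lemma Dat.corr {β : ℝ} {Q h : ℝ → ℝ} {α M B : ℝ} (D : Dat β Q h α M B) {N : ℕ} (hN : 0 < N)
    {z : Fin N → ℝ}
    (hz : StrictMono z) (hmax : ∀ x, weightH β Q h N x ≤ weightH β Q h N z) {R : ℝ} (hR : ∀ i, |z i| ≤ R)
    (f : BoundedContinuousFunction ℝ ℝ) {ε C : ℝ} (hC : 0 ≤ C)
    (hf : ∀ x y, |y| ≤ R → |f x - f y| ≤ ε + C * (x - y) ^ 2) :
    |(∫ t : ℝ, f t * correlationFn N 1 (PH β Q h N) (fun _ => t)) - (∑ i, f (z i)) / N| ≤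
      ε + C * (4 * Real.log 2 / (α - M)) / N := by
  have hc := D.conc hN hz hmax hR f hC hf
  have hZ := D.Z_pos hN
  have hwc : Continuous (weightH β Q h N) := weight_cont D.hβ D.Qs.continuous D.hs.continuous N
  have hwi : Integrable (weightH β Q h N) := D.weight_int hN
  have hN' : (0:ℝ) < N := Nat.cast_pos.mpr hN
  have hi : ∀ i, Integrable (fun x : Fin N → ℝ => f (x i) * weightH β Q h N x) := fun i =>
    hwi.bdd_mul (f.continuous.comp (continuous_apply i)).aestronglyMeasurable
      (Eventually.of_forall fun x => f.norm_coe_le_norm _)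
  obtain ⟨n, rfl⟩ : ∃ n, N = n + 1 := ⟨N - 1, by omega⟩
  set w := weightH β Q h (n+1) with hw
  set Z := ∫ x, w x with hZd
  have h1 : ∫ t : ℝ, f t * correlationFn (n+1) 1 (PH β Q h (n+1)) (fun _ => t) = (∫ x, f (x 0) * w x) / Z := by
    have e : ∀ x : Fin (n+1) → ℝ, f (x 0) * PH β Q h (n+1) x = f (x 0) * w x / Z := by
      intro x; simp only [PH, ZH]; rw [← mul_div_assoc]
    rw [corr_one _ _ (by simp only [e]; exact (hi 0).div_const _)]
    simp only [e]
    rw [integral_div]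
  have h2 : ∫ x, (∑ i, f (x i) - ∑ i, f (z i)) * w x = (n+1 : ℕ) * (∫ x, f (x 0) * w x) - (∑ i, f (z i)) * Z := by
    have e : ∀ x : Fin (n+1) → ℝ, (∑ i, f (x i) - ∑ i, f (z i)) * w x = (∑ i, f (x i) * w x) - (∑ i, f (z i)) * w x := by
      intro x; rw [sub_mul, Finset.sum_mul]
    simp only [e]
    rw [integral_sub (integrable_finsetSum _ fun i _ => hi i) (hwi.const_mul _), integral_finsetSum _ (fun i _ => hi i),
      integral_const_mul]
    rw [Finset.sum_congr rfl (fun i _ => sym_one w (fun σ x => weight_perm D.hβ D.hev σ x) f i)]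
    rw [← hZd]
    simp
  rw [h2] at hc
  rw [h1]
  set I := ∫ x, f (x 0) * w x
  set S := ∑ i, f (z i)
  set K := 4 * Real.log 2 / (α - M)
  have e : I / Z - S / (n+1 : ℕ) = ((n+1:ℕ) * I - S * Z) / ((n+1:ℕ) * Z) := by
    field_simp
  rw [e, abs_div, abs_of_pos (mul_pos hN' hZ), div_le_iff₀ (mul_pos hN' hZ)]
  refine hc.trans (le_of_eq ?_)
  field_simp

lemma sum_div_range (N K : ℕ) (hK : 0 < K) (F : ℕ → ℝ) :
    ∑ l ∈ range (N * K), F (l / K) = K * ∑ j ∈ range N, F j := by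
  induction N with
  | zero => simp
  | succ n ih =>
    rw [Nat.succ_mul, Finset.sum_range_add, ih, Finset.sum_range_succ]
    have : ∀ x ∈ range K, F ((n * K + x) / K) = F n := by
      intro x hx
      rw [Finset.mem_range] at hx
      congr 1
      rw [mul_comm, Nat.mul_add_div hK, Nat.div_eq_of_lt hx, add_zero]
    rw [Finset.sum_congr rfl this]
    simp
    ring

lemma antisymm_sum (s : Finset ℕ) (o : ℕ → ℕ → ℝ) (ho : ∀ k l, o l k = - o k l) (d : ℕ → ℝ) :
    ∑ k ∈ s, ∑ l ∈ s, o k l * d k = 1 / 2 * ∑ k ∈ s, ∑ l ∈ s, o k l * (d k - d l) := by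
  have h1 : ∑ k ∈ s, ∑ l ∈ s, o k l * d l = - ∑ k ∈ s, ∑ l ∈ s, o k l * d k := by
    rw [Finset.sum_comm, ← Finset.sum_neg_distrib]
    refine Finset.sum_congr rfl fun k _ => ?_
    rw [← Finset.sum_neg_distrib]
    refine Finset.sum_congr rfl fun l _ => ?_
    rw [ho]; ring
  simp only [mul_sub, Finset.sum_sub_distrib, h1]
  ring

lemma inv_pair {a b : ℝ} (hab : 0 ≤ a * b) :
    (a⁻¹ - b⁻¹) * (a - b) ≤ (if a = 0 then 1 else 0) + (if b = 0 then 1 else 0) := by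
  by_cases ha : a = 0
  · by_cases hb : b = 0
    · simp [ha, hb]
    · simp [ha, hb]
  · by_cases hb : b = 0
    · simp [ha, hb]
    · have : 0 < a * b := lt_of_le_of_ne hab (mul_ne_zero ha hb).symm
      simp only [ha, hb, if_false, add_zero]
      have e : (a⁻¹ - b⁻¹) * (a - b) = -((a - b) ^ 2 / (a * b)) := by field_simp; ring
      rw [e]
      have : 0 ≤ (a - b) ^ 2 / (a * b) := by positivity
      linarith

lemma sq_range (T : ℕ) (v : ℕ → ℝ) :
    ∑ k ∈ range T, ∑ l ∈ range T, (v k - v l) ^ 2 ≤ 2 * (T * ∑ k ∈ range T, v k ^ 2) := by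
  have h1 : ∑ k ∈ range T, ∑ l ∈ range T, (v k - v l) ^ 2 =
      2 * (T * ∑ k ∈ range T, v k ^ 2) - 2 * (∑ k ∈ range T, v k) ^ 2 := by
    have : ∀ i j, (v i - v j) ^ 2 = v i ^ 2 + v j ^ 2 - 2 * (v i * v j) := by intros; ring
    simp only [this, Finset.sum_sub_distrib, Finset.sum_add_distrib, Finset.sum_const, Finset.card_range,
      nsmul_eq_mul, ← Finset.mul_sum, ← Finset.sum_mul]
    ring
  rw [h1]
  nlinarith [sq_nonneg (∑ k ∈ range T, v k)]

/-- critical point sequence -/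
structure Crit (β : ℝ) (Q h : ℝ → ℝ) (R : ℝ) (N : ℕ) (y : ℕ → ℝ) : Prop where
  mono : ∀ i j, i < j → j < N → y i < y j
  el : ∀ i, i < N → N * deriv Q (y i) + ∑ j ∈ range N, (deriv h (y i - y j) - β * (y i - y j)⁻¹) = 0
  bd : ∀ i, |y i| ≤ R

lemma Crit.mono' {β : ℝ} {Q h : ℝ → ℝ} {R : ℝ} {N : ℕ} {y : ℕ → ℝ} (C : Crit β Q h R N y)
    {i j : ℕ} (hij : i ≤ j) (hj : j < N) : y i ≤ y j := by
  rcases hij.eq_or_lt with rfl | h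
  · exact le_rfl
  · exact (C.mono i j h hj).le

lemma Crit.inj {β : ℝ} {Q h : ℝ → ℝ} {R : ℝ} {N : ℕ} {y : ℕ → ℝ} (C : Crit β Q h R N y)
    {i j : ℕ} (hi : i < N) (hj : j < N) : y i - y j = 0 ↔ i = j := by
  constructor
  · intro e
    rcases lt_trichotomy i j with h | h | h
    · have := C.mono i j h hj; linarith
    · exact h
    · have := C.mono j i h hi; linarith
  · rintro rfl; simp

lemma Crit.lift_el {β : ℝ} {Q h : ℝ → ℝ} {R : ℝ} {N : ℕ} {y : ℕ → ℝ} (C : Crit β Q h R N y)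
    {K : ℕ} (hK : 0 < K) {k : ℕ} (hk : k < N * K) :
    ((N * K : ℕ) : ℝ) * deriv Q (y (k / K)) + ∑ l ∈ range (N * K), (deriv h (y (k / K) - y (l / K)) -
      β * (y (k / K) - y (l / K))⁻¹) = 0 := by
  rw [sum_div_range N K hK (fun j => deriv h (y (k / K) - y j) - β * (y (k / K) - y j)⁻¹)]
  have h1 := C.el (k / K) ((Nat.div_lt_iff_lt_mul hK).mpr hk)
  push_cast
  linear_combination (K : ℝ) * h1

lemma Crit.lift_count {β : ℝ} {Q h : ℝ → ℝ} {R : ℝ} {N : ℕ} {y : ℕ → ℝ} (C : Crit β Q h R N y)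
    {K : ℕ} (hK : 0 < K) :
    ∑ k ∈ range (N * K), ∑ l ∈ range (N * K), (if y (k / K) - y (l / K) = 0 then (1:ℝ) else 0) =
      (N * K : ℕ) * K := by
  have : ∀ k ∈ range (N * K), ∑ l ∈ range (N * K), (if y (k / K) - y (l / K) = 0 then (1:ℝ) else 0) = K := by
    intro k hk
    rw [Finset.mem_range] at hk
    have hk' := (Nat.div_lt_iff_lt_mul hK).mpr hk
    rw [sum_div_range N K hK (fun j => if y (k / K) - y j = 0 then (1:ℝ) else 0)]
    have : ∀ j ∈ range N, (if y (k / K) - y j = 0 then (1:ℝ) else 0) = if k / K = j then 1 else 0 := by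
      intro j hj
      rw [Finset.mem_range] at hj
      simp only [C.inj hk' hj]
    rw [Finset.sum_congr rfl this, Finset.sum_ite_eq, if_pos (Finset.mem_range.mpr hk')]
    simp
  rw [Finset.sum_congr rfl this]
  simp

lemma core_est {β : ℝ} {Q h : ℝ → ℝ} {α M B : ℝ} (D : Dat β Q h α M B) {T : ℕ} {a b : ℕ → ℝ}
    (hs : ∀ k < T, ∀ l < T, 0 ≤ (a k - a l) * (b k - b l))
    (ha : ∀ k < T, (T : ℝ) * deriv Q (a k) + ∑ l ∈ range T, (deriv h (a k - a l) - β * (a k - a l)⁻¹) = 0)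
    (hb : ∀ k < T, (T : ℝ) * deriv Q (b k) + ∑ l ∈ range T, (deriv h (b k - b l) - β * (b k - b l)⁻¹) = 0) :
    (α - M) * (T * ∑ k ∈ range T, (a k - b k) ^ 2) ≤ β / 2 * (
      (∑ k ∈ range T, ∑ l ∈ range T, (if a k - a l = 0 then (1:ℝ) else 0)) + 
      ∑ k ∈ range T, ∑ l ∈ range T, (if b k - b l = 0 then (1:ℝ) else 0)) := by
  set d : ℕ → ℝ := fun k => a k - b k with hd
  set o : ℕ → ℕ → ℝ := fun k l => (deriv h (a k - a l) - β * (a k - a l)⁻¹) -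
    (deriv h (b k - b l) - β * (b k - b l)⁻¹) with ho
  have hodd : ∀ t, deriv h (-t) = - deriv h t := deriv_odd D.hev
  have hoa : ∀ k l, o l k = - o k l := by
    intro k l
    simp only [ho]
    rw [← neg_sub (a k), ← neg_sub (b k), hodd, hodd, inv_neg, inv_neg]
    ring
  have h0 : T * ∑ k ∈ range T, (deriv Q (a k) - deriv Q (b k)) * d k + ∑ k ∈ range T, ∑ l ∈ range T, o k l * d k = 0 := by
    rw [Finset.mul_sum, ← Finset.sum_add_distrib]
    refine Finset.sum_eq_zero fun k hk => ?_
    rw [Finset.mem_range] at hk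
    rw [← Finset.sum_mul]
    simp only [ho, Finset.sum_sub_distrib (f := fun l => deriv h (a k - a l) - β * (a k - a l)⁻¹)]
    linear_combination (ha k hk - hb k hk) * d k
  rw [antisymm_sum _ o hoa d] at h0
  have h1 : α * ∑ k ∈ range T, d k ^ 2 ≤ ∑ k ∈ range T, (deriv Q (a k) - deriv Q (b k)) * d k := by
    rw [Finset.mul_sum]
    exact Finset.sum_le_sum fun k _ => grad_mono (D.Qs.of_le (by norm_num)) D.Q2 _ _
  have h2 : ∑ k ∈ range T, ∑ l ∈ range T, (-M * (d k - d l) ^ 2 - β * ((if a k - a l = 0 then (1:ℝ) else 0) +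
      (if b k - b l = 0 then (1:ℝ) else 0))) ≤ ∑ k ∈ range T, ∑ l ∈ range T, o k l * (d k - d l) := by
    refine Finset.sum_le_sum fun k hk => Finset.sum_le_sum fun l hl => ?_
    rw [Finset.mem_range] at hk hl
    have e1 := grad_mono (D.hs.of_le (by norm_num)) (fun t => (abs_le.mp (D.h2 t)).1) (a k - a l) (b k - b l)
    have e2 := mul_le_mul_of_nonneg_left (inv_pair (hs k hk l hl)) D.hβ.le
    have e3 : d k - d l = (a k - a l) - (b k - b l) := by simp only [hd]; ring
    rw [e3]
    simp only [ho]
    linarith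
  simp only [Finset.sum_sub_distrib, mul_add, Finset.sum_add_distrib, ← Finset.mul_sum] at h2
  have h3 := mul_le_mul_of_nonneg_left (sq_range T d) D.hM
  have hT : (0:ℝ) ≤ T := Nat.cast_nonneg T
  have h4 := mul_le_mul_of_nonneg_left h1 hT
  have e : ∑ k ∈ range T, (a k - b k) ^ 2 = ∑ k ∈ range T, d k ^ 2 := rfl
  linarith

lemma Crit.compare {β : ℝ} {Q h : ℝ → ℝ} {α M B : ℝ} (D : Dat β Q h α M B) {R R' : ℝ} {N K : ℕ} {x y : ℕ → ℝ}
    (hN : 0 < N) (hK : 0 < K) (C : Crit β Q h R N x) (C' : Crit β Q h R' K y) :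
    (∑ k ∈ range (N * K), (x (k / K) - y (k / N)) ^ 2) / (N * K : ℕ) ≤ β / (2 * (α - M)) * (1 / N + 1 / K) := by
  have hc : 0 < α - M := sub_pos.mpr D.hMα
  have hN' : (0:ℝ) < N := Nat.cast_pos.mpr hN
  have hK' : (0:ℝ) < K := Nat.cast_pos.mpr hK
  have e : K * N = N * K := mul_comm _ _
  have h1 := core_est D (T := N * K) (a := fun k => x (k / K)) (b := fun k => y (k / N)) (by
    intro k hk l hl
    have i1 := (Nat.div_lt_iff_lt_mul hK).mpr hk
    have i2 := (Nat.div_lt_iff_lt_mul hK).mpr hl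
    have i3 := (Nat.div_lt_iff_lt_mul hN).mpr (e ▸ hk)
    have i4 := (Nat.div_lt_iff_lt_mul hN).mpr (e ▸ hl)
    rcases le_total k l with hkl | hkl
    · exact mul_nonneg_of_nonpos_of_nonpos (sub_nonpos.mpr (C.mono' (Nat.div_le_div_right hkl) i2))
        (sub_nonpos.mpr (C'.mono' (Nat.div_le_div_right hkl) i4))
    · exact mul_nonneg (sub_nonneg.mpr (C.mono' (Nat.div_le_div_right hkl) i1))
        (sub_nonneg.mpr (C'.mono' (Nat.div_le_div_right hkl) i3)))
    (fun k hk => C.lift_el hK hk) (by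
      intro k hk
      have := C'.lift_el hN (k := k) (e.symm ▸ hk)
      rwa [e] at this)
  have h2 := C'.lift_count hN
  rw [e] at h2
  rw [C.lift_count hK, h2] at h1
  set S := ∑ k ∈ range (N * K), (x (k / K) - y (k / N)) ^ 2
  push_cast at h1 ⊢
  rw [div_le_iff₀ (by positivity)]
  have e2 : β / (2 * (α - M)) * (1 / N + 1 / K) * ((N:ℝ) * K) = β / 2 * (N + K) / (α - M) := by
    field_simp; ring
  rw [e2, le_div_iff₀ hc]
  have hNK : (0:ℝ) < N * K := by positivity
  refine le_of_mul_le_mul_left ?_ hNK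
  linarith

lemma floor_int {E : Type*} [NormedAddCommGroup E] [NormedSpace ℝ E] [CompleteSpace E] {K : ℕ} (hK : 0 < K) (F : ℕ → E) :
    ∫ u in Set.Ico (0:ℝ) 1, F ⌊(K:ℝ) * u⌋₊ = (K:ℝ)⁻¹ • ∑ k ∈ range K, F k := by
  have hK' : (0:ℝ) < K := Nat.cast_pos.mpr hK
  rw [← integral_indicator measurableSet_Ico]
  have e : ∀ u : ℝ, (Set.Ico (0:ℝ) 1).indicator (fun u => F ⌊(K:ℝ) * u⌋₊) u =
      ∑ k ∈ range K, (Set.Ico ((k:ℝ) / K) ((k + 1) / K)).indicator (fun _ => F k) u := by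
    intro u
    by_cases hu : u ∈ Set.Ico (0:ℝ) 1
    · rw [Set.indicator_of_mem hu]
      have hk : ⌊(K:ℝ) * u⌋₊ ∈ range K := by
        rw [Finset.mem_range, Nat.floor_lt (by have := hu.1; positivity)]
        nlinarith [hu.2]
      rw [Finset.sum_eq_single_of_mem _ hk]
      · rw [Set.indicator_of_mem]
        have h0 : 0 ≤ (K:ℝ) * u := by have := hu.1; positivity
        constructor
        · rw [div_le_iff₀ hK', mul_comm u]; exact Nat.floor_le h0
        · rw [lt_div_iff₀ hK', mul_comm]; exact Nat.lt_floor_add_one _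
      · intro k _ hne
        rw [Set.indicator_of_notMem]
        rintro ⟨h1, h2⟩
        apply hne
        rw [div_le_iff₀ hK', mul_comm] at h1
        rw [lt_div_iff₀ hK', mul_comm] at h2
        exact ((Nat.floor_eq_iff (by have := hu.1; positivity)).mpr ⟨h1, h2⟩).symm
    · rw [Set.indicator_of_notMem hu]
      symm
      refine Finset.sum_eq_zero fun k hk => ?_
      rw [Set.indicator_of_notMem]
      rintro ⟨h1, h2⟩
      apply hu
      rw [Finset.mem_range] at hk
      refine ⟨le_trans (by positivity) h1, h2.trans_le ?_⟩
      rw [div_le_one hK']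
      exact_mod_cast hk
  simp only [e]
  rw [integral_finsetSum]
  · rw [Finset.smul_sum]
    refine Finset.sum_congr rfl fun k _ => ?_
    rw [integral_indicator measurableSet_Ico, setIntegral_const, Real.volume_real_Ico]
    congr 1
    rw [max_eq_left]
    · field_simp; ring
    · rw [← sub_div]; simp
  · intro k _
    exact (integrable_indicator_iff measurableSet_Ico).mpr (integrableOn_const (by simp))

lemma cauchy_lim {ν : Measure ℝ} [IsFiniteMeasure ν] {X : ℕ → ℝ → ℝ} {R C : ℝ} (hX : ∀ n, Measurable (X n))
    (hR : ∀ n u, |X n u| ≤ R)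
    (hC : ∀ n m, 0 < n → 0 < m → ∫ u, (X n u - X m u) ^ 2 ∂ν ≤ C * (1 / n + 1 / m)) :
    ∃ Y : ℝ → ℝ, Measurable Y ∧ (∀ u, |Y u| ≤ R) ∧ ∃ φ : ℕ → ℕ, StrictMono φ ∧
      ∀ᵐ u ∂ν, Tendsto (fun k => X (φ k) u) atTop (𝓝 (Y u)) := by
  have hR0 : 0 ≤ R := (abs_nonneg _).trans (hR 0 0)
  have hi : ∀ n, Integrable (X n) ν := fun n => 
    Integrable.of_bound (hX n).aestronglyMeasurable R (Eventually.of_forall fun u => hR n u)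
  have hd2 : ∀ n m, Integrable (fun u => (X n u - X m u) ^ 2) ν := fun n m =>
    Integrable.of_bound (((hX n).sub (hX m)).pow_const 2).aestronglyMeasurable ((2 * R) ^ 2)
      (Eventually.of_forall fun u => by
        rw [Real.norm_eq_abs, abs_pow]
        have := (abs_sub (X n u) (X m u)).trans (add_le_add (hR n u) (hR m u))
        exact pow_le_pow_left₀ (abs_nonneg _) (by linarith) 2)
  have hL1 : ∀ δ > 0, ∀ n m, 0 < n → 0 < m → ∫ u, |X n u - X m u| ∂ν ≤ δ * ν.real Set.univ + δ⁻¹ * (C * (1 / n + 1 / m)) := by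
    intro δ hδ n m hn hm
    calc ∫ u, |X n u - X m u| ∂ν ≤ ∫ u, (δ + δ⁻¹ * (X n u - X m u) ^ 2) ∂ν := by
          refine integral_mono ((hi n).sub (hi m)).abs ((integrable_const _).add ((hd2 n m).const_mul _)) fun u => ?_
          simp only []
          set a := |X n u - X m u|
          rw [← sq_abs]
          have : 0 ≤ δ⁻¹ * (a - δ) ^ 2 := by positivity
          have e : δ⁻¹ * (a - δ) ^ 2 = δ⁻¹ * a ^ 2 - 2 * a + δ := by field_simp; ring
          have : 0 ≤ a := abs_nonneg _
          change a ≤ δ + δ⁻¹ * a ^ 2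
          linarith
      _ = δ * ν.real Set.univ + δ⁻¹ * ∫ u, (X n u - X m u) ^ 2 ∂ν := by
          rw [integral_add (integrable_const _) ((hd2 n m).const_mul _), integral_const_mul, integral_const, smul_eq_mul, mul_comm δ]
      _ ≤ _ := by gcongr; exact hC n m hn hm
  have hcs : CauchySeq (fun n => (hi n).toL1 (X n)) := by
    rw [Metric.cauchySeq_iff]
    intro ε hε
    set V := ν.real Set.univ
    have hV : 0 ≤ V := measureReal_nonneg
    set δ := ε / (2 * (V + 1)) with hδd
    have hδ : 0 < δ := by positivity
    have hlim : Tendsto (fun n : ℕ => δ⁻¹ * (|C| * (2 * (1 / (n:ℝ))))) atTop (𝓝 0) := by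
      have := (((tendsto_one_div_atTop_nhds_zero_nat (𝕜 := ℝ)).const_mul 2).const_mul |C|).const_mul δ⁻¹
      simpa using this
    obtain ⟨n0, hn0⟩ := ((hlim.eventually (gt_mem_nhds (half_pos hε))).and (eventually_gt_atTop 0)).exists
    refine ⟨n0, fun m hm n hn => ?_⟩
    have hn0' : (0:ℝ) < n0 := Nat.cast_pos.mpr hn0.2
    rw [dist_eq_norm, ← Integrable.toL1_sub, L1.norm_of_fun_eq_integral_norm]
    have h1 := hL1 δ hδ m n (by have := hn0.2; omega) (by have := hn0.2; omega)
    have h2 : C * (1 / m + 1 / n) ≤ |C| * (2 * (1 / n0)) := by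
      have e1 : (1:ℝ) / m ≤ 1 / n0 := one_div_le_one_div_of_le hn0' (by exact_mod_cast hm)
      have e2 : (1:ℝ) / n ≤ 1 / n0 := one_div_le_one_div_of_le hn0' (by exact_mod_cast hn)
      calc C * (1 / m + 1 / n) ≤ |C| * (1 / m + 1 / n) := by gcongr; exact le_abs_self C
        _ ≤ _ := by gcongr; linarith
    have h3 := mul_le_mul_of_nonneg_left h2 (inv_nonneg.mpr hδ.le)
    have h4 : δ * V ≤ ε / 2 := by
      rw [hδd, div_mul_eq_mul_div, div_le_iff₀ (by positivity)]
      nlinarith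
    simp only [Pi.sub_apply, Real.norm_eq_abs]
    linarith [hn0.1]
  obtain ⟨Y0, hY0⟩ := cauchySeq_tendsto_of_complete hcs
  obtain ⟨φ, hφ, hae⟩ := (tendstoInMeasure_of_tendsto_Lp hY0).exists_seq_tendsto_ae
  have hYm : Measurable (Y0 : ℝ → ℝ) := (Lp.stronglyMeasurable Y0).measurable
  refine ⟨fun u => max (-R) (min R (Y0 u)), by fun_prop, fun u => ?_, φ, hφ, ?_⟩
  · rw [abs_le]; exact ⟨le_max_left _ _, max_le (by linarith) (min_le_left _ _)⟩
  · have h1 : ∀ᵐ u ∂ν, ∀ n, (hi n).toL1 (X n) u = X n u := by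
      rw [ae_all_iff]; exact fun n => (hi n).coeFn_toL1
    filter_upwards [hae, h1] with u hu h1
    simp only [h1] at hu
    have h2 : |Y0 u| ≤ R := le_of_tendsto hu.abs (Eventually.of_forall fun k => hR _ u)
    rw [abs_le] at h2
    rw [min_eq_right h2.2, max_eq_right h2.1]
    exact hu

lemma Dat.crit_exists {β : ℝ} {Q h : ℝ → ℝ} {α M B : ℝ} (D : Dat β Q h α M B) :
    ∃ R : ℝ, 0 < R ∧ ∃ y : ℕ → ℕ → ℝ, (∀ N i, |y N i| ≤ R) ∧ (∀ N, 0 < N → Crit β Q h R N (y N)) ∧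
      ∀ N, 0 < N → ∀ (f : BoundedContinuousFunction ℝ ℝ) (ε C : ℝ), 0 ≤ C →
        (∀ x y, |y| ≤ R → |f x - f y| ≤ ε + C * (x - y) ^ 2) →
        |(∫ t : ℝ, f t * correlationFn N 1 (PH β Q h N) (fun _ => t)) - (∑ i ∈ range N, f (y N i)) / N| ≤
          ε + C * (4 * Real.log 2 / (α - M)) / N := by
  obtain ⟨R, hR, hb⟩ := D.sup_bound
  have hex : ∀ N : ℕ, ∃ z : Fin N → ℝ, 0 < N → (StrictMono z ∧ ∀ x, weightH β Q h N x ≤ weightH β Q h N z) := by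
    intro N
    by_cases hN : 0 < N
    · obtain ⟨z, hz⟩ := D.exists_max hN
      exact ⟨z, fun _ => hz⟩
    · exact ⟨0, fun h => absurd h hN⟩
  choose z hz using hex
  set y : ℕ → ℕ → ℝ := fun N i => if hi : i < N then z N ⟨i, hi⟩ else 0 with hy
  have hyz : ∀ N (i : Fin N), y N i = z N i := by
    intro N i; simp [hy]
  have hyz' : ∀ N i (hi : i < N), y N i = z N ⟨i, hi⟩ := by
    intro N i hi; simp [hy, hi]
  have hzb : ∀ N, 0 < N → ∀ i, |z N i| ≤ R := fun N hN i => hb N (z N) (hz N hN).1.injective (hz N hN).2 i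
  have hyb : ∀ N i, |y N i| ≤ R := by
    intro N i
    by_cases hi : i < N
    · rw [hyz' N i hi]; exact hzb N (by omega) _
    · simp only [hy, hi, dite_false, abs_zero]; exact hR.le
  refine ⟨R, hR, y, hyb, fun N hN => ⟨?_, ?_, hyb N⟩, ?_⟩
  · intro i j hij hj
    rw [hyz' N i (hij.trans hj), hyz' N j hj]
    exact (hz N hN).1 hij
  · intro i hi
    have := D.EL (hz N hN).1.injective (hz N hN).2 ⟨i, hi⟩
    rw [Finset.sum_range (fun j => deriv h (y N i - y N j) - β * (y N i - y N j)⁻¹)]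
    simp only [hyz]
    rw [hyz' N i hi]
    exact this
  · intro N hN f ε C hC hf
    have := D.corr hN (hz N hN).1 (hz N hN).2 (hzb N hN) f hC hf
    rw [Finset.sum_range (fun i => f (y N i))]
    simp only [hyz]
    exact this

lemma im_ne {w : ℂ} (hw : 0 < w.im) (a : ℝ) : w - (a : ℂ) ≠ 0 := by
  intro h
  have := congrArg Complex.im h
  simp at this
  exact hw.ne' this

lemma norm_res {w : ℂ} (hw : 0 < w.im) (a : ℝ) : ‖(w - (a : ℂ))⁻¹‖ ≤ w.im⁻¹ := by
  rw [norm_inv]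
  refine inv_anti₀ hw ?_
  have := Complex.abs_im_le_norm (w - (a:ℂ))
  simp only [Complex.sub_im, Complex.ofReal_im, sub_zero] at this
  rwa [abs_of_pos hw] at this

lemma Crit.loop_sum {β : ℝ} {Q h : ℝ → ℝ} {R : ℝ} {N : ℕ} {y : ℕ → ℝ} (C : Crit β Q h R N y)
    {w : ℂ} (hw : 0 < w.im) :
    ∑ i ∈ range N, ((N * deriv Q (y i) + ∑ j ∈ range N, deriv h (y i - y j) : ℝ) : ℂ) * (w - (y i : ℂ))⁻¹ =
      (β : ℂ) / 2 * ((∑ i ∈ range N, (w - (y i : ℂ))⁻¹) ^ 2 - ∑ i ∈ range N, ((w - (y i : ℂ))⁻¹) ^ 2) := by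
  set g : ℕ → ℂ := fun i => (w - (y i : ℂ))⁻¹ with hg
  have h1 : ∀ i ∈ range N, ((N * deriv Q (y i) + ∑ j ∈ range N, deriv h (y i - y j) : ℝ) : ℂ) * g i =
      ∑ j ∈ range N, (β : ℂ) * (((y i - y j)⁻¹ : ℝ) : ℂ) * g i := by
    intro i hi
    rw [← Finset.sum_mul]
    congr 1
    have := C.el i (Finset.mem_range.mp hi)
    rw [Finset.sum_sub_distrib] at this
    have e : N * deriv Q (y i) + ∑ j ∈ range N, deriv h (y i - y j) = ∑ j ∈ range N, β * (y i - y j)⁻¹ := by linarith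
    rw [e]
    push_cast
    rfl
  rw [Finset.sum_congr rfl h1]
  set S := ∑ i ∈ range N, ∑ j ∈ range N, (β : ℂ) * (((y i - y j)⁻¹ : ℝ) : ℂ) * g i with hS
  have h2 : S = ∑ i ∈ range N, ∑ j ∈ range N, -((β : ℂ) * (((y i - y j)⁻¹ : ℝ) : ℂ) * g j) := by
    rw [hS, Finset.sum_comm]
    refine Finset.sum_congr rfl fun i _ => Finset.sum_congr rfl fun j _ => ?_
    rw [← neg_sub (y i) (y j), inv_neg]
    push_cast
    ring
  have h3 : S + S = ∑ i ∈ range N, ∑ j ∈ range N, (β : ℂ) * (g i * g j - if i = j then g i * g j else 0) := by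
    nth_rewrite 2 [h2]
    rw [hS, ← Finset.sum_add_distrib]
    refine Finset.sum_congr rfl fun i hi => ?_
    rw [← Finset.sum_add_distrib]
    refine Finset.sum_congr rfl fun j hj => ?_
    by_cases hij : i = j
    · subst hij; simp
    · rw [if_neg hij]
      have hne : y i - y j ≠ 0 := fun e => hij ((C.inj (Finset.mem_range.mp hi) (Finset.mem_range.mp hj)).mp e)
      have hne' : ((y i : ℂ) - y j) ≠ 0 := by exact_mod_cast hne
      have e1 := im_ne hw (y i)
      have e2 := im_ne hw (y j)
      have e3 : g i - g j = ((y i : ℂ) - y j) * (g i * g j) := by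
        simp only [hg]; field_simp; ring
      push_cast
      calc _ = (β : ℂ) * ((y i : ℂ) - y j)⁻¹ * (g i - g j) := by ring
        _ = _ := by rw [e3]; field_simp; ring
  have h4 : ∑ i ∈ range N, ∑ j ∈ range N, (β : ℂ) * (g i * g j - if i = j then g i * g j else 0) =
      β * ((∑ i ∈ range N, g i) ^ 2 - ∑ i ∈ range N, g i ^ 2) := by
    simp only [← Finset.mul_sum, Finset.sum_sub_distrib, sq]
    congr 2
    · rw [← Finset.sum_mul]
    · refine Finset.sum_congr rfl fun i hi => ?_
      rw [Finset.sum_ite_eq, if_pos hi]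
  rw [h4] at h3
  linear_combination h3 / 2

/-- quantile function -/
def Xf (N : ℕ) (y : ℕ → ℝ) (u : ℝ) : ℝ := y ⌊(N:ℝ) * u⌋₊

lemma Xf_meas (N : ℕ) (y : ℕ → ℝ) : Measurable (Xf N y) := by
  unfold Xf
  have : Measurable y := measurable_from_nat
  exact this.comp (Nat.measurable_floor.comp (measurable_id.const_mul _))

lemma Crit.loop_int {β : ℝ} {Q h : ℝ → ℝ} {R : ℝ} {N : ℕ} {y : ℕ → ℝ} (hN : 0 < N) (C : Crit β Q h R N y)
    {w : ℂ} (hw : 0 < w.im) :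
    ∫ u in Set.Ico (0:ℝ) 1, ((deriv Q (Xf N y u) + ∫ v in Set.Ico (0:ℝ) 1, deriv h (Xf N y u - Xf N y v) : ℝ) : ℂ)
        * (w - (Xf N y u : ℂ))⁻¹ =
      (β : ℂ) / 2 * ((∫ u in Set.Ico (0:ℝ) 1, (w - (Xf N y u : ℂ))⁻¹) ^ 2 -
        (N : ℂ)⁻¹ * ∫ u in Set.Ico (0:ℝ) 1, ((w - (Xf N y u : ℂ))⁻¹) ^ 2) := by
  have hN' : (N : ℂ) ≠ 0 := by exact_mod_cast hN.ne'
  have hN'' : (N : ℝ) ≠ 0 := by exact_mod_cast hN.ne'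
  unfold Xf
  have e1 : ∀ x : ℝ, ∫ v in Set.Ico (0:ℝ) 1, deriv h (x - y ⌊(N:ℝ) * v⌋₊) = (N:ℝ)⁻¹ • ∑ j ∈ range N, deriv h (x - y j) :=
    fun x => floor_int hN (fun j => deriv h (x - y j))
  simp only [e1]
  rw [floor_int hN (fun i => ((deriv Q (y i) + (N:ℝ)⁻¹ • ∑ j ∈ range N, deriv h (y i - y j) : ℝ) : ℂ) * (w - (y i : ℂ))⁻¹),
    floor_int hN (fun i => (w - (y i : ℂ))⁻¹), floor_int hN (fun i => ((w - (y i : ℂ))⁻¹) ^ 2)]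
  have h1 := C.loop_sum hw
  have e2 : ∀ i, ((deriv Q (y i) + (N:ℝ)⁻¹ • ∑ j ∈ range N, deriv h (y i - y j) : ℝ) : ℂ) * (w - (y i : ℂ))⁻¹ =
      (N : ℂ)⁻¹ * (((N * deriv Q (y i) + ∑ j ∈ range N, deriv h (y i - y j) : ℝ) : ℂ) * (w - (y i : ℂ))⁻¹) := by
    intro i
    rw [← mul_assoc]
    congr 1
    have : deriv Q (y i) + (N:ℝ)⁻¹ • ∑ j ∈ range N, deriv h (y i - y j) = 
      (N:ℝ)⁻¹ * (N * deriv Q (y i) + ∑ j ∈ range N, deriv h (y i - y j)) := by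
      rw [smul_eq_mul]; field_simp
    rw [this]; push_cast; rfl
  simp only [e2]
  rw [← Finset.mul_sum, h1]
  simp only [Complex.real_smul]
  push_cast
  ring

/-- convolution of a function with a measure -/
def cvl (μ : Measure ℝ) (φ : ℝ → ℝ) (x : ℝ) : ℝ := ∫ y, φ (x - y) ∂μ

lemma cvl_cont {μ : Measure ℝ} [IsFiniteMeasure μ] {φ : ℝ → ℝ} (hφ : Continuous φ) {B : ℝ}
    (hB : ∀ t, |φ t| ≤ B) : Continuous (cvl μ φ) := by
  unfold cvl
  refine continuous_of_dominated (bound := fun _ => B) ?_ ?_ (integrable_const _) ?_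
  · intro x; exact (by fun_prop : Continuous fun y => φ (x - y)).aestronglyMeasurable
  · intro x; exact Eventually.of_forall fun y => hB _
  · exact Eventually.of_forall fun y => by fun_prop

lemma cvl_deriv {μ : Measure ℝ} [IsFiniteMeasure μ] {φ : ℝ → ℝ} (hφ : ContDiff ℝ 1 φ) {B : ℝ}
    (hB : ∀ t, |φ t| ≤ B) (hB1 : ∀ t, |deriv φ t| ≤ B) (x : ℝ) : HasDerivAt (cvl μ φ) (cvl μ (deriv φ) x) x := by
  have hc : Continuous φ := hφ.continuous
  have hc1 : Continuous (deriv φ) := hφ.continuous_deriv (by norm_num)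
  refine (hasDerivAt_integral_of_dominated_loc_of_deriv_le (μ := μ) (F := fun x y => φ (x - y))
    (F' := fun x y => deriv φ (x - y)) (s := Set.univ) (bound := fun _ => B) (Filter.univ_mem) ?_ ?_ ?_ ?_ (integrable_const _) ?_).2
  · exact Eventually.of_forall fun x => (by fun_prop : Continuous fun y => φ (x - y)).aestronglyMeasurable
  · exact Integrable.of_bound (by fun_prop : Continuous fun y => φ (x - y)).aestronglyMeasurable B
      (Eventually.of_forall fun y => hB _)
  · exact (by fun_prop : Continuous fun y => deriv φ (x - y)).aestronglyMeasurable
  · exact Eventually.of_forall fun y x _ => hB1 _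
  · refine Eventually.of_forall fun y x _ => ?_
    have := ((hφ.differentiable (by norm_num)) (x - y)).hasDerivAt.comp_sub_const x y
    exact this

lemma cvl_smooth {μ : Measure ℝ} [IsFiniteMeasure μ] {B : ℝ} (n : ℕ) : ∀ {φ : ℝ → ℝ}, ContDiff ℝ n φ →
    (∀ m ≤ n, ∀ t, |iteratedDeriv m φ t| ≤ B) → ContDiff ℝ n (cvl μ φ) := by
  induction n with
  | zero =>
    intro φ hφ hB
    rw [Nat.cast_zero, contDiff_zero] at *
    exact cvl_cont hφ (fun t => by simpa using hB 0 le_rfl t)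
  | succ n ih =>
    intro φ hφ hB
    have h1 : ContDiff ℝ 1 φ := hφ.of_le (by exact_mod_cast Nat.le_add_left 1 n)
    have hd := cvl_deriv (μ := μ) h1 (fun t => by simpa using hB 0 (Nat.zero_le _) t)
      (fun t => by simpa using hB 1 (Nat.le_add_left 1 n) t)
    have hφ' := hφ
    push_cast at hφ' ⊢
    rw [contDiff_succ_iff_deriv] at hφ' ⊢
    refine ⟨fun x => (hd x).differentiableAt, by simp, ?_⟩
    have e : deriv (cvl μ φ) = cvl μ (deriv φ) := funext fun x => (hd x).deriv
    rw [e]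
    refine ih hφ'.2.2 fun m hm t => ?_
    rw [← iteratedDeriv_succ']
    exact hB (m + 1) (by omega) t

lemma Crit.compare_int {β : ℝ} {Q h : ℝ → ℝ} {α M B : ℝ} (D : Dat β Q h α M B) {R R' : ℝ} {N K : ℕ} {x y : ℕ → ℝ}
    (hN : 0 < N) (hK : 0 < K) (C : Crit β Q h R N x) (C' : Crit β Q h R' K y) :
    ∫ u in Set.Ico (0:ℝ) 1, (Xf N x u - Xf K y u) ^ 2 ≤ β / (2 * (α - M)) * (1 / N + 1 / K) := by
  refine le_trans (le_of_eq ?_) (Crit.compare D hN hK C C')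
  have hN' : (N : ℝ) ≠ 0 := by exact_mod_cast hN.ne'
  have hK' : (K : ℝ) ≠ 0 := by exact_mod_cast hK.ne'
  have e1 : ∀ u : ℝ, Xf N x u = x (⌊((N * K : ℕ) : ℝ) * u⌋₊ / K) := by
    intro u
    unfold Xf
    rw [← Nat.floor_div_natCast]
    congr 2
    push_cast
    field_simp
  have e2 : ∀ u : ℝ, Xf K y u = y (⌊((N * K : ℕ) : ℝ) * u⌋₊ / N) := by
    intro u
    unfold Xf
    rw [← Nat.floor_div_natCast]
    congr 2
    push_cast
    field_simp
  simp only [e1, e2]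
  rw [floor_int (Nat.mul_pos hN hK) (fun k => (x (k / K) - y (k / N)) ^ 2), smul_eq_mul, div_eq_inv_mul]

/-- Lebesgue measure on the unit interval -/
def nu : Measure ℝ := volume.restrict (Set.Ico (0:ℝ) 1)

lemma nu_prob : IsProbabilityMeasure nu := ⟨by simp [nu]⟩

lemma loop_limit {β : ℝ} {Q h : ℝ → ℝ} {R B : ℝ} {y : ℕ → ℕ → ℝ} {Y : ℝ → ℝ} {φ : ℕ → ℕ}
    (hQ : Continuous (deriv Q)) (hh : Continuous (deriv h)) (hB : ∀ t, |deriv h t| ≤ B)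
    (hy : ∀ N i, |y N i| ≤ R) (hC : ∀ N, 0 < N → Crit β Q h R N (y N)) 
    (hφ : StrictMono φ) (hl : ∀ᵐ u ∂nu, Tendsto (fun k => Xf (φ k) (y (φ k)) u) atTop (𝓝 (Y u)))
    {w : ℂ} (hw : 0 < w.im) :
    ∫ u, ((deriv Q (Y u) + ∫ v, deriv h (Y u - Y v) ∂nu : ℝ) : ℂ) * (w - (Y u : ℂ))⁻¹ ∂nu =
      (β : ℂ) / 2 * (∫ u, (w - (Y u : ℂ))⁻¹ ∂nu) ^ 2 := by
  have := nu_prob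
  set X : ℕ → ℝ → ℝ := fun k => Xf (φ k) (y (φ k)) with hX
  have hXm : ∀ k, Measurable (X k) := fun k => Xf_meas _ _
  have hXb : ∀ k u, |X k u| ≤ R := fun k u => hy _ _
  obtain ⟨q, hq⟩ := (isCompact_Icc (a := -R) (b := R)).exists_bound_of_continuousOn hQ.continuousOn
  have hB0 : 0 ≤ B := (abs_nonneg _).trans (hB 0)
  have hgc : Continuous (fun x : ℝ => (w - (x : ℂ))⁻¹) :=
    Continuous.inv₀ (by fun_prop) (fun x => im_ne hw x)
  have hcv : ∀ Z : ℝ → ℝ, Measurable Z → Continuous (fun x => ∫ v, deriv h (x - Z v) ∂nu) := by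
    intro Z hZ
    refine continuous_of_dominated (bound := fun _ => B) ?_ ?_ (integrable_const _) ?_
    · intro x; exact (hh.measurable.comp (hZ.const_sub x)).aestronglyMeasurable
    · intro x; exact Eventually.of_forall fun v => hB _
    · exact Eventually.of_forall fun v => by fun_prop
  have t1 : Tendsto (fun k => ∫ u, ((deriv Q (X k u) + ∫ v, deriv h (X k u - X k v) ∂nu : ℝ) : ℂ) * (w - (X k u : ℂ))⁻¹ ∂nu)
      atTop (𝓝 (∫ u, ((deriv Q (Y u) + ∫ v, deriv h (Y u - Y v) ∂nu : ℝ) : ℂ) * (w - (Y u : ℂ))⁻¹ ∂nu)) := by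
    refine tendsto_integral_of_dominated_convergence (fun _ => (q + B) * w.im⁻¹) ?_ (integrable_const _) ?_ ?_
    · intro k
      refine Measurable.aestronglyMeasurable ?_
      refine Measurable.mul ?_ (hgc.measurable.comp (hXm k))
      exact Complex.measurable_ofReal.comp ((hQ.measurable.comp (hXm k)).add ((hcv _ (hXm k)).measurable.comp (hXm k)))
    · intro k
      refine Eventually.of_forall fun u => ?_
      have h1 : |deriv Q (X k u)| ≤ q := hq _ (abs_le.mp (hXb k u))
      have h2 : ‖∫ v, deriv h (X k u - X k v) ∂nu‖ ≤ B := by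
        have := norm_integral_le_of_norm_le_const (μ := nu) (f := fun v => deriv h (X k u - X k v)) (C := B)
          (Eventually.of_forall fun v => hB _)
        simpa using this
      rw [norm_mul, Complex.norm_real]
      have h3 := norm_res hw (X k u)
      have h4 : ‖deriv Q (X k u) + ∫ v, deriv h (X k u - X k v) ∂nu‖ ≤ q + B := (norm_add_le _ _).trans (add_le_add h1 h2)
      exact mul_le_mul h4 h3 (norm_nonneg _) ((norm_nonneg _).trans h4)
    · filter_upwards [hl] with u hu
      refine Tendsto.mul ?_ ((hgc.tendsto _).comp hu)
      refine (Complex.continuous_ofReal.tendsto _).comp ?_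
      refine ((hQ.tendsto _).comp hu).add ?_
      refine tendsto_integral_of_dominated_convergence (fun _ => B) ?_ (integrable_const _) ?_ ?_
      · intro k; exact (hh.measurable.comp ((hXm k).const_sub _)).aestronglyMeasurable
      · intro k; exact Eventually.of_forall fun v => hB _
      · filter_upwards [hl] with v hv
        exact (hh.tendsto _).comp (hu.sub hv)
  have t2 : Tendsto (fun k => ∫ u, (w - (X k u : ℂ))⁻¹ ∂nu) atTop (𝓝 (∫ u, (w - (Y u : ℂ))⁻¹ ∂nu)) := by
    refine tendsto_integral_of_dominated_convergence (fun _ => w.im⁻¹) ?_ (integrable_const _) ?_ ?_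
    · intro k; exact (hgc.measurable.comp (hXm k)).aestronglyMeasurable
    · intro k; exact Eventually.of_forall fun u => norm_res hw _
    · filter_upwards [hl] with u hu
      exact (hgc.tendsto _).comp hu
  have t3 : Tendsto (fun k => ((φ k : ℕ) : ℂ)⁻¹ * ∫ u, ((w - (X k u : ℂ))⁻¹) ^ 2 ∂nu) atTop (𝓝 0) := by
    refine squeeze_zero_norm (a := fun k => ((φ k : ℕ) : ℝ)⁻¹ * (w.im⁻¹) ^ 2) (fun k => ?_) ?_
    · rw [norm_mul, norm_inv, Complex.norm_natCast]
      gcongr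
      have := norm_integral_le_of_norm_le_const (μ := nu) (f := fun u => ((w - (X k u : ℂ))⁻¹) ^ 2) (C := (w.im⁻¹) ^ 2)
        (Eventually.of_forall fun v => by rw [norm_pow]; gcongr; exact norm_res hw _)
      simpa using this
    · have := ((tendsto_inv_atTop_nhds_zero_nat (𝕜 := ℝ)).comp hφ.tendsto_atTop).mul_const ((w.im⁻¹) ^ 2)
      simpa [Function.comp_def] using this
  have t4 := ((t2.pow 2).sub t3).const_mul ((β:ℂ) / 2)
  rw [sub_zero] at t4
  refine tendsto_nhds_unique (t1.congr' ?_) t4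
  filter_upwards [eventually_gt_atTop 0] with k hk
  have hk' : 0 < φ k := lt_of_lt_of_le hk (hφ.id_le k)
  exact Crit.loop_int hk' (hC _ hk') hw

lemma Dat.limit {β : ℝ} {Q h : ℝ → ℝ} {α M B : ℝ} (D : Dat β Q h α M B) :
    ∃ (μ : Measure ℝ) (W : ℝ → ℝ) (R c : ℝ), LD μ W β R c ∧ ∀ f : BoundedContinuousFunction ℝ ℝ,
      Tendsto (fun N : ℕ => ∫ t : ℝ, f t * correlationFn N 1 (PH β Q h N) (fun _ => t)) atTop (𝓝 (∫ t, f t ∂μ)) := by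
  have := nu_prob
  obtain ⟨R, hR, y, hy, hC, hcorr⟩ := D.crit_exists
  have hc : 0 < α - M := sub_pos.mpr D.hMα
  set c0 := β / (2 * (α - M)) with hc0
  have hc0' : 0 ≤ c0 := by have := D.hβ; positivity
  have hcmp : ∀ n m, 0 < n → 0 < m → ∫ u, (Xf n (y n) u - Xf m (y m) u) ^ 2 ∂nu ≤ c0 * (1 / n + 1 / m) :=
    fun n m hn hm => Crit.compare_int D hn hm (hC n hn) (hC m hm)
  obtain ⟨Y, hYm, hYb, φ, hφ, hl⟩ := cauchy_lim (ν := nu) (X := fun n => Xf n (y n)) (R := R) (C := c0)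
    (fun n => Xf_meas _ _) (fun n u => hy _ _) hcmp
  set μ := nu.map Y with hμ
  have hμp : IsProbabilityMeasure μ := Measure.isProbabilityMeasure_map hYm.aemeasurable
  have hQc : Continuous (deriv Q) := D.Qs.continuous_deriv (by norm_num)
  have hhc : Continuous (deriv h) := D.hs.continuous_deriv (by norm_num)
  have hh4 : ContDiff ℝ 4 (deriv h) := by
    have := D.hs
    rw [show (5 : WithTop ℕ∞) = 4 + 1 by norm_num, contDiff_succ_iff_deriv] at this
    exact this.2.2
  have hQ4 : ContDiff ℝ 4 (deriv Q) := by
    have := D.Qs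
    rw [show (5 : WithTop ℕ∞) = 4 + 1 by norm_num, contDiff_succ_iff_deriv] at this
    exact this.2.2
  have hmapc : ∀ x, cvl μ (deriv h) x = ∫ v, deriv h (x - Y v) ∂nu := by
    intro x
    unfold cvl
    rw [hμ, integral_map hYm.aemeasurable]
    exact (by fun_prop : Continuous fun y => deriv h (x - y)).aestronglyMeasurable
  have hcvs : ContDiff ℝ 3 (cvl μ (deriv h)) := by
    refine cvl_smooth (B := B) 3 (hh4.of_le (by norm_num)) fun m hm t => ?_
    rw [← iteratedDeriv_succ']
    exact D.hB (m + 1) (by omega) t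
  set W : ℝ → ℝ := fun x => deriv Q x + cvl μ (deriv h) x with hW
  have hWs : ContDiff ℝ 3 W := (hQ4.of_le (by norm_num)).add hcvs
  refine ⟨μ, W, R, α - M, ⟨hμp, hR, ?_, D.hβ, hc, hWs, ?_, ?_⟩, ?_⟩
  · rw [hμ, ae_map_iff hYm.aemeasurable (measurableSet_le (by fun_prop) measurable_const)]
    exact Eventually.of_forall hYb
  · intro x
    have h1 : HasDerivAt (cvl μ (deriv h)) (cvl μ (deriv (deriv h)) x) x :=
      cvl_deriv (B := B) (hh4.of_le (by norm_num)) D.hb1 (fun t => by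
        have := D.hB 2 (by norm_num) t
        rwa [iteratedDeriv_succ, iteratedDeriv_one] at this) x
    have h2 : HasDerivAt (deriv Q) (deriv (deriv Q) x) x :=
      (hQ4.differentiable (by norm_num) x).hasDerivAt
    have hd : deriv W x = deriv (deriv Q) x + cvl μ (deriv (deriv h)) x := (h2.add h1).deriv
    rw [hd]
    have h3 : |cvl μ (deriv (deriv h)) x| ≤ M := by
      have := norm_integral_le_of_norm_le_const (μ := μ) (f := fun y => deriv (deriv h) (x - y)) (C := M)
        (Eventually.of_forall fun v => D.h2 _)
      simpa [cvl] using this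
    have := (abs_le.mp h3).1
    linarith [D.Q2 x]
  · intro w hw
    have h1 := loop_limit hQc hhc D.hb1 hy hC hφ hl hw
    have hgc : Continuous (fun x : ℝ => (w - (x : ℂ))⁻¹) :=
      Continuous.inv₀ (by fun_prop) (fun x => im_ne hw x)
    have hWg : Continuous (fun x : ℝ => (W x : ℂ) * (w - (x : ℂ))⁻¹) :=
      (Complex.continuous_ofReal.comp hWs.continuous).mul hgc
    have e1 := integral_map (μ := nu) hYm.aemeasurable (f := fun x : ℝ => (w - (x : ℂ))⁻¹) hgc.aestronglyMeasurable
    have e2 := integral_map (μ := nu) hYm.aemeasurable (f := fun x : ℝ => (W x : ℂ) * (w - (x : ℂ))⁻¹)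
      hWg.aestronglyMeasurable
    rw [hμ, e1, e2]
    simp only [hW, hmapc]
    rw [h1]
    have : (β : ℂ) ≠ 0 := by exact_mod_cast D.hβ.ne'
    push_cast
    field_simp
  · intro f
    have hfm : ∫ t, f t ∂μ = ∫ u, f (Y u) ∂nu := by
      rw [hμ, integral_map hYm.aemeasurable f.continuous.aestronglyMeasurable]
    have hsum : ∀ N, 0 < N → (∑ i ∈ range N, f (y N i)) / N = ∫ u, f (Xf N (y N) u) ∂nu := by
      intro N hN
      unfold Xf nu
      rw [floor_int hN (fun i => f (y N i)), smul_eq_mul, div_eq_inv_mul]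
    have hlimf : Tendsto (fun k => ∫ u, f (Xf (φ k) (y (φ k)) u) ∂nu) atTop (𝓝 (∫ u, f (Y u) ∂nu)) := by
      refine tendsto_integral_of_dominated_convergence (fun _ => ‖f‖) ?_ (integrable_const _) ?_ ?_
      · intro k; exact (f.continuous.measurable.comp (Xf_meas _ _)).aestronglyMeasurable
      · intro k; exact Eventually.of_forall fun u => f.norm_coe_le_norm _
      · filter_upwards [hl] with u hu
        exact (f.continuous.tendsto _).comp hu
    have hfi : ∀ n, Integrable (fun u => f (Xf n (y n) u)) nu := fun n =>
      Integrable.of_bound (f.continuous.measurable.comp (Xf_meas _ _)).aestronglyMeasurable ‖f‖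
        (Eventually.of_forall fun u => f.norm_coe_le_norm _)
    have hd2 : ∀ n m, Integrable (fun u => (Xf n (y n) u - Xf m (y m) u) ^ 2) nu := fun n m =>
      Integrable.of_bound (((Xf_meas n (y n)).sub (Xf_meas m (y m))).pow_const 2).aestronglyMeasurable ((2 * R) ^ 2)
        (Eventually.of_forall fun u => by
          rw [Real.norm_eq_abs, abs_pow]
          have : |Xf n (y n) u - Xf m (y m) u| ≤ R + R := (abs_sub _ _).trans (add_le_add (hy _ _) (hy _ _))
          exact pow_le_pow_left₀ (abs_nonneg _) (by linarith) 2)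
    rw [hfm, Metric.tendsto_atTop]
    intro ε hε
    obtain ⟨C, hC0, hf⟩ := test_bound f R (ε := ε / 4) (by positivity)
    have hstep : ∀ N, 0 < N → |(∫ u, f (Xf N (y N) u) ∂nu) - ∫ u, f (Y u) ∂nu| ≤ ε / 4 + C * (c0 * (1 / N)) := by
      intro N hN
      have l1 : Tendsto (fun k => |(∫ u, f (Xf N (y N) u) ∂nu) - ∫ u, f (Xf (φ k) (y (φ k)) u) ∂nu|) atTop
        (𝓝 (|(∫ u, f (Xf N (y N) u) ∂nu) - ∫ u, f (Y u) ∂nu|)) := (tendsto_const_nhds.sub hlimf).abs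
      have l2 : Tendsto (fun k => ε / 4 + C * (c0 * (1 / (N:ℝ) + 1 / (φ k : ℕ)))) atTop
          (𝓝 (ε / 4 + C * (c0 * (1 / N)))) := by
        have := (tendsto_one_div_atTop_nhds_zero_nat (𝕜 := ℝ)).comp hφ.tendsto_atTop
        have := (((this.const_add (1 / (N:ℝ))).const_mul c0).const_mul C).const_add (ε / 4)
        rw [add_zero] at this
        exact this
      refine le_of_tendsto_of_tendsto l1 l2 ?_
      filter_upwards [eventually_gt_atTop 0] with k hk
      have hk' : 0 < φ k := lt_of_lt_of_le hk (hφ.id_le k)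
      rw [← integral_sub (hfi _) (hfi _)]
      calc _ ≤ ∫ u, |f (Xf N (y N) u) - f (Xf (φ k) (y (φ k)) u)| ∂nu := abs_integral_le_integral_abs
        _ ≤ ∫ u, (ε / 4 + C * (Xf N (y N) u - Xf (φ k) (y (φ k)) u) ^ 2) ∂nu := by
            refine integral_mono ((hfi _).sub (hfi _)).abs ((integrable_const _).add ((hd2 _ _).const_mul _)) fun u => ?_
            exact hf _ _ (hy _ _)
        _ = ε / 4 + C * ∫ u, (Xf N (y N) u - Xf (φ k) (y (φ k)) u) ^ 2 ∂nu := by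
            rw [integral_add (integrable_const _) ((hd2 _ _).const_mul _), integral_const_mul, integral_const]
            simp
        _ ≤ _ := by gcongr; exact hcmp _ _ hN hk'
    set κ := 4 * Real.log 2 / (α - M)
    have hfin : Tendsto (fun N : ℕ => C * (c0 + κ) * (1 / (N:ℝ))) atTop (𝓝 0) := by
      simpa using (tendsto_one_div_atTop_nhds_zero_nat (𝕜 := ℝ)).const_mul (C * (c0 + κ))
    obtain ⟨N0, hN0⟩ := eventually_atTop.mp ((hfin.eventually (gt_mem_nhds (show (0:ℝ) < ε / 4 by positivity))).and (eventually_gt_atTop 0))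
    refine ⟨N0, fun N hN => ?_⟩
    obtain ⟨h1, h2⟩ := hN0 N hN
    have h3 := hcorr N h2 f (ε / 4) C hC0 hf
    rw [hsum N h2] at h3
    have h4 := hstep N h2
    rw [Real.dist_eq]
    have h5 := abs_sub_le (∫ t : ℝ, f t * correlationFn N 1 (PH β Q h N) (fun _ => t)) (∫ u, f (Xf N (y N) u) ∂nu) (∫ u, f (Y u) ∂nu)
    have e : C * (c0 + κ) * (1 / (N:ℝ)) = C * κ / N + C * (c0 * (1 / N)) := by ring
    linarith

/-- Theorem 1.1 of the paper: weak convergence of the first correlation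
measure of `P_{N,Q,β}^h` to a compactly supported probability measure with a non-zero
continuous density on the interior of its support. -/
theorem global_weak_convergence_first_correlation_measure
    (β : ℝ) (hβ : 0 < β) (h : ℝ → ℝ)
    (hAn : ∀ x : ℝ, AnalyticAt ℝ h x) (hEv : IsEvenFun h) (hSch : IsSchwartz h) :
    ∃ αh : ℝ, 0 ≤ αh ∧
      ∀ Q : ℝ → ℝ, (∀ x : ℝ, AnalyticAt ℝ Q x) → (∃ c > 0, ∀ t : ℝ, c ≤ iteratedDeriv 2 Q t) →
        IsEvenFun Q → αh < alphaQ Q →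
        ∃ g : ℝ → ℝ,
          -- `g` is the density of a compactly supported probability measure `μ_{Q,β}^h`
          (∀ t, 0 ≤ g t) ∧ Measurable g ∧ (∫ t : ℝ, g t) = 1 ∧ HasCompactSupport g ∧
          -- non-zero and continuous on the interior of its support
          ContinuousOn g (interior (tsupport g)) ∧
          (∀ t ∈ interior (tsupport g), g t ≠ 0) ∧
          -- weak convergence of the first correlation measure
          (∀ f : BoundedContinuousFunction ℝ ℝ,
            Tendsto
              (fun N : ℕ =>
                ∫ t : ℝ, f t * correlationFn N 1 (PH β Q h N) (fun _ => t))
              atTop (𝓝 (∫ t : ℝ, f t * g t))) := by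
  obtain ⟨H, hH⟩ := hSch
  have hHe : (H : ℝ → ℝ) = h := funext hH
  have hbd : ∀ n : ℕ, ∃ C, ∀ t, |iteratedDeriv n h t| ≤ C := by
    intro n
    obtain ⟨C, hC⟩ := H.decay' 0 n
    refine ⟨C, fun t => ?_⟩
    have := hC t
    change ‖t‖ ^ 0 * ‖iteratedFDeriv ℝ n (H : ℝ → ℝ) t‖ ≤ C at this
    rw [hHe, norm_iteratedFDeriv_eq_norm_iteratedDeriv, pow_zero, one_mul] at this
    exact this
  choose Cb hCb using hbd
  have hCb0 : ∀ n, 0 ≤ Cb n := fun n => (abs_nonneg _).trans (hCb n 0)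
  refine ⟨Cb 2, hCb0 2, ?_⟩
  intro Q hQa hQc hQe hα
  obtain ⟨c, hc, hcQ⟩ := hQc
  have it2 : ∀ (f : ℝ → ℝ) t, iteratedDeriv 2 f t = deriv (deriv f) t := by
    intro f t
    rw [iteratedDeriv_succ, iteratedDeriv_one]
  have hbdd : BddBelow (Set.range fun t => iteratedDeriv 2 Q t) := ⟨c, by rintro _ ⟨t, rfl⟩; exact hcQ t⟩
  have D : Dat β Q h (alphaQ Q) (Cb 2) (∑ n ∈ range 6, Cb n) :=
    { hβ := hβ
      Qs := contDiff_iff_contDiffAt.mpr fun x => (hQa x).contDiffAt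
      hs := contDiff_iff_contDiffAt.mpr fun x => (hAn x).contDiffAt
      Qev := hQe
      hev := hEv
      Q2 := fun t => by rw [← it2]; exact ciInf_le hbdd t
      h2 := fun t => by rw [← it2]; exact hCb 2 t
      hB := fun n hn t => (hCb n t).trans
        (Finset.single_le_sum (f := Cb) (fun i _ => hCb0 i) (Finset.mem_range.mpr (by omega)))
      hM := hCb0 2
      hMα := hα }
  obtain ⟨μ, W, R, c', L, hlim⟩ := D.limit
  have := L.prob
  refine ⟨gg μ W β, gg_nonneg μ W β, (gg_cont L).measurable, ?_, ?_, (gg_cont L).continuousOn,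
    fun t ht => gg_pos L ht, fun f => ?_⟩
  · have := inversion L (f := fun _ => 1) continuous_const (B := 1) (by simp)
    simpa using this.symm
  · refine HasCompactSupport.intro (isCompact_Icc (a := -R) (b := R)) fun x hx => ?_
    apply gg_zero L
    by_contra hcon
    push Not at hcon
    exact hx (abs_le.mp hcon)
  · rw [← inversion L f.continuous (B := ‖f‖) (fun x => f.norm_coe_le_norm x)]
    exact hlim f

end
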